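/- arXiv:0709.1774 — 3 statements merged into one kernel-verified Lean document; each statement's English description precedes it below -/
import Mathlib

section
/- Let n ≥ 1 and let F : [0,1] × S^n → ℝ^n be a continuous map. Define the solution set B := {(t,x) ∈ [0,1] × S^n : F(t,x) = F(t,−x)}. Then there exists a compact connected subset C ⊆ B such that C ∩ ({0} × S^n) ≠ ∅ and C ∩ ({1} × S^n) ≠ ∅. -/
/-- A point of the convex hull of a finite family is a convex combination of the family. -/
theorem mem_convexHull_range_iff_exists_sum {ι E : Type*} [Fintype ι] [AddCommGroup E] [Module ℝ E]
    (u : ι → E) (p : E) :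
    p ∈ convexHull ℝ (Set.range u) ↔
      ∃ c : ι → ℝ, (∀ k, 0 ≤ c k) ∧ ∑ k, c k = 1 ∧ ∑ k, c k • u k = p := by
  classical
  constructor
  · rw [convexHull_range_eq_exists_affineCombination]
    rintro ⟨s, c, hc, hs, rfl⟩
    refine ⟨fun k => if k ∈ s then c k else 0, fun k => ?_, ?_, ?_⟩
    · dsimp only
      split_ifs with h
      exacts [hc k h, le_rfl]
    · simpa using hs
    · rw [s.affineCombination_eq_linear_combination u c hs]
      simp [ite_smul]
  · rintro ⟨c, hc, hs, rfl⟩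
    exact (convex_convexHull ℝ _).sum_mem (fun k _ => hc k) hs
      fun k _ => subset_convexHull ℝ _ ⟨k, rfl⟩

/-- Among `n + 2` vectors of `ℝⁿ`, any `n` of which are linearly independent, the number of
subfamilies of `n + 1` vectors whose convex hull contains `0` is even. -/
theorem even_card_zero_mem_convexHull_succAbove {n : ℕ} (u : Fin (n + 2) → Fin n → ℝ)
    (hu : ∀ c : Fin (n + 2) → ℝ, ∑ k, c k • u k = 0 → ∀ i j, i ≠ j → c i = 0 → c j = 0 → c = 0)
    [DecidablePred fun i : Fin (n + 2) => 0 ∈ convexHull ℝ (Set.range (u ∘ i.succAbove))] :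
    Even (Finset.univ.filter
      fun i : Fin (n + 2) => 0 ∈ convexHull ℝ (Set.range (u ∘ i.succAbove))).card := by
  have key : ∀ i : Fin (n + 2), 0 ∈ convexHull ℝ (Set.range (u ∘ i.succAbove)) ↔
      ∃ c : Fin (n + 2) → ℝ, ∑ k, c k • u k = 0 ∧ c i = 0 ∧ ∀ k, k ≠ i → 0 < c k := by
    intro i
    rw [mem_convexHull_range_iff_exists_sum]
    constructor
    · rintro ⟨c, hc, hs, h0⟩
      set d : Fin (n + 2) → ℝ := i.insertNth 0 c with hd
      have hsum : ∑ k, d k • u k = 0 := by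
        rw [Fin.sum_univ_succAbove _ i]; simpa [hd] using h0
      refine ⟨d, hsum, by simp [hd], fun k hk => ?_⟩
      obtain ⟨l, rfl⟩ := Fin.exists_succAbove_eq hk
      have hdl : d (i.succAbove l) = c l := by simp [hd]
      rw [hdl]
      refine lt_of_le_of_ne (hc l) fun h => ?_
      have := hu d hsum i (i.succAbove l) (Fin.succAbove_ne i l).symm (by simp [hd])
        (by rw [hdl, ← h])
      have hc0 : ∀ l, c l = 0 := fun l => by
        have := congrFun this (i.succAbove l)
        simpa [hd] using this
      simp [hc0] at hs
    · rintro ⟨c, h0, hi, hpos⟩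
      have hp : 0 < ∑ l, c (i.succAbove l) :=
        Finset.sum_pos (fun l _ => hpos _ (Fin.succAbove_ne i l)) Finset.univ_nonempty
      refine ⟨fun l => (∑ l, c (i.succAbove l))⁻¹ * c (i.succAbove l), fun l =>
        mul_nonneg (inv_nonneg.2 hp.le) (hpos _ (Fin.succAbove_ne i l)).le, ?_, ?_⟩
      · rw [← Finset.mul_sum, inv_mul_cancel₀ hp.ne']
      · rw [Fin.sum_univ_succAbove _ i, hi, zero_smul, zero_add] at h0
        simp only [mul_smul, ← Finset.smul_sum, Function.comp, h0, smul_zero]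
  classical
  rw [Finset.filter_congr fun i _ => key i]
  clear key
  rw [← Nat.not_odd_iff_even]
  intro hodd
  obtain ⟨i, hi⟩ := Finset.card_pos.1 hodd.pos
  obtain ⟨c, hc0, hci, hc⟩ := (Finset.mem_filter.1 hi).2
  obtain ⟨j₀, hj₀⟩ := exists_ne i
  -- a relation with nonzero `i`-th coefficient
  obtain ⟨d, hd0, hdi⟩ : ∃ d : Fin (n + 2) → ℝ, ∑ k, d k • u k = 0 ∧ d i = 1 := by
    let f : (Fin (n + 2) → ℝ) →ₗ[ℝ] (Fin n → ℝ) × ℝ :=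
      (Fintype.linearCombination ℝ u).prod (LinearMap.proj j₀)
    have hf : ¬ Function.Injective f := fun h => by
      have := LinearMap.finrank_le_finrank_of_injective h
      simp at this
    obtain ⟨d, hd, hdne⟩ : ∃ d, f d = 0 ∧ d ≠ 0 := by
      rw [injective_iff_map_eq_zero] at hf
      push Not at hf
      exact hf
    have h1 : ∑ k, d k • u k = 0 := by
      simpa [f, Fintype.linearCombination_apply] using congrArg Prod.fst hd
    have h2 : d j₀ = 0 := by simpa [f] using congrArg Prod.snd hd
    have h3 : d i ≠ 0 := fun h => hdne (hu d h1 i j₀ hj₀.symm h h2)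
    refine ⟨fun k => (d i)⁻¹ * d k, ?_, inv_mul_cancel₀ h3⟩
    simp only [mul_smul, ← Finset.smul_sum, h1, smul_zero]
  -- the first zero along a ray leaving the facet opposite to `i`
  obtain ⟨j, hj, hmin⟩ := Finset.exists_max_image (Finset.univ.erase i) (fun k => -d k / c k)
    ⟨j₀, by simp [hj₀]⟩
  have hji : j ≠ i := (Finset.mem_erase.1 hj).1
  set M := -d j / c j
  have he0 : ∑ k, (d k + M * c k) • u k = 0 := by
    simp only [add_smul, mul_smul, Finset.sum_add_distrib, ← Finset.smul_sum, hd0, hc0, smul_zero,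
      add_zero]
  have hei : d i + M * c i = 1 := by rw [hci, hdi]; ring
  have hej : d j + M * c j = 0 := by
    have := (hc j hji).ne'
    simp only [M]; field_simp; ring
  have hepos : ∀ k, k ≠ j → 0 < d k + M * c k := by
    intro k hkj
    by_cases hki : k = i
    · rw [hki, hei]; exact one_pos
    have h1 := hmin k (by simp [hki])
    have h2 : 0 ≤ d k + M * c k := by
      have := (div_le_iff₀ (hc k hki)).1 h1
      linarith
    refine lt_of_le_of_ne h2 fun h => ?_
    have := congrFun (hu _ he0 j k hkj.symm hej h.symm) i
    simp only [hei, Pi.zero_apply, one_ne_zero] at this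
  have hset : (Finset.univ.filter fun i : Fin (n + 2) => ∃ c : Fin (n + 2) → ℝ,
      ∑ k, c k • u k = 0 ∧ c i = 0 ∧ ∀ k, k ≠ i → 0 < c k) = {i, j} := by
    ext k
    simp only [Finset.mem_filter, Finset.mem_univ, true_and, Finset.mem_insert,
      Finset.mem_singleton]
    constructor
    · rintro ⟨b, hb0, hbk, hb⟩
      by_contra! hk
      have hcj := hc j hji
      have h0 : ∑ l, (b l - b i * (d l + M * c l) - b j / c j * c l) • u l = 0 := by
        simp only [sub_smul, mul_smul, Finset.sum_sub_distrib, ← Finset.smul_sum, hc0, hb0, he0,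
          smul_zero, sub_zero]
      have h1 := congrFun (hu _ h0 i j hji.symm (by rw [hei, hci]; ring)
        (by rw [hej]; field_simp; ring)) k
      simp only [hbk, Pi.zero_apply] at h1
      have h2 : 0 < b i * (d k + M * c k) := mul_pos (hb i hk.1.symm) (hepos k hk.2)
      have h3 : 0 < b j / c j * c k := mul_pos (div_pos (hb j hk.2.symm) hcj) (hc k hk.1)
      linarith
    · rintro (rfl | rfl)
      · exact ⟨c, hc0, hci, hc⟩
      · exact ⟨_, he0, hej, hepos⟩
  rw [hset, Finset.card_pair hji.symm] at hodd
  exact absurd hodd (by decide)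

/-- The `k`-th vertex of the Kuhn simplex with base point `x` in which the coordinate `a` is
incremented at time `ρ a`. -/
def kuhnVertex {m : ℕ} (x : Fin m → ℤ) (ρ : Equiv.Perm (Fin m)) (k : Fin (m + 1)) : Fin m → ℤ :=
  fun a => x a + if (ρ a : ℕ) < k then 1 else 0

/-- The vertex set of the facet of a Kuhn simplex opposite to its `i`-th vertex. -/
def kuhnFacet {m : ℕ} (p : (Fin (m + 1) → ℤ) × Equiv.Perm (Fin (m + 1)) × Fin (m + 2)) :
    Set (Fin (m + 1) → ℤ) :=
  Set.range (kuhnVertex p.1 p.2.1 ∘ p.2.2.succAbove)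

theorem val_finRotate_symm {n : ℕ} (j : Fin (n + 1)) :
    (((finRotate (n + 1)).symm j : Fin (n + 1)) : ℕ) = if (j : ℕ) = 0 then n else (j : ℕ) - 1 := by
  obtain ⟨k, rfl⟩ := (finRotate (n + 1)).surjective j
  rw [Equiv.symm_apply_apply]
  by_cases hk : k = Fin.last n
  · subst hk; simp
  · rw [coe_finRotate_of_ne_last hk]; simp

theorem val_finRotate {n : ℕ} (j : Fin (n + 1)) :
    ((finRotate (n + 1) j : Fin (n + 1)) : ℕ) = if (j : ℕ) = n then 0 else (j : ℕ) + 1 := by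
  by_cases hk : j = Fin.last n
  · subst hk; simp
  · rw [coe_finRotate_of_ne_last hk, if_neg]
    exact fun h => hk (Fin.ext h)

/-- The Kuhn simplex on the other side of a facet, with the index of that facet. -/
def kuhnNeighbor {m : ℕ} (p : (Fin (m + 1) → ℤ) × Equiv.Perm (Fin (m + 1)) × Fin (m + 2)) :
    (Fin (m + 1) → ℤ) × Equiv.Perm (Fin (m + 1)) × Fin (m + 2) :=
  if h0 : p.2.2 = 0 then
    (fun a => p.1 a + if (p.2.1 a : ℕ) = 0 then 1 else 0,
      p.2.1.trans (finRotate (m + 1)).symm, Fin.last (m + 1))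
  else if hl : p.2.2 = Fin.last (m + 1) then
    (fun a => p.1 a - if (p.2.1 a : ℕ) = m then 1 else 0, p.2.1.trans (finRotate (m + 1)), 0)
  else (p.1, p.2.1.trans (Equiv.swap (p.2.2.pred h0) (p.2.2.castPred hl)), p.2.2)

theorem kuhnNeighbor_zero {m : ℕ} (x : Fin (m + 1) → ℤ) (ρ : Equiv.Perm (Fin (m + 1))) :
    kuhnNeighbor (x, ρ, 0) = (fun a => x a + if (ρ a : ℕ) = 0 then 1 else 0,
      ρ.trans (finRotate (m + 1)).symm, Fin.last (m + 1)) := by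
  simp [kuhnNeighbor]

theorem kuhnNeighbor_last {m : ℕ} (x : Fin (m + 1) → ℤ) (ρ : Equiv.Perm (Fin (m + 1))) :
    kuhnNeighbor (x, ρ, Fin.last (m + 1)) = (fun a => x a - if (ρ a : ℕ) = m then 1 else 0,
      ρ.trans (finRotate (m + 1)), 0) := by
  simp [kuhnNeighbor]

theorem kuhnNeighbor_middle {m : ℕ} (x : Fin (m + 1) → ℤ) (ρ : Equiv.Perm (Fin (m + 1)))
    (i : Fin (m + 2)) (h0 : i ≠ 0) (hl : i ≠ Fin.last (m + 1)) :
    kuhnNeighbor (x, ρ, i) = (x, ρ.trans (Equiv.swap (i.pred h0) (i.castPred hl)), i) := by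
  simp [kuhnNeighbor, h0, hl]

theorem kuhnNeighbor_kuhnNeighbor {m : ℕ}
    (p : (Fin (m + 1) → ℤ) × Equiv.Perm (Fin (m + 1)) × Fin (m + 2)) :
    kuhnNeighbor (kuhnNeighbor p) = p := by
  obtain ⟨x, ρ, i⟩ := p
  by_cases h0 : i = 0
  · subst h0
    rw [kuhnNeighbor_zero, kuhnNeighbor_last]
    refine Prod.ext (funext fun a => ?_) (Prod.ext (Equiv.ext fun a => by simp) rfl)
    have := (ρ a).isLt
    simp only [Equiv.trans_apply, val_finRotate_symm]
    split_ifs <;> omega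
  by_cases hl : i = Fin.last (m + 1)
  · subst hl
    rw [kuhnNeighbor_last, kuhnNeighbor_zero]
    refine Prod.ext (funext fun a => ?_) (Prod.ext (Equiv.ext fun a => by simp) rfl)
    have := (ρ a).isLt
    simp only [Equiv.trans_apply, val_finRotate]
    split_ifs <;> first | omega | contradiction
  · rw [kuhnNeighbor_middle x ρ i h0 hl, kuhnNeighbor_middle _ _ i h0 hl]
    simp [Equiv.trans_assoc]

theorem kuhnNeighbor_ne {m : ℕ}
    (p : (Fin (m + 1) → ℤ) × Equiv.Perm (Fin (m + 1)) × Fin (m + 2)) :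
    kuhnNeighbor p ≠ p := by
  obtain ⟨x, ρ, i⟩ := p
  intro h
  by_cases h0 : i = 0
  · subst h0
    rw [kuhnNeighbor_zero] at h
    simp at h
  by_cases hl : i = Fin.last (m + 1)
  · subst hl
    rw [kuhnNeighbor_last] at h
    have := congrArg (fun q => (q.2.2 : ℕ)) h
    simp at this
  · rw [kuhnNeighbor_middle x ρ i h0 hl] at h
    have h1 := congrArg (fun q => ((q.2.1 (ρ.symm (i.pred h0)) : Fin (m + 1)) : ℕ)) h
    have h2 : (i : ℕ) ≠ 0 := fun h => h0 (Fin.ext h)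
    simp at h1
    omega

theorem kuhnFacet_kuhnNeighbor {m : ℕ}
    (p : (Fin (m + 1) → ℤ) × Equiv.Perm (Fin (m + 1)) × Fin (m + 2)) :
    kuhnFacet (kuhnNeighbor p) = kuhnFacet p := by
  have zero : ∀ (x : Fin (m + 1) → ℤ) (ρ : Equiv.Perm (Fin (m + 1))),
      kuhnFacet (kuhnNeighbor (x, ρ, 0)) = kuhnFacet (x, ρ, 0) := by
    intro x ρ
    rw [kuhnNeighbor_zero]
    simp only [kuhnFacet]
    congr 1
    funext l a
    have := (ρ a).isLt
    have := l.isLt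
    simp only [Function.comp, Fin.succAbove_last, Fin.succAbove_zero, kuhnVertex,
      Equiv.trans_apply, val_finRotate_symm, Fin.val_castSucc, Fin.val_succ]
    split_ifs <;> omega
  obtain ⟨x, ρ, i⟩ := p
  by_cases h0 : i = 0
  · subst h0; exact zero x ρ
  by_cases hl : i = Fin.last (m + 1)
  · subst hl
    obtain ⟨x', ρ', h⟩ : ∃ x' ρ', kuhnNeighbor (x, ρ, Fin.last (m + 1)) = (x', ρ', 0) :=
      ⟨_, _, kuhnNeighbor_last x ρ⟩
    rw [h, ← zero, ← h, kuhnNeighbor_kuhnNeighbor]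
  · rw [kuhnNeighbor_middle x ρ i h0 hl]
    simp only [kuhnFacet]
    congr 1
    funext l a
    have h1 : (i.succAbove l : ℕ) ≠ i := fun h => Fin.succAbove_ne i l (Fin.ext h)
    have h2 : (i : ℕ) ≠ 0 := fun h => h0 (Fin.ext h)
    simp only [Function.comp, kuhnVertex, Equiv.trans_apply, Equiv.swap_apply_def, Fin.ext_iff,
      Fin.val_pred, Fin.coe_castPred]
    split_ifs <;> simp_all <;> omega

theorem abs_kuhnNeighbor_sub_le {m : ℕ}
    (p : (Fin (m + 1) → ℤ) × Equiv.Perm (Fin (m + 1)) × Fin (m + 2)) (a : Fin (m + 1)) :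
    |(kuhnNeighbor p).1 a - p.1 a| ≤ 1 := by
  unfold kuhnNeighbor
  split_ifs with h0 hl <;> dsimp only <;> (try split_ifs) <;> simp

/-- The facet opposite to the facet with index `Fin.last` under `v ↦ -v`, for simplices whose last
step is in the direction `0`. -/
def kuhnNeg {m : ℕ} (p : (Fin (m + 1) → ℤ) × Equiv.Perm (Fin (m + 1)) × Fin (m + 2)) :
    (Fin (m + 1) → ℤ) × Equiv.Perm (Fin (m + 1)) × Fin (m + 2) :=
  (-kuhnVertex p.1 p.2.1 (Fin.last m).castSucc,
    p.2.1.trans (Fin.revPerm.trans (finRotate (m + 1)).symm), p.2.2)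

theorem val_finRotate_symm_revPerm {n : ℕ} (j : Fin (n + 1)) :
    (((finRotate (n + 1)).symm (Fin.revPerm j) : Fin (n + 1)) : ℕ) =
      if (j : ℕ) = n then n else n - 1 - j := by
  have := j.isLt
  rw [val_finRotate_symm]
  simp only [Fin.revPerm_apply, Fin.val_rev]
  split_ifs <;> omega

theorem kuhnNeg_kuhnNeg {m : ℕ}
    (p : (Fin (m + 1) → ℤ) × Equiv.Perm (Fin (m + 1)) × Fin (m + 2)) :
    kuhnNeg (kuhnNeg p) = p := by
  obtain ⟨x, ρ, i⟩ := p
  refine Prod.ext (funext fun a => ?_) (Prod.ext (Equiv.ext fun a => Fin.ext ?_) rfl)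
  · have := (ρ a).isLt
    simp only [kuhnNeg, kuhnVertex, Pi.neg_apply, Equiv.trans_apply, val_finRotate_symm_revPerm,
      Fin.val_castSucc, Fin.val_last]
    split_ifs <;> omega
  · have := (ρ a).isLt
    simp only [kuhnNeg, Equiv.trans_apply, val_finRotate_symm_revPerm]
    split_ifs <;> omega

theorem kuhnNeg_ne {m : ℕ} (hm : 1 ≤ m)
    (p : (Fin (m + 1) → ℤ) × Equiv.Perm (Fin (m + 1)) × Fin (m + 2)) :
    kuhnNeg p ≠ p := by
  intro h
  have h1 := congrFun (congrArg Prod.fst h) (p.2.1.symm 0)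
  simp [kuhnNeg, kuhnVertex] at h1
  split_ifs at h1 <;> omega

theorem kuhnVertex_kuhnNeg {m : ℕ} (x : Fin (m + 1) → ℤ) (ρ : Equiv.Perm (Fin (m + 1)))
    (i : Fin (m + 2)) (l : Fin (m + 1)) :
    kuhnVertex (kuhnNeg (x, ρ, i)).1 (kuhnNeg (x, ρ, i)).2.1 l.castSucc =
      -kuhnVertex x ρ l.rev.castSucc := by
  funext a
  have := (ρ a).isLt
  have := l.isLt
  simp only [kuhnNeg, kuhnVertex, Pi.neg_apply, Equiv.trans_apply, val_finRotate_symm_revPerm,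
    Fin.val_castSucc, Fin.val_last, Fin.val_rev]
  split_ifs <;> omega

theorem kuhnFacet_kuhnNeg {m : ℕ} (x : Fin (m + 1) → ℤ) (ρ : Equiv.Perm (Fin (m + 1))) :
    kuhnFacet (kuhnNeg (x, ρ, Fin.last (m + 1))) = -kuhnFacet (x, ρ, Fin.last (m + 1)) := by
  ext v
  simp only [kuhnFacet, Set.mem_neg, Set.mem_range, Function.comp]
  change (∃ y, kuhnVertex (kuhnNeg (x, ρ, Fin.last (m + 1))).1
    (kuhnNeg (x, ρ, Fin.last (m + 1))).2.1 ((Fin.last (m + 1)).succAbove y) = v) ↔ _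
  simp only [Fin.succAbove_last, kuhnVertex_kuhnNeg]
  constructor
  · rintro ⟨l, rfl⟩; exact ⟨l.rev, by simp⟩
  · rintro ⟨l, hl⟩; exact ⟨l.rev, by simp [hl]⟩

theorem Finset.even_card_of_involution {α : Type*} (s : Finset α) (g : α → α)
    (hmem : ∀ a ∈ s, g a ∈ s) (hne : ∀ a ∈ s, g a ≠ a) (hg : ∀ a ∈ s, g (g a) = a) :
    Even s.card := by
  rw [← ZMod.natCast_eq_zero_iff_even, Finset.card_eq_sum_ones, Nat.cast_sum]
  exact Finset.sum_involution (fun a _ => g a) (fun _ _ => by decide) (fun a ha _ => hne a ha)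
    hmem hg

theorem StrictMono.fin_apply_eq {n : ℕ} {f : Fin n → Fin n} (hf : StrictMono f) (a : Fin n) :
    f a = a :=
  le_antisymm hf.apply_le hf.le_apply

/-- A labelling of the lattice that is close to the projection `v ↦ (v₁, …, vₙ)` near the origin
of the hyperplane `v₀ = 0`, but takes the value `(-n, …, -1)` at the origin, has at most one zero
simplex containing the origin in this hyperplane. -/
theorem eq_of_zero_mem_of_near_projection {n : ℕ} (hn : 1 ≤ n)
    (w : (Fin (n + 1) → ℤ) → Fin n → ℝ) (hcenter : ∀ a, w 0 a = -((n : ℝ) - (a : ℕ)))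
    (hstar : ∀ v : Fin (n + 1) → ℤ, (∀ a, |v a| ≤ 1) → v 0 = 0 → v ≠ 0 →
      ∀ a, |w v a - v a.succ| ≤ 1 / (4 * (n + 1)))
    (x : Fin (n + 1) → ℤ) (ρ : Equiv.Perm (Fin (n + 1))) (hρ : (ρ 0 : ℕ) = n)
    (h0 : (0 : Fin (n + 1) → ℤ) ∈ kuhnFacet (x, ρ, Fin.last (n + 1)))
    (hdoor : 0 ∈ convexHull ℝ (w '' kuhnFacet (x, ρ, Fin.last (n + 1)))) :
    x = 0 ∧ ρ = (finRotate (n + 1)).symm := by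
  simp only [kuhnFacet, ← Set.range_comp] at hdoor
  rw [mem_convexHull_range_iff_exists_sum] at hdoor
  obtain ⟨β, hβ, hβ1, hβ0⟩ := hdoor
  simp only [Function.comp, Fin.succAbove_last] at hβ0
  obtain ⟨l, hl⟩ := h0
  simp only [Function.comp, Fin.succAbove_last] at hl
  set ε : ℝ := 1 / (4 * (n + 1)) with hε
  have hn' : (1 : ℝ) ≤ n := by exact_mod_cast hn
  have hεn : ε * (n + 1) = 1 / 4 := by rw [hε]; field_simp
  have hε0 : 0 < ε := by positivity
  have hε8 : ε ≤ 1 / 8 := by nlinarith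
  have hx : ∀ b, x b = -if (ρ b : ℕ) < l then 1 else 0 := fun b => by
    have := congrFun hl b
    simp only [kuhnVertex, Fin.val_castSucc, Pi.zero_apply] at this
    omega
  have hv : ∀ (k : Fin (n + 1)) b, kuhnVertex x ρ k.castSucc b =
      (if (ρ b : ℕ) < k then 1 else 0) - if (ρ b : ℕ) < l then 1 else 0 := fun k b => by
    simp only [kuhnVertex, Fin.val_castSucc, hx b]; ring
  have hvne : ∀ k : Fin (n + 1), k ≠ l → kuhnVertex x ρ k.castSucc ≠ 0 := by
    intro k hk h
    have h1 := congrFun h (ρ.symm (min k l))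
    rw [hv] at h1
    rcases lt_or_gt_of_ne hk with hkl | hkl
    · simp [min_eq_left hkl.le, hkl] at h1
    · simp [min_eq_right hkl.le, hkl] at h1
  set θ := β l with hθ
  set T : ℕ → ℝ := fun j => ∑ k : Fin (n + 1), β k *
    ((if j < (k : ℕ) then 1 else 0) - if j < (l : ℕ) then 1 else 0) with hT
  have hmain : ∀ a : Fin n, |T (ρ a.succ) - θ * (n - (a : ℕ))| ≤ ε := by
    intro a
    have h1 : ∑ k, β k * w (kuhnVertex x ρ k.castSucc) a = 0 := by
      simpa using congrFun hβ0 a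
    have h2 : θ * ((n : ℝ) - (a : ℕ)) = ∑ k, if k = l then θ * ((n : ℝ) - (a : ℕ)) else 0 := by
      simp
    have h3 : T (ρ a.succ) - θ * (n - (a : ℕ)) = ∑ k : Fin (n + 1), (β k *
        ((if (ρ a.succ : ℕ) < (k : ℕ) then 1 else 0) - if (ρ a.succ : ℕ) < (l : ℕ) then 1 else 0)
        - (if k = l then θ * ((n : ℝ) - (a : ℕ)) else 0)
        - β k * w (kuhnVertex x ρ k.castSucc) a) := by
      rw [Finset.sum_sub_distrib, Finset.sum_sub_distrib, h1, ← h2, sub_zero]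
    rw [h3]
    calc _ ≤ ∑ k : Fin (n + 1), β k * ε := ?_
      _ = ε := by rw [← Finset.sum_mul, hβ1, one_mul]
    refine (Finset.abs_sum_le_sum_abs _ _).trans (Finset.sum_le_sum fun k _ => ?_)
    by_cases hk : k = l
    · subst hk
      rw [hl, hcenter, if_pos rfl]
      have : (0 : ℝ) ≤ β k * ε := mul_nonneg (hβ k) hε0.le
      refine le_of_eq_of_le (abs_eq_zero.2 ?_) this
      rw [sub_self, ← hθ]
      ring
    · have h4 := hstar _ (fun b => ?_) ?_ (hvne k hk) a
      · rw [hv] at h4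
        push_cast at h4
        rw [if_neg hk, sub_zero, ← mul_sub, abs_mul, abs_of_nonneg (hβ k), abs_sub_comm]
        exact mul_le_mul_of_nonneg_left h4 (hβ k)
      · rw [hv]; split_ifs <;> simp
      · rw [hv, hρ, if_neg (by omega), if_neg (by omega)]; rfl
  have hex : ∀ j < n, ∃ a : Fin n, (ρ a.succ : ℕ) = j := by
    intro j hj
    have : ρ.symm ⟨j, by omega⟩ ≠ 0 := by
      rw [Ne, Equiv.symm_apply_eq, Fin.ext_iff, hρ]
      exact hj.ne
    obtain ⟨a, ha⟩ := Fin.exists_succ_eq.2 this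
    exact ⟨a, by rw [ha]; simp⟩
  have hθ0 : 0 ≤ θ := hβ l
  have hl0 : (l : ℕ) = 0 := by
    by_contra hpos
    obtain ⟨a, ha⟩ := hex (l - 1) (by omega)
    have h1 := abs_le.1 (hmain a)
    rw [ha] at h1
    have hca : (1 : ℝ) ≤ n - (a : ℕ) := by
      have : ((a : ℕ) : ℝ) + 1 ≤ n := by exact_mod_cast a.isLt
      linarith
    have h2 : T (l - 1) ≤ 0 := by
      refine Finset.sum_nonpos fun k _ => mul_nonpos_of_nonneg_of_nonpos (hβ k) ?_
      rw [if_pos (show (l : ℕ) - 1 < l by omega)]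
      split_ifs <;> norm_num
    have h3 : T l ≤ ε + θ * n := by
      by_cases hln : (l : ℕ) < n
      · obtain ⟨b, hb⟩ := hex l hln
        have h4 := abs_le.1 (hmain b)
        rw [hb] at h4
        have : 0 ≤ θ * (b : ℕ) := by positivity
        linarith
      · have : T l = 0 := by
          refine Finset.sum_eq_zero fun k _ => ?_
          rw [if_neg (by omega), if_neg (by omega)]; simp
        rw [this]; positivity
    have h4 : T l - T (l - 1) = 1 - θ := by
      have : θ = ∑ k, if k = l then β k else 0 := by simp [hθ]
      rw [← hβ1, this, ← Finset.sum_sub_distrib, ← Finset.sum_sub_distrib]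
      refine Finset.sum_congr rfl fun k _ => ?_
      rw [if_neg (lt_irrefl _), if_pos (show (l : ℕ) - 1 < l by omega)]
      rcases lt_trichotomy k l with h | h | h
      · rw [if_neg (by omega), if_neg (by omega), if_neg (by omega)]; ring
      · rw [if_neg (by omega), if_pos (by omega), if_pos h]; ring
      · rw [if_pos (by omega), if_pos (by omega), if_neg (by omega)]; ring
    have h5 : θ ≤ ε := by nlinarith
    have h6 : θ * (n - (a : ℕ)) ≥ 0 := by positivity
    nlinarith
  have hx0 : x = 0 := funext fun b => by rw [hx, if_neg (by omega)]; rfl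
  refine ⟨hx0, ?_⟩
  have hθlow : 7 / 8 ≤ θ * (n + 1) := by
    have h1 : θ + T 0 = 1 := by
      have : θ = ∑ k, if k = l then β k else 0 := by simp [hθ]
      rw [← hβ1, this, ← Finset.sum_add_distrib]
      refine Finset.sum_congr rfl fun k _ => ?_
      rw [hl0, if_neg (lt_irrefl _)]
      by_cases h : k = l
      · rw [if_pos h, if_neg (by omega)]; ring
      · rw [if_neg h, if_pos (by omega)]; ring
    obtain ⟨b, hb⟩ := hex 0 (by omega)
    have h4 := abs_le.1 (hmain b)
    rw [hb] at h4
    have : 0 ≤ θ * (b : ℕ) := by positivity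
    linarith
  have hanti : ∀ i j, i ≤ j → T j ≤ T i := by
    intro i j hij
    refine Finset.sum_le_sum fun k _ => mul_le_mul_of_nonneg_left ?_ (hβ k)
    simp only [hl0, Nat.not_lt_zero, if_false]
    split_ifs <;> first | omega | norm_num
  have hlt : ∀ a : Fin n, (ρ a.succ : ℕ) < n := by
    intro a
    have h1 : ρ a.succ ≠ ρ 0 := ρ.injective.ne (Fin.succ_ne_zero a)
    have h2 : (ρ a.succ : ℕ) ≠ n := fun h => h1 (Fin.ext (h.trans hρ.symm))
    omega
  have hmono : StrictMono fun a : Fin n => (⟨ρ a.succ, hlt a⟩ : Fin n) := by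
    intro a b hab
    rw [Fin.mk_lt_mk]
    by_contra! h
    have h1 := abs_le.1 (hmain a)
    have h2 := abs_le.1 (hmain b)
    have h3 := hanti _ _ h
    have h4 : ((a : ℕ) : ℝ) + 1 ≤ (b : ℕ) := by exact_mod_cast hab
    have h5 : θ ≤ 2 * ε := by nlinarith
    nlinarith
  rw [← Equiv.symm_symm ρ]
  congr 1
  refine Equiv.ext fun b => ?_
  rw [Equiv.symm_apply_eq]
  apply Fin.ext
  by_cases hb : b = Fin.last n
  · subst hb
    rw [finRotate_last, hρ]; rfl
  · obtain ⟨a, rfl⟩ := Fin.exists_castSucc_eq.2 hb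
    have h1 : finRotate (n + 1) a.castSucc = a.succ := by
      apply Fin.ext; rw [coe_finRotate_of_ne_last hb]; rfl
    rw [h1]
    exact (congrArg Fin.val (hmono.fin_apply_eq a)).symm

theorem zero_mem_convexHull_of_chain {n : ℕ} (w : (Fin (n + 1) → ℤ) → Fin n → ℝ)
    (hcenter : ∀ a, w 0 a = -((n : ℝ) - (a : ℕ)))
    (hchain : ∀ k : Fin (n + 1), k ≠ 0 → ∀ a : Fin n,
      w (kuhnVertex 0 (finRotate (n + 1)).symm k.castSucc) a = if (a : ℕ) < k then 1 else 0) :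
    0 ∈ convexHull ℝ (w '' kuhnFacet (0, (finRotate (n + 1)).symm, Fin.last (n + 1))) := by
  simp only [kuhnFacet, ← Set.range_comp]
  rw [mem_convexHull_range_iff_exists_sum]
  refine ⟨fun _ => ((n : ℝ) + 1)⁻¹, fun _ => by positivity, ?_, ?_⟩
  · simp only [Finset.sum_const, Finset.card_univ, Fintype.card_fin, nsmul_eq_mul]
    push_cast
    field_simp
  · rw [← Finset.smul_sum]
    convert smul_zero _
    funext a
    simp only [Function.comp, Fin.succAbove_last, Finset.sum_apply, Pi.zero_apply]
    have h : ∀ k : Fin (n + 1), w (kuhnVertex 0 (finRotate (n + 1)).symm k.castSucc) a =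
        (if (a : ℕ) < k then 1 else 0) - if k = 0 then ((n : ℝ) - (a : ℕ)) else 0 := by
      intro k
      by_cases hk : k = 0
      · subst hk
        have : kuhnVertex 0 (finRotate (n + 1)).symm (0 : Fin (n + 1)).castSucc = 0 := by
          funext b; simp [kuhnVertex]
        rw [this, hcenter]; simp
      · rw [hchain k hk, if_neg hk, sub_zero]
    have hcard : (Finset.univ.filter fun k : Fin (n + 1) => (a : ℕ) < k).card = n - a := by
      have : (Finset.univ.filter fun k : Fin (n + 1) => (a : ℕ) < k) = Finset.Ioi a.castSucc := by
        ext k; simp [Fin.lt_def]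
      rw [this, Fin.card_Ioi]; simp
    simp only [h, Finset.sum_sub_distrib, Finset.sum_ite_eq', Finset.mem_univ, if_true,
      Finset.sum_boole, hcard]
    rw [Nat.cast_sub a.isLt.le, sub_self]

/-- A generic labelling of the lattice by vectors of `ℝⁿ`, odd away from the origin, has a zero
facet across which a given bounded symmetric neighbourhood `s` of the origin is left. -/
theorem false_of_forall_zero_facet {n : ℕ} (hn : 1 ≤ n) (s : (Fin (n + 1) → ℤ) → Prop)
    (hfin : {v | s v}.Finite) (hneg : ∀ v, s (-v) ↔ s v) (hs0 : s 0)
    (w : (Fin (n + 1) → ℤ) → Fin n → ℝ)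
    (hw : ∀ x ρ, s x → ∀ c : Fin (n + 2) → ℝ, ∑ k, c k • w (kuhnVertex x ρ k) = 0 →
      ∀ i j, i ≠ j → c i = 0 → c j = 0 → c = 0)
    (hodd : ∀ v, v ≠ 0 → w (-v) = -w v)
    (hcenter : ∀ a, w 0 a = -((n : ℝ) - (a : ℕ)))
    (hchain : ∀ k : Fin (n + 1), k ≠ 0 → ∀ a : Fin n,
      w (kuhnVertex 0 (finRotate (n + 1)).symm k.castSucc) a = if (a : ℕ) < k then 1 else 0)
    (hstar : ∀ v : Fin (n + 1) → ℤ, (∀ a, |v a| ≤ 1) → v 0 = 0 → v ≠ 0 →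
      ∀ a, |w v a - v a.succ| ≤ 1 / (4 * (n + 1)))
    (hconst : ∀ x ρ i, 0 ∈ convexHull ℝ (w '' kuhnFacet (x, ρ, i)) →
      ∀ y : Fin (n + 1) → ℤ, (∀ a, |y a - x a| ≤ 1) → (s x ↔ s y)) : False := by
  classical
  let door : (Fin (n + 1) → ℤ) × Equiv.Perm (Fin (n + 1)) × Fin (n + 2) → Prop :=
    fun p => 0 ∈ convexHull ℝ (w '' kuhnFacet p)
  let X := hfin.toFinset.filter fun x => 0 ≤ x 0
  have hX : ∀ x, x ∈ X ↔ s x ∧ 0 ≤ x 0 := fun x => by simp [X]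
  let S := (X ×ˢ (Finset.univ : Finset (Equiv.Perm (Fin (n + 1)) × Fin (n + 2)))).filter door
  have hS : ∀ p, p ∈ S ↔ s p.1 ∧ 0 ≤ p.1 0 ∧ door p := fun p => by
    simp [S, hX, and_assoc]
  have hSeven : Even S.card := by
    rw [Finset.card_filter, Finset.sum_product]
    refine Finset.even_sum _ fun x hx => ?_
    rw [← Finset.univ_product_univ, Finset.sum_product]
    refine Finset.even_sum _ fun ρ _ => ?_
    rw [← Finset.card_filter]
    simp only [kuhnFacet, ← Set.range_comp]
    exact even_card_zero_mem_convexHull_succAbove (w ∘ kuhnVertex x ρ) (hw x ρ ((hX x).1 hx).1)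
  let bd : (Fin (n + 1) → ℤ) × Equiv.Perm (Fin (n + 1)) × Fin (n + 2) → Prop :=
    fun p => p.1 0 = 0 ∧ (p.2.1 0 : ℕ) = n ∧ p.2.2 = Fin.last (n + 1)
  have hinterior : Even (S.filter fun p => ¬bd p).card := by
    refine Finset.even_card_of_involution _ kuhnNeighbor ?_ (fun p _ => kuhnNeighbor_ne p)
      (fun p _ => kuhnNeighbor_kuhnNeighbor p)
    intro p hp
    rw [Finset.mem_filter, hS] at hp ⊢
    obtain ⟨⟨h1, h2, h3⟩, h4⟩ := hp
    have h5 : s (kuhnNeighbor p).1 :=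
      (hconst p.1 p.2.1 p.2.2 h3 _ (abs_kuhnNeighbor_sub_le p)).1 h1
    have h6 : door (kuhnNeighbor p) := by
      simp only [door, kuhnFacet_kuhnNeighbor]; exact h3
    suffices 0 ≤ (kuhnNeighbor p).1 0 ∧ ¬bd (kuhnNeighbor p) from ⟨⟨h5, this.1, h6⟩, this.2⟩
    clear h3 h5 h6
    obtain ⟨x, ρ, i⟩ := p
    have hlt := (ρ 0).isLt
    dsimp only at h2
    by_cases hi0 : i = 0
    · subst hi0
      rw [kuhnNeighbor_zero]
      simp only [bd, Equiv.trans_apply, val_finRotate_symm, not_and]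
      refine ⟨by split_ifs <;> omega, fun h h' => ?_⟩
      split_ifs at h h' <;> omega
    by_cases hil : i = Fin.last (n + 1)
    · subst hil
      rw [kuhnNeighbor_last]
      simp only [bd, and_true, not_and] at h4
      refine ⟨?_, fun h => hi0 h.2.2.symm⟩
      dsimp only
      split_ifs with h
      · have : x 0 ≠ 0 := fun h0 => h4 h0 h
        omega
      · omega
    · rw [kuhnNeighbor_middle x ρ i hi0 hil]
      exact ⟨h2, fun h => hil h.2.2⟩
  have hbd : Even (S.filter bd).card := by
    have := Finset.card_filter_add_card_filter_not (s := S) bd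
    rw [← this] at hSeven
    exact (Nat.even_add.1 hSeven).2 hinterior
  have hsym : Even ((S.filter bd).filter fun p => ¬(0 : Fin (n + 1) → ℤ) ∈ kuhnFacet p).card := by
    refine Finset.even_card_of_involution _ kuhnNeg ?_ (fun p _ => kuhnNeg_ne hn p)
      (fun p _ => kuhnNeg_kuhnNeg p)
    rintro ⟨x, ρ, i⟩ hp
    rw [Finset.mem_filter, Finset.mem_filter, hS] at hp ⊢
    obtain ⟨⟨⟨h1, h2, h3⟩, h4, h5, h6⟩, h7⟩ := hp
    dsimp only at h1 h2 h4 h5 h6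
    subst h6
    have h8 : (kuhnNeg (x, ρ, Fin.last (n + 1))).1 0 = 0 := by
      simp [kuhnNeg, kuhnVertex, h4, h5]
    have h9 : s (kuhnNeg (x, ρ, Fin.last (n + 1))).1 := by
      simp only [kuhnNeg]
      rw [hneg, ← hconst _ _ _ h3]
      · exact h1
      · intro a
        simp only [kuhnVertex]
        split_ifs <;> simp
    refine ⟨⟨⟨h9, h8.ge, ?_⟩, h8, ?_, rfl⟩, ?_⟩
    · simp only [door, kuhnFacet_kuhnNeg]
      have h10 : w '' (-kuhnFacet (x, ρ, Fin.last (n + 1))) =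
          -(w '' kuhnFacet (x, ρ, Fin.last (n + 1))) := by
        rw [← Set.image_neg_eq_neg, ← Set.image_neg_eq_neg, Set.image_image, Set.image_image]
        exact Set.image_congr fun v hv => hodd v fun h => h7 (h ▸ hv)
      rw [h10, convexHull_neg, Set.mem_neg, neg_zero]
      exact h3
    · simp only [kuhnNeg, Equiv.trans_apply, val_finRotate_symm_revPerm, h5, if_true]
    · rw [kuhnFacet_kuhnNeg, Set.mem_neg, neg_zero]; exact h7
  have hone : (S.filter bd).filter (fun p => (0 : Fin (n + 1) → ℤ) ∈ kuhnFacet p) =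
      {(0, (finRotate (n + 1)).symm, Fin.last (n + 1))} := by
    ext ⟨x, ρ, i⟩
    rw [Finset.mem_filter, Finset.mem_filter, hS, Finset.mem_singleton]
    constructor
    · rintro ⟨⟨⟨-, -, h3⟩, -, h5, h6⟩, h7⟩
      dsimp only at h5 h6
      subst h6
      obtain ⟨rfl, rfl⟩ := eq_of_zero_mem_of_near_projection hn w hcenter hstar x ρ h5 h7 h3
      rfl
    · intro h
      rw [h]
      refine ⟨⟨⟨hs0, le_rfl, zero_mem_convexHull_of_chain w hcenter hchain⟩, rfl, ?_, rfl⟩, 0, ?_⟩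
      · simp
      · funext b; simp [kuhnVertex]
  have h1 := Finset.card_filter_add_card_filter_not (s := S.filter bd)
    fun p => (0 : Fin (n + 1) → ℤ) ∈ kuhnFacet p
  rw [hone, Finset.card_singleton] at h1
  rw [← h1, Nat.even_add] at hbd
  exact absurd (hbd.2 hsym) (by decide)

/-- Finitely many vectors can be perturbed into general position, relative to a family which
already is in general position. -/
theorem exists_general_position {ι E : Type*} [DecidableEq ι] [NormedAddCommGroup E]
    [NormedSpace ℝ E] [FiniteDimensional ℝ E] (P U : Finset ι) (hPU : Disjoint P U) (f : ι → E)
    {ε : ℝ} (hε : 0 < ε)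
    (hP : ∀ A ⊆ P, A.card ≤ Module.finrank ℝ E → LinearIndepOn ℝ f (A : Set ι)) :
    ∃ w : ι → E, (∀ i ∉ U, w i = f i) ∧ (∀ i, ‖w i - f i‖ < ε) ∧
      ∀ A ⊆ P ∪ U, A.card ≤ Module.finrank ℝ E → LinearIndepOn ℝ w (A : Set ι) := by
  classical
  induction U using Finset.induction_on with
  | empty => exact ⟨f, fun _ _ => rfl, fun _ => by simpa using hε, by simpa using hP⟩
  | insert a U ha ih =>
    rw [Finset.disjoint_insert_right] at hPU
    obtain ⟨w, hwf, hwε, hw⟩ := ih hPU.2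
    let 𝒜 := (P ∪ U).powerset.filter fun A => A.card < Module.finrank ℝ E
    have hdense : Dense (⋂ A ∈ (𝒜 : Set (Finset ι)),
        ((Submodule.span ℝ (w '' (A : Set ι)) : Set E)ᶜ)) := by
      refine dense_biInter_of_isOpen 
        (fun A _ => (Submodule.closed_of_finiteDimensional _).isOpen_compl)
        𝒜.countable_toSet fun A hA => ?_
      rw [← interior_eq_empty_iff_dense_compl, ← Set.not_nonempty_iff_eq_empty]
      intro h
      have htop := Submodule.eq_top_of_nonempty_interior' _ h
      have h1 := finrank_span_finset_le_card (R := ℝ) (A.image w)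
      rw [Finset.coe_image, Set.finrank, htop, finrank_top] at h1
      have h2 := (Finset.mem_filter.1 hA).2
      exact absurd (h1.trans Finset.card_image_le) (not_le.2 h2)
    obtain ⟨z, hz, hzε⟩ := hdense.exists_dist_lt (f a) hε
    have hupd : ∀ i, i ≠ a → Function.update w a z i = w i := fun i hi => by simp [hi]
    refine ⟨Function.update w a z, fun i hi => ?_, fun i => ?_, fun A hA hcard => ?_⟩
    · rw [Finset.mem_insert, not_or] at hi
      rw [hupd i hi.1, hwf i hi.2]
    · by_cases hi : i = a
      · subst hi
        rw [Function.update_self, ← dist_eq_norm, dist_comm]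
        exact hzε
      · rw [hupd i hi]; exact hwε i
    · by_cases haA : a ∈ A
      · have hsub : A.erase a ⊆ P ∪ U := fun i hi => by
          have h1 := hA (Finset.mem_of_mem_erase hi)
          have h2 := Finset.ne_of_mem_erase hi
          simpa [h2] using h1
        have hlt : (A.erase a).card < Module.finrank ℝ E :=
          (Finset.card_erase_lt_of_mem haA).trans_le hcard
        have himg : Function.update w a z '' (A.erase a : Finset ι) = w '' (A.erase a : Finset ι) :=
          Set.image_congr fun i hi => hupd i (Finset.ne_of_mem_erase hi)
        rw [← Finset.insert_erase haA, Finset.coe_insert,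
          linearIndepOn_insert (by simp), himg, Function.update_self]
        refine ⟨(hw _ hsub hlt.le).congr fun i hi => (hupd i (Finset.ne_of_mem_erase hi)).symm, ?_⟩
        exact Set.mem_iInter₂.1 hz _ (Finset.mem_coe.2 (Finset.mem_filter.2
          ⟨Finset.mem_powerset.2 hsub, hlt⟩))
      · refine (hw A (fun i hi => ?_) hcard).congr fun i hi => (hupd i ?_).symm
        · have h1 := hA hi
          have h2 : i ≠ a := fun h => haA (h ▸ hi)
          simpa [h2] using h1
        · rintro rfl
          exact haA hi

theorem kuhnVertex_injective {m : ℕ} (x : Fin m → ℤ) (ρ : Equiv.Perm (Fin m)) :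
    Function.Injective (kuhnVertex x ρ) := by
  intro k l h
  by_contra hne
  wlog hkl : k < l generalizing k l
  · exact this h.symm (Ne.symm hne) (lt_of_le_of_ne (not_lt.1 hkl) (Ne.symm hne))
  have hk : (k : ℕ) < m := by omega
  have := congrFun h (ρ.symm ⟨k, hk⟩)
  simp only [kuhnVertex, Equiv.apply_symm_apply] at this
  rw [if_neg (lt_irrefl _), if_pos (show (k : ℕ) < (l : ℕ) from hkl)] at this
  omega

theorem abs_kuhnVertex_sub_le {m : ℕ} (x : Fin m → ℤ) (ρ : Equiv.Perm (Fin m)) (k : Fin (m + 1))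
    (a : Fin m) : |kuhnVertex x ρ k a - x a| ≤ 1 := by
  simp only [kuhnVertex]
  split_ifs <;> simp

theorem eq_zero_of_kuhnVertex_eq_neg {m : ℕ} (x : Fin m → ℤ) (ρ : Equiv.Perm (Fin m))
    (k l : Fin (m + 1)) (h : kuhnVertex x ρ k = -kuhnVertex x ρ l) : kuhnVertex x ρ k = 0 := by
  funext a
  have := congrFun h a
  simp only [kuhnVertex, Pi.neg_apply, Pi.zero_apply] at this ⊢
  split_ifs at this ⊢ <;> omega

/-- The values on the chain `0, e₁, e₁ + e₂, …` prescribed in `false_of_forall_zero_facet` are in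
general position. -/
theorem linearIndepOn_of_chain {n : ℕ} (f : (Fin (n + 1) → ℤ) → Fin n → ℝ)
    (hcenter : ∀ a, f 0 a = -((n : ℝ) - (a : ℕ)))
    (hchain : ∀ k : Fin (n + 1), k ≠ 0 → ∀ a : Fin n,
      f (kuhnVertex 0 (finRotate (n + 1)).symm k.castSucc) a = if (a : ℕ) < k then 1 else 0)
    (A : Finset (Fin (n + 1) → ℤ))
    (hA : A ⊆ Finset.univ.image fun k : Fin (n + 1) =>
      kuhnVertex 0 (finRotate (n + 1)).symm k.castSucc)
    (hcard : A.card ≤ n) : LinearIndepOn ℝ f (A : Set (Fin (n + 1) → ℤ)) := by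
  set p : Fin (n + 1) → Fin (n + 1) → ℤ :=
    fun k => kuhnVertex 0 (finRotate (n + 1)).symm k.castSucc with hp
  have hpinj : Function.Injective p := (kuhnVertex_injective _ _).comp (Fin.castSucc_injective _)
  have hp0 : p 0 = 0 := by funext b; simp [hp, kuhnVertex]
  rw [linearIndepOn_finset_iff]
  intro d hd
  set e : Fin (n + 1) → ℝ := fun k => if p k ∈ A then d (p k) else 0 with he
  have hsum : ∑ k, e k • f (p k) = 0 := by
    have h1 : ∑ v ∈ Finset.univ.image p, (if v ∈ A then d v else 0) • f v = ∑ k, e k • f (p k) :=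
      Finset.sum_image fun k _ l _ h => hpinj h
    rw [← h1, ← hd, ← Finset.sum_subset hA fun v _ hv => by rw [if_neg hv, zero_smul]]
    exact Finset.sum_congr rfl fun v hv => by rw [if_pos hv]
  have hf : ∀ (k : Fin (n + 1)) (a : Fin n), f (p k) a =
      (if (a : ℕ) < k then 1 else 0) - if k = 0 then ((n : ℝ) - (a : ℕ)) else 0 := by
    intro k a
    by_cases hk : k = 0
    · subst hk
      rw [hp0, hcenter]; simp
    · rw [hchain k hk, if_neg hk, sub_zero]
  let T : ℕ → ℝ := fun j => ∑ k : Fin (n + 1), if j < k then e k else 0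
  have hT : ∀ j ≤ n, T j = ((n : ℝ) - j) * e 0 := by
    intro j hj
    rcases hj.lt_or_eq with hj | rfl
    · have := congrFun hsum ⟨j, hj⟩
      simp only [Finset.sum_apply, Pi.smul_apply, smul_eq_mul, hf, mul_sub, mul_ite, mul_one,
        mul_zero, Finset.sum_sub_distrib, Finset.sum_ite_eq', Finset.mem_univ, if_true,
        Pi.zero_apply] at this
      simp only [T]
      linarith
    · rw [sub_self, zero_mul]
      exact Finset.sum_eq_zero fun k _ => if_neg (by omega)
  have he0 : ∀ k, e k = e 0 := by
    intro k
    induction k using Fin.cases with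
    | zero => rfl
    | succ i =>
      have h1 : T i - T (i + 1) = e i.succ := by
        simp only [T, ← Finset.sum_sub_distrib]
        rw [Finset.sum_eq_single i.succ]
        · simp
        · intro k _ hk
          have : (k : ℕ) ≠ i + 1 := fun h => hk (Fin.ext (by simpa using h))
          split_ifs <;> first | omega | simp
        · simp
      rw [← h1, hT i i.isLt.le, hT (i + 1) i.isLt]
      push_cast
      ring
  obtain ⟨k, hk⟩ : ∃ k, p k ∉ A := by
    by_contra! h
    have h1 := Finset.card_le_card (Finset.image_subset_iff.2 fun k _ => h k :
      Finset.univ.image p ⊆ A)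
    rw [Finset.card_image_of_injective _ hpinj, Finset.card_univ, Fintype.card_fin] at h1
    omega
  have hek : ∀ l, e l = 0 := fun l => by rw [he0 l, ← he0 k]; exact if_neg hk
  intro v hv
  obtain ⟨l, -, rfl⟩ := Finset.mem_image.1 (hA hv)
  exact (if_pos hv).symm.trans (hek l)

/-- A labelling of the lattice which is odd away from the origin can be perturbed to a generic one,
without changing the values prescribed on the chain `0, e₁, e₁ + e₂, …`. -/
theorem exists_generic_labelling {n : ℕ} (f : (Fin (n + 1) → ℤ) → Fin n → ℝ)
    (hodd : ∀ v, v ≠ 0 → f (-v) = -f v)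
    (hcenter : ∀ a, f 0 a = -((n : ℝ) - (a : ℕ)))
    (hchain : ∀ k : Fin (n + 1), k ≠ 0 → ∀ a : Fin n,
      f (kuhnVertex 0 (finRotate (n + 1)).symm k.castSucc) a = if (a : ℕ) < k then 1 else 0)
    (M : ℕ) {ε : ℝ} (hε : 0 < ε) :
    ∃ w : (Fin (n + 1) → ℤ) → Fin n → ℝ, (∀ v, ‖w v - f v‖ < ε) ∧
      (∀ v, v ≠ 0 → w (-v) = -w v) ∧
      (∀ k : Fin (n + 1), w (kuhnVertex 0 (finRotate (n + 1)).symm k.castSucc) =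
        f (kuhnVertex 0 (finRotate (n + 1)).symm k.castSucc)) ∧
      ∀ (x : Fin (n + 1) → ℤ) ρ, (∀ a, |x a| ≤ M) →
        ∀ c : Fin (n + 2) → ℝ, ∑ k, c k • w (kuhnVertex x ρ k) = 0 →
          ∀ i j, i ≠ j → c i = 0 → c j = 0 → c = 0 := by
  classical
  let P : Finset (Fin (n + 1) → ℤ) := Finset.univ.image fun k : Fin (n + 1) =>
    kuhnVertex 0 (finRotate (n + 1)).symm k.castSucc
  let U : Finset (Fin (n + 1) → ℤ) :=
    ((Fintype.piFinset fun _ => Finset.Icc (-(M + 1 : ℤ)) (M + 1)).filter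
      fun v => 0 ≤ toLex v) \ P
  obtain ⟨w, hwf, hwε, hw⟩ := exists_general_position P U Finset.disjoint_sdiff f hε
    fun A hA hcard => linearIndepOn_of_chain f hcenter hchain A hA (by simpa using hcard)
  have hneg : ∀ v : Fin (n + 1) → ℤ, v ≠ 0 → (0 ≤ toLex (-v) ↔ ¬ 0 ≤ toLex v) := by
    intro v hv
    rw [toLex_neg, neg_nonneg, not_le, lt_iff_le_and_ne]
    exact ⟨fun h => ⟨h, hv⟩, fun h => h.1⟩
  have hPpos : ∀ k : Fin (n + 1),
      0 ≤ toLex (kuhnVertex 0 (finRotate (n + 1)).symm k.castSucc) := by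
    intro k
    have h : (0 : Fin (n + 1) → ℤ) ≤ kuhnVertex 0 (finRotate (n + 1)).symm k.castSucc := by
      intro a
      simp only [kuhnVertex, Pi.zero_apply]
      split_ifs <;> simp
    exact Pi.toLex_monotone h
  let r : (Fin (n + 1) → ℤ) → Fin (n + 1) → ℤ := fun v => if 0 ≤ toLex v then v else -v
  have hrpos : ∀ v, 0 ≤ toLex (r v) := by
    intro v
    by_cases h : 0 ≤ toLex v
    · simp only [r, if_pos h]; exact h
    · simp only [r, if_neg h]
      exact (hneg v (by rintro rfl; exact h le_rfl)).2 h
  have hreq : ∀ v, r v = v ∨ r v = -v := fun v => by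
    by_cases h : 0 ≤ toLex v <;> simp [r, h]
  refine ⟨fun v => if 0 ≤ toLex v then w v else -w (-v), fun v => ?_, fun v hv => ?_,
    fun k => ?_, fun x ρ hx c hc i j hij hi hj => ?_⟩
  · by_cases h : 0 ≤ toLex v
    · simpa [h] using hwε v
    · have hv : v ≠ 0 := by rintro rfl; exact h le_rfl
      have := hwε (-v)
      rw [hodd v hv, ← norm_neg] at this
      simpa only [if_neg h, sub_eq_add_neg, neg_add, neg_neg] using this
  · by_cases h : 0 ≤ toLex v
    · simp only [if_pos h, if_neg (fun h' => (hneg v hv).1 h' h), neg_neg]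
    · simp only [if_neg h, if_pos ((hneg v hv).2 h), neg_neg]
  · simp only [if_pos (hPpos k)]
    exact hwf _ fun h => (Finset.mem_sdiff.1 h).2 (Finset.mem_image_of_mem _ (Finset.mem_univ k))
  · let S : Finset (Fin (n + 2)) := {i, j}ᶜ
    have hinj : Function.Injective fun k => r (kuhnVertex x ρ k) := by
      intro k l hkl
      dsimp only at hkl
      rcases hreq (kuhnVertex x ρ k) with hk | hk <;>
        rcases hreq (kuhnVertex x ρ l) with hl | hl <;> rw [hk, hl] at hkl
      · exact kuhnVertex_injective x ρ hkl
      · have := eq_zero_of_kuhnVertex_eq_neg x ρ k l hkl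
        refine kuhnVertex_injective x ρ ?_
        rw [this] at hkl ⊢
        rw [← neg_neg (kuhnVertex x ρ l), ← hkl, neg_zero]
      · have := eq_zero_of_kuhnVertex_eq_neg x ρ l k hkl.symm
        refine kuhnVertex_injective x ρ ?_
        rw [this] at hkl ⊢
        rw [← neg_neg (kuhnVertex x ρ k), hkl, neg_zero]
      · exact kuhnVertex_injective x ρ (neg_injective hkl)
    have hmem : S.image (fun k => r (kuhnVertex x ρ k)) ⊆ P ∪ U := by
      intro v hv
      obtain ⟨k, -, rfl⟩ := Finset.mem_image.1 hv
      by_cases hP : r (kuhnVertex x ρ k) ∈ P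
      · exact Finset.mem_union_left _ hP
      · refine Finset.mem_union_right _ (Finset.mem_sdiff.2
          ⟨Finset.mem_filter.2 ⟨Fintype.mem_piFinset.2 fun a => ?_, hrpos _⟩, hP⟩)
        have h1 := abs_le.1 (abs_kuhnVertex_sub_le x ρ k a)
        have h2 := abs_le.1 (hx a)
        rw [Finset.mem_Icc]
        rcases hreq (kuhnVertex x ρ k) with hk | hk <;> rw [hk]
        · constructor <;> linarith
        · rw [Pi.neg_apply]; constructor <;> linarith
    have hScard : S.card = n := by
      rw [Finset.card_compl, Finset.card_pair hij, Fintype.card_fin]; rfl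
    have hind := hw _ hmem (Finset.card_image_le.trans (by simp [hScard]))
    rw [Finset.coe_image] at hind
    have hind' := hind.comp_of_image hinj.injOn
    rw [linearIndepOn_finset_iff] at hind'
    have hterm : ∀ k, (c k * if 0 ≤ toLex (kuhnVertex x ρ k) then 1 else -1) •
        w (r (kuhnVertex x ρ k)) = c k • (if 0 ≤ toLex (kuhnVertex x ρ k) then w (kuhnVertex x ρ k)
          else -w (-kuhnVertex x ρ k)) := by
      intro k
      by_cases h : 0 ≤ toLex (kuhnVertex x ρ k)
      · simp [r, h]
      · simp [r, h]
    have hzero := hind' (fun k => c k * if 0 ≤ toLex (kuhnVertex x ρ k) then 1 else -1) (by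
      simp only [Function.comp, hterm]
      rw [← hc]
      refine Finset.sum_subset (Finset.subset_univ _) fun k _ hk => ?_
      have : k = i ∨ k = j := by simpa [S, or_iff_not_imp_left] using hk
      rcases this with rfl | rfl
      · rw [hi, zero_smul]
      · rw [hj, zero_smul])
    funext k
    by_cases hk : k ∈ S
    · have := hzero k hk
      split_ifs at this <;> simpa using this
    · have : k = i ∨ k = j := by simpa [S, or_iff_not_imp_left] using hk
      rcases this with rfl | rfl
      exacts [hi, hj]

/-- If `φ` is an even function on `ℝⁿ⁺¹` which is negative at the origin and positive far away, then
every odd map `ℝⁿ⁺¹ → ℝⁿ` has a zero at which `φ` vanishes. -/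
theorem exists_eq_zero_of_odd_of_even {n : ℕ} (hn : 1 ≤ n) (G : (Fin (n + 1) → ℝ) → Fin n → ℝ)
    (φ : (Fin (n + 1) → ℝ) → ℝ) (hG : Continuous G) (hφ : Continuous φ)
    (hGodd : ∀ y, G (-y) = -G y) (hφeven : ∀ y, φ (-y) = φ y) (hφ0 : φ 0 < 0) (R : ℝ)
    (hR : ∀ y, R ≤ ‖y‖ → 0 < φ y) : ∃ y, G y = 0 ∧ φ y = 0 := by
  classical
  by_contra! hne
  have hR0 : 0 < R := by
    by_contra! h
    exact absurd (hR 0 (by simpa using h)) hφ0.not_gt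
  let K := Metric.closedBall (0 : Fin (n + 1) → ℝ) (R + 2)
  have hK : IsCompact K := isCompact_closedBall _ _
  obtain ⟨δ, hδ, hδK⟩ : ∃ δ > 0, ∀ y ∈ K, 3 * δ ≤ ‖G y‖ + |φ y| := by
    obtain ⟨z, -, hz⟩ := hK.exists_isMinOn ⟨0, Metric.mem_closedBall_self (by linarith)⟩
      (f := fun y => ‖G y‖ + |φ y|) (by fun_prop)
    refine ⟨(‖G z‖ + |φ z|) / 3, ?_, fun y hy => ?_⟩
    · by_cases h : G z = 0
      · have := abs_pos.2 (hne z h)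
        positivity
      · have := norm_pos_iff.2 h
        positivity
    · have : ‖G z‖ + |φ z| ≤ ‖G y‖ + |φ y| := hz hy
      linarith
  obtain ⟨η₁, hη₁, hη₁G⟩ := Metric.uniformContinuousOn_iff.1
    (hK.uniformContinuousOn_of_continuous hG.continuousOn) δ hδ
  obtain ⟨η₂, hη₂, hη₂φ⟩ := Metric.uniformContinuousOn_iff.1
    (hK.uniformContinuousOn_of_continuous hφ.continuousOn) δ hδ
  obtain ⟨η₃, hη₃, hη₃φ⟩ := Metric.eventually_nhds_iff.1 (hφ.continuousAt.eventually_lt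
    continuousAt_const hφ0)
  obtain ⟨N, hN⟩ := exists_nat_gt (max 1 (max (1 / η₁) (max (1 / η₂) (4 / η₃))))
  simp only [max_lt_iff] at hN
  obtain ⟨hN1, hNη₁, hNη₂, hNη₃⟩ := hN
  have hN0 : (0 : ℝ) < N := by linarith
  have hN1' : 1 / (N : ℝ) ≤ 1 := by rw [div_le_one hN0]; exact hN1.le
  rw [div_lt_comm₀ (by assumption) hN0] at hNη₁ hNη₂ hNη₃
  let pt : (Fin (n + 1) → ℤ) → Fin (n + 1) → ℝ := fun v a => (v a : ℝ) / N
  have hptneg : ∀ v, pt (-v) = -pt v := fun v => by funext a; simp [pt, neg_div]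
  have hpt : ∀ x y : Fin (n + 1) → ℤ, (∀ a, |y a - x a| ≤ 1) → dist (pt y) (pt x) ≤ 1 / N := by
    intro x y h
    refine (dist_pi_le_iff (by positivity)).2 fun a => ?_
    rw [Real.dist_eq, ← sub_div, abs_div, abs_of_pos hN0]
    gcongr
    exact_mod_cast h a
  let s : (Fin (n + 1) → ℤ) → Prop := fun v => φ (pt v) < 0
  have hsR : ∀ v, s v → ‖pt v‖ < R := fun v hv => by
    by_contra! h
    exact absurd (hR _ h) (not_lt.2 (le_of_lt hv))
  have hsbound : ∀ v, s v → ∀ a, |v a| ≤ (⌈R * N⌉₊ : ℤ) := by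
    intro v hv a
    have h1 := (norm_le_pi_norm (pt v) a).trans_lt (hsR v hv)
    rw [Real.norm_eq_abs, abs_div, abs_of_pos hN0, div_lt_iff₀ hN0] at h1
    have h2 := h1.le.trans (Nat.le_ceil (R * N))
    exact_mod_cast h2
  have hssmall : ∀ v : Fin (n + 1) → ℤ, (∀ a, |v a| ≤ 4) → s v := by
    intro v hv
    refine hη₃φ (lt_of_le_of_lt ?_ hNη₃)
    refine (dist_pi_le_iff (by positivity)).2 fun a => ?_
    rw [Pi.zero_apply, dist_zero_right, Real.norm_eq_abs, abs_div, abs_of_pos hN0]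
    gcongr
    exact_mod_cast hv a
  let f : (Fin (n + 1) → ℤ) → Fin n → ℝ := fun v =>
    if ∀ a, |v a| ≤ 1 then
      if v = 0 then fun a => -((n : ℝ) - (a : ℕ)) else fun a => (v a.succ : ℝ)
    else G (pt v)
  have hfodd : ∀ v, v ≠ 0 → f (-v) = -f v := by
    intro v hv
    simp only [f, Pi.neg_apply, abs_neg, neg_eq_zero, if_neg hv]
    split_ifs
    · funext a; simp
    · rw [hptneg, hGodd]
  have hfcenter : ∀ a, f 0 a = -((n : ℝ) - (a : ℕ)) := fun a => by simp [f]
  have hfchain : ∀ k : Fin (n + 1), k ≠ 0 → ∀ a : Fin n,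
      f (kuhnVertex 0 (finRotate (n + 1)).symm k.castSucc) a = if (a : ℕ) < k then 1 else 0 := by
    intro k hk a
    have h1 : ∀ b, |kuhnVertex 0 (finRotate (n + 1)).symm k.castSucc b| ≤ 1 := fun b => by
      simpa using abs_kuhnVertex_sub_le 0 (finRotate (n + 1)).symm k.castSucc b
    have h2 : ∀ b : Fin n, kuhnVertex 0 (finRotate (n + 1)).symm k.castSucc b.succ =
        if (b : ℕ) < k then 1 else 0 := fun b => by
      simp only [kuhnVertex, val_finRotate_symm]
      simp
    have h3 : kuhnVertex 0 (finRotate (n + 1)).symm k.castSucc ≠ 0 := fun h => by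
      have := h2 ⟨0, hn⟩
      rw [h, if_pos (Nat.pos_of_ne_zero fun h => hk (Fin.ext h))] at this
      simp at this
    simp only [f, if_pos h1, if_neg h3, h2]
    split_ifs <;> simp
  obtain ⟨w, hwf, hwodd, hwchain, hwgen⟩ := exists_generic_labelling f hfodd hfcenter hfchain
    ⌈R * N⌉₊ (ε := min δ (1 / (4 * (n + 1)))) (by positivity)
  refine false_of_forall_zero_facet hn s ?_ (fun v => by simp only [s, hptneg, hφeven])
    (hssmall 0 (by simp)) w (fun x ρ hx => hwgen x ρ (hsbound x hx)) hwodd (fun a => ?_)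
    (fun k hk a => by rw [hwchain, hfchain k hk]) (fun v hv _ hv0 a => ?_) ?_
  · refine (Set.finite_Icc (fun _ => -(⌈R * N⌉₊ : ℤ)) (fun _ => (⌈R * N⌉₊ : ℤ))).subset
      fun v hv => ?_
    exact ⟨fun a => (abs_le.1 (hsbound v hv a)).1, fun a => (abs_le.1 (hsbound v hv a)).2⟩
  · have h0 : kuhnVertex 0 (finRotate (n + 1)).symm (0 : Fin (n + 1)).castSucc = 0 := by
      funext b; simp [kuhnVertex]
    have := hwchain 0
    rw [h0] at this
    rw [this, hfcenter]
  · have h1 : f v a = v a.succ := by simp only [f, if_pos hv, if_neg hv0]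
    rw [← h1]
    exact (norm_le_pi_norm (w v - f v) a).trans ((hwf v).le.trans (min_le_right _ _))
  · intro x ρ i hfacet y hy
    by_cases hx3 : ∀ a, |x a| ≤ 3
    · refine iff_of_true (hssmall x fun a => (hx3 a).trans (by norm_num)) (hssmall y fun a => ?_)
      have h1 := abs_le.1 (hx3 a)
      have h2 := abs_le.1 (hy a)
      rw [abs_le]; constructor <;> linarith
    push Not at hx3
    obtain ⟨a, ha⟩ := hx3
    by_contra hxy
    have hdist := hpt x y hy
    have hxR : ‖pt x‖ ≤ R + 1 := by
      by_cases hx : s x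
      · linarith [hsR x hx]
      · have hy' : s y := by tauto
        have h1 := norm_sub_norm_le (pt x) (pt y)
        rw [← dist_eq_norm, dist_comm] at h1
        linarith [hsR y hy']
    have hball : ∀ v : Fin (n + 1) → ℤ, (∀ a, |v a - x a| ≤ 1) → pt v ∈ K := by
      intro v hv
      have h1 := norm_sub_norm_le (pt v) (pt x)
      rw [← dist_eq_norm] at h1
      rw [mem_closedBall_zero_iff]
      linarith [hpt x v hv]
    have hxK : pt x ∈ K := hball x (by simp)
    have hφx : |φ (pt x)| < δ := by
      have h1 := hη₂φ _ (hball y hy) _ hxK (hdist.trans_lt hNη₂)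
      rw [Real.dist_eq, abs_lt] at h1
      rw [abs_lt]
      by_cases hx : s x
      · have hy' : ¬ s y := by tauto
        simp only [s, not_lt] at hx hy'
        constructor <;> linarith
      · have hy' : s y := by tauto
        simp only [s, not_lt] at hx hy'
        constructor <;> linarith
    have hGx : 2 * δ < ‖G (pt x)‖ := by linarith [hδK _ hxK]
    have hsub : w '' kuhnFacet (x, ρ, i) ⊆ Metric.ball (G (pt x)) (2 * δ) := by
      rintro _ ⟨_, ⟨k, rfl⟩, rfl⟩
      simp only [Function.comp]
      set v := kuhnVertex x ρ (i.succAbove k)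
      have hv : ∀ a, |v a - x a| ≤ 1 := abs_kuhnVertex_sub_le x ρ _
      have hfv : f v = G (pt v) := if_neg fun h => by
        have h1 := abs_le.1 (hv a)
        have h2 := abs_le.1 (h a)
        exact absurd (abs_le.2 ⟨by linarith, by linarith⟩) (not_le.2 ha)
      have h1 := (hwf v).trans_le (min_le_left _ _)
      rw [hfv, ← dist_eq_norm] at h1
      have h2 := hη₁G _ (hball v hv) _ hxK ((hpt x v hv).trans_lt hNη₁)
      rw [Metric.mem_ball]
      linarith [dist_triangle (w v) (G (pt v)) (G (pt x))]
    have h0 := convexHull_min hsub (convex_ball _ _) hfacet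
    rw [Metric.mem_ball, dist_zero_left] at h0
    linarith

/-- In a compact Hausdorff space, two closed sets which are not joined by a connected component are
separated by a clopen set. -/
theorem exists_isClopen_of_disjoint_connectedComponent {X : Type*} [TopologicalSpace X]
    [CompactSpace X] [T2Space X] {P Q : Set X} (hP : IsClosed P) (hQ : IsClosed Q)
    (h : ∀ x ∈ P, Disjoint (connectedComponent x) Q) :
    ∃ A : Set X, IsClopen A ∧ P ⊆ A ∧ Disjoint A Q := by
  let π : X → ConnectedComponents X := (↑)
  have hπ : Continuous π := ConnectedComponents.continuous_coe
  have hsub : π '' P ⊆ (π '' Q)ᶜ := by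
    rintro _ ⟨x, hx, rfl⟩ ⟨y, hy, hyx⟩
    exact Set.disjoint_left.1 (h x hx) (ConnectedComponents.coe_eq_coe'.1 hyx) hy
  obtain ⟨V, hV, hPV, hVQ⟩ := exists_clopen_of_closed_subset_open
    (hP.isCompact.image hπ).isClosed (hQ.isCompact.image hπ).isClosed.isOpen_compl hsub
  exact ⟨π ⁻¹' V, hV.preimage hπ, Set.image_subset_iff.1 hPV,
    Set.disjoint_left.2 fun x hx hxQ => hVQ hx ⟨x, hxQ, rfl⟩⟩

theorem exists_eq_zero_of_odd_of_even_euclidean {n : ℕ} (hn : 1 ≤ n)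
    (G : EuclideanSpace ℝ (Fin (n + 1)) → EuclideanSpace ℝ (Fin n))
    (φ : EuclideanSpace ℝ (Fin (n + 1)) → ℝ) (hG : Continuous G) (hφ : Continuous φ)
    (hGodd : ∀ y, G (-y) = -G y) (hφeven : ∀ y, φ (-y) = φ y) (hφ0 : φ 0 < 0) (R : ℝ)
    (hR : ∀ y, R ≤ ‖y‖ → 0 < φ y) : ∃ y, G y = 0 ∧ φ y = 0 := by
  obtain ⟨y, hy, hy'⟩ := exists_eq_zero_of_odd_of_even hn
    (fun y => WithLp.ofLp (G (WithLp.toLp 2 y))) (fun y => φ (WithLp.toLp 2 y))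
    (by fun_prop) (by fun_prop) (fun y => by rw [WithLp.toLp_neg, hGodd, WithLp.ofLp_neg])
    (fun y => by rw [WithLp.toLp_neg, hφeven]) (by simpa using hφ0) R fun y hy => hR _ <|
      hy.trans <| (pi_norm_le_iff_of_nonneg (norm_nonneg _)).2 fun a =>
        PiLp.norm_apply_le (WithLp.toLp 2 y) a
  exact ⟨WithLp.toLp 2 y, WithLp.ofLp_injective 2 hy, hy'⟩

theorem Metric.infDist_neg_of_neg_mem {E : Type*} [NormedAddCommGroup E] {Z : Set E}
    (hZ : ∀ y, y ∈ Z → -y ∈ Z) (y : E) : Metric.infDist (-y) Z = Metric.infDist y Z := by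
  have : (fun z : E => -z) '' Z = Z := by
    ext z
    exact ⟨by rintro ⟨x, hx, rfl⟩; exact hZ x hx, fun hz => ⟨-z, hZ z hz, neg_neg z⟩⟩
  conv_lhs => rw [← this]
  exact Metric.infDist_image isometry_neg

/-- The solution set of a family of Borsuk–Ulam equations over `[0, 1]` is not separated between
the two ends of the interval by a closed partition invariant under the antipodal map. -/
theorem false_of_antipodal_partition {n : ℕ} (hn : 1 ≤ n)
    (F : ℝ × EuclideanSpace ℝ (Fin (n + 1)) → EuclideanSpace ℝ (Fin n)) (hF : Continuous F)
    (A₀ A₁ : Set (ℝ × EuclideanSpace ℝ (Fin (n + 1)))) (hA₀ : IsClosed A₀) (hA₁ : IsClosed A₁)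
    (hdisj : Disjoint A₀ A₁)
    (hA₀neg : ∀ p ∈ A₀, (p.1, -p.2) ∈ A₀) (hA₁neg : ∀ p ∈ A₁, (p.1, -p.2) ∈ A₁)
    (hA₀lt : ∀ p ∈ A₀, p.1 < 1) (hA₁pos : ∀ p ∈ A₁, 0 < p.1)
    (hcover : ∀ t ∈ Set.Icc (0 : ℝ) 1, ∀ x, ‖x‖ = 1 → F (t, x) = F (t, -x) →
      (t, x) ∈ A₀ ∪ A₁) : False := by
  let q : EuclideanSpace ℝ (Fin (n + 1)) → ℝ × EuclideanSpace ℝ (Fin (n + 1)) :=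
    fun y => (‖y‖ - 1, (max 1 ‖y‖)⁻¹ • y)
  have hq : Continuous q := by
    have h : Continuous fun y : EuclideanSpace ℝ (Fin (n + 1)) => (max 1 ‖y‖)⁻¹ :=
      (continuous_const.max continuous_norm).inv₀ fun y =>
        (lt_of_lt_of_le one_pos (le_max_left _ _)).ne'
    fun_prop
  have hqneg : ∀ y, q (-y) = ((q y).1, -(q y).2) := fun y => by simp [q]
  let Z₀ := Metric.closedBall 0 1 ∪ q ⁻¹' A₀
  let Z₁ := {y | 2 ≤ ‖y‖} ∪ q ⁻¹' A₁
  have hZ₀ : IsClosed Z₀ := Metric.isClosed_closedBall.union (hA₀.preimage hq)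
  have hZ₁ : IsClosed Z₁ :=
    (isClosed_le continuous_const continuous_norm).union (hA₁.preimage hq)
  have hZ₀neg : ∀ y, y ∈ Z₀ → -y ∈ Z₀ := by
    rintro y (h | h)
    · exact Or.inl (by simpa using h)
    · exact Or.inr (by rw [Set.mem_preimage, hqneg]; exact hA₀neg _ h)
  have hZ₁neg : ∀ y, y ∈ Z₁ → -y ∈ Z₁ := by
    rintro y (h | h)
    · exact Or.inl (by simpa using h)
    · exact Or.inr (by rw [Set.mem_preimage, hqneg]; exact hA₁neg _ h)
  have hZdisj : ∀ y, y ∈ Z₀ → y ∉ Z₁ := by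
    rintro y (h | h) (h' | h')
    · rw [mem_closedBall_zero_iff] at h
      simp only [Set.mem_ofPred_eq] at h'
      linarith
    · rw [mem_closedBall_zero_iff] at h
      have : 0 < ‖y‖ - 1 := hA₁pos _ h'
      linarith
    · simp only [Set.mem_ofPred_eq] at h'
      have : ‖y‖ - 1 < 1 := hA₀lt _ h
      linarith
    · exact Set.disjoint_left.1 hdisj h h'
  have hzeroZ₀ : (0 : EuclideanSpace ℝ (Fin (n + 1))) ∈ Z₀ :=
    Or.inl (Metric.mem_closedBall_self zero_le_one)
  obtain ⟨z, hz⟩ := NormedSpace.exists_lt_norm ℝ (EuclideanSpace ℝ (Fin (n + 1))) 2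
  have hzZ₁ : z ∈ Z₁ := Or.inl hz.le
  obtain ⟨y, hGy, hφy⟩ := exists_eq_zero_of_odd_of_even_euclidean hn
    (fun y => F (q y) - F ((q y).1, -(q y).2))
    (fun y => Metric.infDist y Z₀ - Metric.infDist y Z₁)
    (by fun_prop) ((Metric.continuous_infDist_pt _).sub (Metric.continuous_infDist_pt _))
    (fun y => by simp [hqneg])
    (fun y => by
      rw [Metric.infDist_neg_of_neg_mem hZ₀neg, Metric.infDist_neg_of_neg_mem hZ₁neg])
    (by
      have := (hZ₁.notMem_iff_infDist_pos ⟨z, hzZ₁⟩).1 (hZdisj 0 hzeroZ₀)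
      simpa [Metric.infDist_zero_of_mem hzeroZ₀] using this)
    2 (fun y hy => by
      have hy₁ : y ∈ Z₁ := Or.inl hy
      have := (hZ₀.notMem_iff_infDist_pos ⟨0, hzeroZ₀⟩).1 fun h => hZdisj y h hy₁
      simpa [Metric.infDist_zero_of_mem hy₁] using this)
  have hy : y ∉ Z₀ ∧ y ∉ Z₁ := by
    rw [hZ₀.notMem_iff_infDist_pos ⟨0, hzeroZ₀⟩, hZ₁.notMem_iff_infDist_pos ⟨z, hzZ₁⟩]
    rw [sub_eq_zero] at hφy
    rw [hφy, and_self]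
    refine lt_of_le_of_ne Metric.infDist_nonneg fun h => ?_
    have h₁ : y ∈ Z₁ := (hZ₁.mem_iff_infDist_zero ⟨z, hzZ₁⟩).2 h.symm
    exact hZdisj y ((hZ₀.mem_iff_infDist_zero ⟨0, hzeroZ₀⟩).2 (hφy.trans h.symm)) h₁
  simp only [Z₀, Z₁, Set.mem_union, not_or, mem_closedBall_zero_iff, not_le,
    Set.mem_ofPred_eq] at hy
  obtain ⟨⟨h1, hq₀⟩, h2, hq₁⟩ := hy
  refine (hcover (q y).1 ⟨?_, ?_⟩ (q y).2 ?_ (sub_eq_zero.1 hGy)).elim hq₀ hq₁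
  · simp only [q]; linarith
  · simp only [q]; linarith
  · simp only [q]
    rw [max_eq_right h1.le, norm_smul, norm_inv, norm_norm, inv_mul_cancel₀ (by linarith)]

theorem stmt0 (n : ℕ) (hn : 1 ≤ n)
    (F : ℝ × EuclideanSpace ℝ (Fin (n + 1)) → EuclideanSpace ℝ (Fin n))
    (hF : Continuous F)
    (B : Set (ℝ × EuclideanSpace ℝ (Fin (n + 1))))
    (hB : B = {p | p.1 ∈ Set.Icc (0 : ℝ) 1 ∧
      p.2 ∈ Metric.sphere (0 : EuclideanSpace ℝ (Fin (n + 1))) 1 ∧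
      F p = F (p.1, -p.2)}) :
    ∃ C : Set (ℝ × EuclideanSpace ℝ (Fin (n + 1))),
      C ⊆ B ∧ IsCompact C ∧ IsConnected C ∧
      (C ∩ (({0} : Set ℝ) ×ˢ Metric.sphere (0 : EuclideanSpace ℝ (Fin (n + 1))) 1)).Nonempty ∧
      (C ∩ (({1} : Set ℝ) ×ˢ Metric.sphere (0 : EuclideanSpace ℝ (Fin (n + 1))) 1)).Nonempty := by
  have hmem : ∀ p, p ∈ B ↔ p.1 ∈ Set.Icc (0 : ℝ) 1 ∧ ‖p.2‖ = 1 ∧ F p = F (p.1, -p.2) := fun p => by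
    rw [hB, Set.mem_ofPred_eq, mem_sphere_zero_iff_norm]
  have hBcompact : IsCompact B := by
    refine ((isCompact_Icc (a := (0 : ℝ)) (b := 1)).prod (isCompact_sphere 0 1)).of_isClosed_subset
      ?_ ?_
    · rw [hB]
      exact (isClosed_Icc.preimage continuous_fst).inter
        ((Metric.isClosed_sphere.preimage continuous_snd).inter
          (isClosed_eq hF (by fun_prop)))
    · rw [hB]
      exact fun p hp => ⟨hp.1, hp.2.1⟩
  have hBneg : ∀ p ∈ B, (p.1, -p.2) ∈ B := fun p hp => by
    rw [hmem] at hp ⊢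
    exact ⟨hp.1, by simpa using hp.2.1, by simpa using hp.2.2.symm⟩
  have : CompactSpace B := isCompact_iff_compactSpace.1 hBcompact
  have hfst : Continuous fun b : B => b.1.1 := by fun_prop
  let P : Set B := {b | b.1.1 = 0}
  let Q : Set B := {b | b.1.1 = 1}
  by_cases h : ∀ b ∈ P, Disjoint (connectedComponent b) Q
  · exfalso
    obtain ⟨A, hA, hPA, hAQ⟩ := exists_isClopen_of_disjoint_connectedComponent
      (isClosed_eq hfst continuous_const) (isClosed_eq hfst continuous_const) h
    let σ : B → B := fun b => ⟨(b.1.1, -b.1.2), hBneg b.1 b.2⟩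
    have hσ : Continuous σ := by fun_prop
    have hσσ : ∀ b, σ (σ b) = b := fun b => Subtype.ext (by simp [σ])
    let A' : Set B := A ∩ σ ⁻¹' A
    have hA' : IsClopen A' := hA.inter (hA.preimage hσ)
    have hA'σ : ∀ b, σ b ∈ A' ↔ b ∈ A' := fun b => by
      simp only [A', Set.mem_inter_iff, Set.mem_preimage, hσσ, and_comm]
    refine false_of_antipodal_partition hn F hF (Subtype.val '' A') (Subtype.val '' A'ᶜ)
      (hA'.1.isCompact.image continuous_subtype_val).isClosed
      (hA'.compl.1.isCompact.image continuous_subtype_val).isClosed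
      (Set.disjoint_image_iff Subtype.val_injective |>.2 disjoint_compl_right) ?_ ?_ ?_ ?_ ?_
    · rintro _ ⟨b, hb, rfl⟩
      exact ⟨σ b, (hA'σ b).2 hb, rfl⟩
    · rintro _ ⟨b, hb, rfl⟩
      exact ⟨σ b, fun h => hb ((hA'σ b).1 h), rfl⟩
    · rintro _ ⟨b, hb, rfl⟩
      exact lt_of_le_of_ne ((hmem b.1).1 b.2).1.2 fun hb1 => Set.disjoint_left.1 hAQ hb.1 hb1
    · rintro _ ⟨b, hb, rfl⟩
      exact lt_of_le_of_ne ((hmem b.1).1 b.2).1.1 fun hb0 => hb ⟨hPA hb0.symm, hPA hb0.symm⟩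
    · intro t ht x hx hFx
      rw [← Set.image_union, Set.union_compl_self, Set.image_univ, Subtype.range_coe]
      exact (hmem _).2 ⟨ht, hx, hFx⟩
  · push Not at h
    obtain ⟨b, hb, hbQ⟩ := h
    obtain ⟨b', hb', hb'Q⟩ := Set.not_disjoint_iff.1 hbQ
    refine ⟨Subtype.val '' connectedComponent b, by simp,
      isClosed_connectedComponent.isCompact.image continuous_subtype_val,
      isConnected_connectedComponent.image _ continuous_subtype_val.continuousOn,
      ⟨b, ⟨b, mem_connectedComponent, rfl⟩, hb, ?_⟩, ⟨b', ⟨b', hb', rfl⟩, hb'Q, ?_⟩⟩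
    · exact mem_sphere_zero_iff_norm.2 ((hmem b.1).1 b.2).2.1
    · exact mem_sphere_zero_iff_norm.2 ((hmem b'.1).1 b'.2).2.1
end

section
/- Let m ≥ 1 and let W ⊆ ℝ^{m+1} be a compact set with nonempty interior W° such that W equals the closure of W°, and let ∂W := W ∖ W° be its topological boundary in ℝ^{m+1}. Let f : ∂W → ℝ^m be continuous. Then for every interior point w ∈ W° there exist a unit vector x ∈ S^m and real numbers λ > 0 and μ > 0 such that w + λx ∈ ∂W, w − μx ∈ ∂W, and f(w + λx) = f(w − μx); equivalently, there are two boundary points x₁, x₂ ∈ ∂W with w lying in the open segment between x₁ and x₂ and f(x₁) = f(x₂). -/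
/-- The parity (in `ZMod 2`) of the indicator that the signs of the entries of a list alternate,
starting with a positive entry if `s = true` and with a negative one if `s = false`. -/
def altSign : Bool → List ℤ → ZMod 2
  | _, [] => 1
  | true, x :: l => if 0 < x then altSign false l else 0
  | false, x :: l => if x < 0 then altSign true l else 0

/-- The sum of `A` over all lists obtained from a list by deleting one entry. -/
def deletionSum (A : List ℤ → ZMod 2) : List ℤ → ZMod 2
  | [] => 0
  | x :: l => A l + deletionSum (fun k => A (x :: k)) l

theorem deletionSum_zero (l : List ℤ) : deletionSum (fun _ => 0) l = 0 := by
  induction l with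
  | nil => rfl
  | cons x l ih => simp [deletionSum, ih]

theorem deletionSum_altSign (s : Bool) (l : List ℤ) (hl : ∀ x ∈ l, x ≠ 0) :
    deletionSum (altSign s) l = altSign s l + altSign (!s) l := by
  induction l generalizing s with
  | nil => cases s <;> simp [deletionSum, altSign] <;> decide
  | cons x l ih =>
    have hx : x ≠ 0 := hl x (by simp)
    have ih' := fun s => ih s (fun y hy => hl y (by simp [hy]))
    have two : ∀ a : ZMod 2, a + a = 0 := by decide
    have ht := ih' true
    have hf := ih' false
    simp only [Bool.not_true, Bool.not_false] at ht hf
    rcases lt_or_gt_of_ne hx with h | h <;> cases s <;>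
      simp [deletionSum, altSign, h, not_lt.2 h.le, deletionSum_zero, ht, hf, ← add_assoc]
    all_goals rw [add_right_comm, two, zero_add]

theorem deletionSum_perm {A : List ℤ → ZMod 2} (hA : ∀ k k' : List ℤ, k.Perm k' → A k = A k')
    {l l' : List ℤ} (h : l.Perm l') : deletionSum A l = deletionSum A l' := by
  induction h generalizing A with
  | nil => rfl
  | cons x h ih =>
    simp only [deletionSum]
    rw [hA _ _ h, ih fun k k' hk => hA _ _ (hk.cons x)]
  | swap x y l =>
    simp only [deletionSum]
    have : (fun k => A (x :: y :: k)) = fun k => A (y :: x :: k) :=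
      funext fun k => hA _ _ (List.Perm.swap _ _ _)
    rw [this]; ring
  | trans _ _ ih₁ ih₂ => rw [ih₁ hA, ih₂ hA]

theorem deletionSum_congr {A B : List ℤ → ZMod 2} {l : List ℤ}
    (h : ∀ k, k.Sublist l → A k = B k) : deletionSum A l = deletionSum B l := by
  induction l generalizing A B with
  | nil => rfl
  | cons x l ih =>
    simp only [deletionSum]
    rw [h l (List.sublist_cons_self x l), ih fun k hk => h _ (hk.cons_cons x)]

theorem deletionSum_ofFn (A : List ℤ → ZMod 2) {n : ℕ} (t : Fin (n + 1) → ℤ) :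
    deletionSum A (List.ofFn t) = ∑ i, A (List.ofFn (t ∘ Fin.succAbove i)) := by
  induction n generalizing A with
  | zero => simp [deletionSum]
  | succ n ih =>
    rw [List.ofFn_succ, deletionSum, ih, Fin.sum_univ_succ (n := n + 1)]
    have h0 : (List.ofFn fun i => t i.succ) = List.ofFn (t ∘ Fin.succAbove 0) := rfl
    rw [h0, add_right_inj]
    refine Finset.sum_congr rfl fun i _ => ?_
    rw [List.ofFn_succ (f := t ∘ _)]
    simp [Function.comp_def]

theorem deletionSum_add (A B : List ℤ → ZMod 2) (l : List ℤ) :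
    deletionSum (fun k => A k + B k) l = deletionSum A l + deletionSum B l := by
  induction l generalizing A B with
  | nil => simp [deletionSum]
  | cons x l ih => simp only [deletionSum, ih]; ring

theorem deletionSum_deletionSum (A : List ℤ → ZMod 2) (l : List ℤ) :
    deletionSum (deletionSum A) l = 0 := by
  induction l generalizing A with
  | nil => rfl
  | cons x l ih =>
    simp only [deletionSum, deletionSum_add, ih, add_zero]
    exact CharTwo.add_self_eq_zero _

/-- No two entries of the list (and no entry and itself) are opposite to each other. -/
def NoOpposite (l : List ℤ) : Prop := ∀ x ∈ l, ∀ y ∈ l, x + y ≠ 0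

theorem NoOpposite.mono {l l' : List ℤ} (h : NoOpposite l) (hs : ∀ x ∈ l', x ∈ l) :
    NoOpposite l' := fun x hx y hy => h x (hs x hx) y (hs y hy)

theorem NoOpposite.eq {l : List ℤ} (h : NoOpposite l) {x y : ℤ} (hx : x ∈ l) (hy : y ∈ l)
    (hxy : |x| = |y|) : x = y := by
  rcases abs_eq_abs.1 hxy with h' | h'
  · exact h'
  · exact absurd (by omega) (h x hx y hy)

theorem NoOpposite.neg {l : List ℤ} (h : NoOpposite l) : NoOpposite (l.map Neg.neg) := by
  intro x hx y hy
  obtain ⟨a, ha, rfl⟩ := List.mem_map.1 hx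
  obtain ⟨b, hb, rfl⟩ := List.mem_map.1 hy
  have := h a ha b hb
  omega

/-- Sorting a list of integers by absolute value. -/
def absSort (l : List ℤ) : List ℤ := l.insertionSort (fun a b => |a| ≤ |b|)

theorem absSort_perm (l : List ℤ) : (absSort l).Perm l := List.perm_insertionSort _ _

theorem absSort_pairwise (l : List ℤ) : (absSort l).Pairwise (fun a b => |a| ≤ |b|) := by
  have : Std.Total (fun a b : ℤ => |a| ≤ |b|) := ⟨fun a b => le_total _ _⟩
  have : IsTrans ℤ (fun a b : ℤ => |a| ≤ |b|) := ⟨fun a b c => le_trans⟩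
  exact List.pairwise_insertionSort _ _

theorem absSort_eq {l k : List ℤ} (h : NoOpposite l) (hp : k.Perm l)
    (hk : k.Pairwise (fun a b => |a| ≤ |b|)) : absSort l = k := by
  refine List.Perm.eq_of_pairwise (le := fun a b => |a| ≤ |b|) (fun a b ha hb h₁ h₂ => ?_)
    (absSort_pairwise l) hk ((absSort_perm l).trans hp.symm)
  exact h.eq ((absSort_perm l).mem_iff.1 ha) (hp.mem_iff.1 hb) (le_antisymm h₁ h₂)

open Classical in
/-- The parity of the indicator that a list of labels without opposite entries has alternating
signs, the first one positive, when it is sorted by absolute value. -/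
noncomputable def fanCochain (l : List ℤ) : ZMod 2 :=
  if NoOpposite l then altSign true (absSort l) else 0

theorem fanCochain_perm (k k' : List ℤ) (h : k.Perm k') : fanCochain k = fanCochain k' := by
  unfold fanCochain
  by_cases hk : NoOpposite k
  · have hk' : NoOpposite k' := hk.mono fun x => h.mem_iff.2
    rw [if_pos hk, if_pos hk', absSort_eq hk ((absSort_perm k').trans h.symm)
      (absSort_pairwise k')]
  · have hk' : ¬ NoOpposite k' := fun h' => hk (h'.mono fun x => h.mem_iff.1)
    rw [if_neg hk, if_neg hk']

theorem altSign_map_neg (s : Bool) (l : List ℤ) :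
    altSign s (l.map Neg.neg) = altSign (!s) l := by
  induction l generalizing s with
  | nil => cases s <;> rfl
  | cons x l ih => cases s <;> simp [altSign, ih]

theorem sum_fanCochain {n : ℕ} (t : Fin (n + 1) → ℤ) (ht : NoOpposite (List.ofFn t)) :
    ∑ i, fanCochain (List.ofFn (t ∘ Fin.succAbove i)) =
      fanCochain (List.ofFn t) + fanCochain (List.ofFn (-t)) := by
  set l := absSort (List.ofFn t) with hl
  have hp : l.Perm (List.ofFn t) := absSort_perm _
  have hlo : NoOpposite l := ht.mono fun x => hp.mem_iff.1
  have hneg : List.ofFn (-t) = (List.ofFn t).map Neg.neg := by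
    rw [List.map_ofFn]; rfl
  have hsort : absSort ((List.ofFn t).map Neg.neg) = l.map Neg.neg := by
    refine absSort_eq ht.neg (hp.map _) ?_
    rw [List.pairwise_map]
    simpa only [abs_neg] using absSort_pairwise (List.ofFn t)
  rw [← deletionSum_ofFn, deletionSum_perm fanCochain_perm hp.symm,
    deletionSum_congr (B := altSign true), deletionSum_altSign, hneg, fanCochain, fanCochain,
    if_pos ht, if_pos ht.neg, hsort, altSign_map_neg]
  · intro x hx h0
    exact hlo x hx x hx (by simp [h0])
  · intro k hk
    have hko : NoOpposite k := hlo.mono fun x hx => hk.subset hx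
    rw [fanCochain, if_pos hko, absSort_eq hko (List.Perm.refl _)]
    exact (absSort_pairwise _).sublist hk

theorem nodup_of_altSign_ne_zero {s : Bool} {l : List ℤ} (h : altSign s l ≠ 0)
    (hl : l.Pairwise (fun a b => |a| ≤ |b|)) (ho : NoOpposite l) :
    l.Pairwise (fun a b => |a| < |b|) := by
  induction l generalizing s with
  | nil => exact List.Pairwise.nil
  | cons x l ih =>
    rw [List.pairwise_cons] at hl
    have ho' : NoOpposite l := ho.mono fun y hy => List.mem_cons_of_mem _ hy
    have hs : altSign (!s) l ≠ 0 := by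
      cases s <;> simp only [altSign, ne_eq, ite_eq_right_iff, not_forall] at h <;> exact h.2
    have hl' := ih hs hl.2 ho'
    rw [List.pairwise_cons]
    refine ⟨?_, hl'⟩
    cases l with
    | nil => simp
    | cons y l =>
      have hxy : |x| < |y| := by
        refine lt_of_le_of_ne (hl.1 y (by simp)) fun hxy => ?_
        have := ho.eq (by simp) (by simp) hxy
        subst this
        cases s <;> simp [altSign] at h <;> omega
      intro z hz
      rcases List.mem_cons.1 hz with rfl | hz
      · exact hxy
      · exact hxy.trans_le ((List.pairwise_cons.1 hl.2).1 z hz)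

theorem fanCochain_eq_zero {N : ℕ} {l : List ℤ} (hN : N < l.length) (hl : ∀ x ∈ l, |x| ≤ N) :
    fanCochain l = 0 := by
  unfold fanCochain
  split_ifs with ho
  · by_contra h
    have hp := absSort_perm l
    have hlt := nodup_of_altSign_ne_zero h (absSort_pairwise l) (ho.mono fun x => hp.mem_iff.1)
    have hnd : ((absSort l).map Int.natAbs).Nodup := by
      rw [List.Nodup, List.pairwise_map]
      exact hlt.imp fun {a b} hab => by
        rw [Int.abs_eq_natAbs, Int.abs_eq_natAbs] at hab; omega
    have hsub : ((absSort l).map Int.natAbs).toFinset ⊆ Finset.Icc 1 N := by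
      intro a ha
      rw [List.mem_toFinset, List.mem_map] at ha
      obtain ⟨x, hx, rfl⟩ := ha
      have hx := hp.mem_iff.1 hx
      have h1 := hl x hx
      have h2 := ho x hx x hx
      rw [Int.abs_eq_natAbs] at h1
      rw [Finset.mem_Icc]; omega
    have := Finset.card_le_card hsub
    rw [List.toFinset_card_of_nodup hnd, List.length_map, hp.length_eq, Nat.card_Icc] at this
    omega
  · rfl

/-- The covering relation of the face poset of the cubical lattice: the integer point `x`
represents the cube which is a product of the points `x n` with `x n` even and of the
open intervals `(x n - 1, x n + 1)` with `x n` odd; `Cov x y` says that `x` is a facet of `y`. -/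
def Cov (x y : ℕ → ℤ) : Prop :=
  ∃ n, Odd (y n) ∧ (x n = y n + 1 ∨ x n = y n - 1) ∧ ∀ m, m ≠ n → x m = y m

theorem Cov.reflect_bot {x y : ℕ → ℤ} (h : Cov x y) : Cov (y + y - x) y := by
  obtain ⟨n, h₁, h₂, h₃⟩ := h
  refine ⟨n, h₁, ?_, fun m hm => ?_⟩
  · simp only [Pi.sub_apply, Pi.add_apply]; omega
  · simp [h₃ m hm]

theorem Cov.reflect_top {x y : ℕ → ℤ} (h : Cov x y) : Cov x (x + x - y) := by
  obtain ⟨n, h₁, h₂, h₃⟩ := h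
  refine ⟨n, ?_, ?_, fun m hm => ?_⟩
  · simp only [Pi.sub_apply, Pi.add_apply]
    rw [Int.odd_iff] at *; omega
  · simp only [Pi.sub_apply, Pi.add_apply]; omega
  · simp [h₃ m hm]

theorem Cov.reflect_mid {x y z : ℕ → ℤ} (h : Cov x y) (h' : Cov y z) :
    Cov x (x + z - y) ∧ Cov (x + z - y) z := by
  obtain ⟨n, h₁, h₂, h₃⟩ := h
  obtain ⟨k, h₁', h₂', h₃'⟩ := h'
  have hne : n ≠ k := by
    rintro rfl
    rw [Int.odd_iff] at *; omega
  refine ⟨⟨k, ?_, ?_, fun m hm => ?_⟩, ⟨n, ?_, ?_, fun m hm => ?_⟩⟩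
  · simp only [Pi.sub_apply, Pi.add_apply, h₃ k hne.symm]
    rw [Int.odd_iff] at *; omega
  · simp only [Pi.sub_apply, Pi.add_apply, h₃ k hne.symm]; omega
  · simp [h₃' m hm]
  · rwa [← h₃' n hne]
  · have := h₃' n hne
    simp only [Pi.sub_apply, Pi.add_apply]; omega
  · simp [h₃ m hm]

theorem Cov.neg {x y : ℕ → ℤ} (h : Cov x y) : Cov (-x) (-y) := by
  obtain ⟨n, h₁, h₂, h₃⟩ := h
  refine ⟨n, by simpa using h₁, ?_, fun m hm => by simp [h₃ m hm]⟩
  simp only [Pi.neg_apply]; omega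

theorem Cov.ne {x y : ℕ → ℤ} (h : Cov x y) : x ≠ y := by
  obtain ⟨n, -, h₂, -⟩ := h
  rintro rfl
  omega

theorem Cov.abs_sub_le {x y : ℕ → ℤ} (h : Cov x y) (m : ℕ) : |x m - y m| ≤ 1 := by
  obtain ⟨n, -, h₂, h₃⟩ := h
  rw [abs_le]
  by_cases hm : m = n
  · subst hm; omega
  · have := h₃ m hm; omega

/-- Complete flags of faces of the cubical decomposition of `ℝ^j`, where `ℝ^j` is embedded in
the space of all sequences. -/
structure IsFlag (j : ℕ) (v : Fin (j + 1) → ℕ → ℤ) : Prop where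
  cov : ∀ i k : Fin (j + 1), i.val + 1 = k.val → Cov (v i) (v k)
  even : ∀ n, Even (v 0 n)
  odd : ∀ n < j, Odd (v (Fin.last j) n)
  supp : ∀ i n, j ≤ n → v i n = 0

theorem IsFlag.neg {j : ℕ} {v : Fin (j + 1) → ℕ → ℤ} (h : IsFlag j v) : IsFlag j (-v) where
  cov i k hik := (h.cov i k hik).neg
  even n := by simpa using h.even n
  odd n hn := by simpa using h.odd n hn
  supp i n hn := by simpa using h.supp i n hn

theorem IsFlag.abs_sub_le {j : ℕ} {v : Fin (j + 1) → ℕ → ℤ} (h : IsFlag j v) (i k : Fin (j + 1))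
    (n : ℕ) : |v i n - v k n| ≤ j := by
  have key : ∀ (c : ℕ) (i k : Fin (j + 1)), i.val + c = k.val → |v i n - v k n| ≤ c := by
    intro c
    induction c with
    | zero => intro i k hik; rw [Fin.ext (a := i) (b := k) (by omega)]; simp
    | succ c ih =>
      intro i k hik
      have hlt : i.val + c < j + 1 := by omega
      have h1 := ih i ⟨i.val + c, hlt⟩ rfl
      have h2 := (h.cov ⟨i.val + c, hlt⟩ k (by simp; omega)).abs_sub_le n
      have := _root_.abs_sub_le (v i n) (v ⟨i.val + c, hlt⟩ n) (v k n)
      push_cast; omega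
  rcases le_total i.val k.val with hik | hik
  · exact (key (k.val - i.val) i k (by omega)).trans (by omega)
  · rw [abs_sub_comm]
    exact (key (i.val - k.val) k i (by omega)).trans (by omega)

/-- The lower neighbour of an index, reflected at the bottom. -/
def lowerIdx {j : ℕ} (r : Fin (j + 2)) : Fin (j + 2) :=
  ⟨if r.val = 0 then 1 else r.val - 1, by split_ifs <;> omega⟩

/-- The upper neighbour of an index, reflected at the top. -/
def upperIdx {j : ℕ} (r : Fin (j + 2)) : Fin (j + 2) :=
  ⟨if r.val = j + 1 then j else r.val + 1, by split_ifs <;> omega⟩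

theorem lowerIdx_ne {j : ℕ} (r : Fin (j + 2)) : lowerIdx r ≠ r := by
  intro h
  have := congrArg Fin.val h
  simp only [lowerIdx] at this
  split_ifs at this <;> omega

theorem upperIdx_ne {j : ℕ} (r : Fin (j + 2)) : upperIdx r ≠ r := by
  intro h
  have := congrArg Fin.val h
  simp only [upperIdx] at this
  split_ifs at this <;> omega

/-- The flag which agrees with `v` except at index `r`. -/
def flagFlip {j : ℕ} (v : Fin (j + 2) → ℕ → ℤ) (r : Fin (j + 2)) : Fin (j + 2) → ℕ → ℤ :=
  Function.update v r (v (lowerIdx r) + v (upperIdx r) - v r)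

theorem flagFlip_of_ne {j : ℕ} (v : Fin (j + 2) → ℕ → ℤ) {r i : Fin (j + 2)} (h : i ≠ r) :
    flagFlip v r i = v i := Function.update_of_ne h _ _

theorem flagFlip_self {j : ℕ} (v : Fin (j + 2) → ℕ → ℤ) (r : Fin (j + 2)) :
    flagFlip v r r = v (lowerIdx r) + v (upperIdx r) - v r := Function.update_self _ _ _

theorem flagFlip_flagFlip {j : ℕ} (v : Fin (j + 2) → ℕ → ℤ) (r : Fin (j + 2)) :
    flagFlip (flagFlip v r) r = v := by
  funext i
  by_cases hi : i = r
  · subst hi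
    rw [flagFlip_self, flagFlip_self, flagFlip_of_ne _ (lowerIdx_ne _), flagFlip_of_ne _ (upperIdx_ne _)]
    abel
  · rw [flagFlip_of_ne _ hi, flagFlip_of_ne _ hi]

theorem flagFlip_comp_succAbove {j : ℕ} (v : Fin (j + 2) → ℕ → ℤ) (r : Fin (j + 2)) :
    flagFlip v r ∘ r.succAbove = v ∘ r.succAbove := by
  funext i
  exact flagFlip_of_ne _ (Fin.succAbove_ne r i)

theorem lowerIdx_eq {j : ℕ} {r i : Fin (j + 2)} (h : i.val + 1 = r.val) : lowerIdx r = i := by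
  ext; simp only [lowerIdx]; split_ifs <;> omega

theorem upperIdx_eq {j : ℕ} {r i : Fin (j + 2)} (h : r.val + 1 = i.val) : upperIdx r = i := by
  ext; simp only [upperIdx]; split_ifs <;> omega

theorem lowerIdx_eq_upperIdx {j : ℕ} {r : Fin (j + 2)} (h : r.val = 0 ∨ r.val = j + 1) :
    lowerIdx r = upperIdx r := by
  ext; simp only [lowerIdx, upperIdx]; split_ifs <;> omega

theorem IsFlag.flip {j : ℕ} {v : Fin (j + 2) → ℕ → ℤ} (h : IsFlag (j + 1) v)
    (r : Fin (j + 2)) : IsFlag (j + 1) (flagFlip v r) where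
  cov i k hik := by
    by_cases hi : i = r
    · subst hi
      have hk : k ≠ i := by rintro rfl; omega
      rw [flagFlip_self, flagFlip_of_ne _ hk, upperIdx_eq hik]
      by_cases h0 : i.val = 0
      · rw [lowerIdx_eq_upperIdx (Or.inl h0), upperIdx_eq hik]
        exact (h.cov i k hik).reflect_bot
      · have hlow : i.val - 1 + 1 = i.val := by omega
        rw [lowerIdx_eq (i := ⟨i.val - 1, by omega⟩) hlow]
        exact ((h.cov ⟨i.val - 1, by omega⟩ i hlow).reflect_mid (h.cov i k hik)).2
    · rw [flagFlip_of_ne _ hi]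
      by_cases hk : k = r
      · subst hk
        rw [flagFlip_self, lowerIdx_eq hik]
        by_cases h0 : k.val = j + 1
        · rw [← lowerIdx_eq_upperIdx (Or.inr h0), lowerIdx_eq hik]
          exact (h.cov i k hik).reflect_top
        · rw [upperIdx_eq (i := ⟨k.val + 1, by omega⟩) rfl]
          exact ((h.cov i k hik).reflect_mid (h.cov k ⟨k.val + 1, by omega⟩ rfl)).1
      · rw [flagFlip_of_ne _ hk]
        exact h.cov i k hik
  even n := by
    by_cases hr : 0 = r
    · subst hr
      rw [flagFlip_self, lowerIdx_eq_upperIdx (Or.inl rfl)]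
      have := h.even n
      simp only [Pi.sub_apply, Pi.add_apply]
      rw [Int.even_iff] at *; omega
    · rw [flagFlip_of_ne _ hr]; exact h.even n
  odd n hn := by
    by_cases hr : Fin.last (j + 1) = r
    · subst hr
      rw [flagFlip_self, lowerIdx_eq_upperIdx (Or.inr rfl)]
      have := h.odd n hn
      simp only [Pi.sub_apply, Pi.add_apply]
      rw [Int.odd_iff] at *; omega
    · rw [flagFlip_of_ne _ hr]; exact h.odd n hn
  supp i n hn := by
    by_cases hr : i = r
    · subst hr
      rw [flagFlip_self]
      simp [h.supp _ n hn]
    · rw [flagFlip_of_ne _ hr]; exact h.supp i n hn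

theorem IsFlag.flip_ne {j : ℕ} {v : Fin (j + 2) → ℕ → ℤ} (h : IsFlag (j + 1) v)
    (r : Fin (j + 2)) : flagFlip v r ≠ v := by
  intro heq
  have heq : v (lowerIdx r) + v (upperIdx r) - v r = v r := by
    rw [← flagFlip_self, heq]
  by_cases h0 : r.val = 0
  · have hc := h.cov r ⟨r.val + 1, by omega⟩ rfl
    rw [lowerIdx_eq_upperIdx (Or.inl h0), upperIdx_eq (i := ⟨r.val + 1, by omega⟩) rfl] at heq
    apply hc.ne
    funext n
    have := congrFun heq n
    simp only [Pi.sub_apply, Pi.add_apply] at this; omega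
  have hlow : r.val - 1 + 1 = r.val := by omega
  have hc := h.cov ⟨r.val - 1, by omega⟩ r hlow
  by_cases h1 : r.val = j + 1
  · rw [← lowerIdx_eq_upperIdx (Or.inr h1), lowerIdx_eq (i := ⟨r.val - 1, by omega⟩) hlow] at heq
    apply hc.ne
    funext n
    have := congrFun heq n
    simp only [Pi.sub_apply, Pi.add_apply] at this; omega
  · obtain ⟨n, hn, hn', hn''⟩ := hc
    obtain ⟨k, hk, hk', hk''⟩ := h.cov r ⟨r.val + 1, by omega⟩ rfl
    rw [upperIdx_eq (i := ⟨r.val + 1, by omega⟩) rfl,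
      lowerIdx_eq (i := ⟨r.val - 1, by omega⟩) hlow] at heq
    have h2 := congrFun heq n
    simp only [Pi.sub_apply, Pi.add_apply] at h2
    by_cases hnk : n = k
    · subst hnk
      rw [Int.odd_iff] at *; omega
    · have := hk'' n hnk; omega

open Classical in
/-- The complete flags of dimension `j` with all vertices in `A`. -/
noncomputable def flagsIn (A : Finset (ℕ → ℤ)) (j : ℕ) : Finset (Fin (j + 1) → ℕ → ℤ) :=
  (Fintype.piFinset fun _ => A).filter (IsFlag j)

theorem mem_flagsIn {A : Finset (ℕ → ℤ)} {j : ℕ} {v : Fin (j + 1) → ℕ → ℤ} :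
    v ∈ flagsIn A j ↔ (∀ i, v i ∈ A) ∧ IsFlag j v := by
  simp [flagsIn]

/-- The flags of `flagsIn A (j + 1)` which lie in the upper half space of `ℝ^{j+1}`. -/
noncomputable def upperFlagsIn (A : Finset (ℕ → ℤ)) (j : ℕ) :
    Finset (Fin (j + 2) → ℕ → ℤ) :=
  (flagsIn A (j + 1)).filter fun v => 0 < v (Fin.last (j + 1)) j

theorem mem_upperFlagsIn {A : Finset (ℕ → ℤ)} {j : ℕ} {v : Fin (j + 2) → ℕ → ℤ} :
    v ∈ upperFlagsIn A j ↔
      ((∀ i, v i ∈ A) ∧ IsFlag (j + 1) v) ∧ 0 < v (Fin.last (j + 1)) j := by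
  simp [upperFlagsIn, mem_flagsIn]

theorem sum_eq_zero_of_flip {j : ℕ} (r : Fin (j + 2))
    (b : (Fin (j + 1) → ℕ → ℤ) → ZMod 2) (S : Finset (Fin (j + 2) → ℕ → ℤ))
    (hS : ∀ v ∈ S, IsFlag (j + 1) v)
    (hflip : ∀ v ∈ S, b (v ∘ r.succAbove) ≠ 0 → flagFlip v r ∈ S) :
    ∑ v ∈ S, b (v ∘ r.succAbove) = 0 := by
  rw [← Finset.sum_filter_ne_zero]
  refine Finset.sum_involution (fun v _ => flagFlip v r) (fun v _ => ?_) (fun v hv _ => ?_)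
    (fun v hv => ?_) (fun v _ => flagFlip_flagFlip v r)
  · rw [flagFlip_comp_succAbove]; exact CharTwo.add_self_eq_zero _
  · exact (hS v (Finset.mem_filter.1 hv).1).flip_ne r
  · rw [Finset.mem_filter] at hv ⊢
    exact ⟨hflip v hv.1 hv.2, by rw [flagFlip_comp_succAbove]; exact hv.2⟩

theorem IsFlag.eq_zero_of_penultimate {j : ℕ} {v : Fin (j + 2) → ℕ → ℤ}
    (h : IsFlag (j + 1) v) (h0 : v (Fin.last j).castSucc j = 0) (i : Fin (j + 1)) :
    v i.castSucc j = 0 := by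
  induction i using Fin.reverseInduction with
  | last => exact h0
  | cast i ih =>
    obtain ⟨n, hn, hn', hn''⟩ := h.cov i.castSucc.castSucc i.succ.castSucc (by simp)
    rw [hn'' j _, ih]
    rintro rfl
    rw [ih] at hn
    simp at hn

theorem IsFlag.comp_castSucc {j : ℕ} {v : Fin (j + 2) → ℕ → ℤ}
    (h : IsFlag (j + 1) v) (h0 : v (Fin.last j).castSucc j = 0) :
    IsFlag j (v ∘ Fin.castSucc) where
  cov i k hik := h.cov _ _ (by simpa using hik)
  even n := h.even n
  odd n hn := by
    have hodd := h.odd n (by omega)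
    obtain ⟨k, hk, hk', hk''⟩ := h.cov (Fin.last j).castSucc (Fin.last (j + 1)) (by simp)
    have hkj : k = j := by
      by_contra hkj
      have := h.odd j (by omega)
      rw [← hk'' j (Ne.symm hkj), h0] at this
      simp at this
    simp only [Function.comp_apply]
    rw [hk'' n (by omega)]
    exact hodd
  supp i n hn := by
    rcases hn.eq_or_lt with rfl | hn
    · exact h.eq_zero_of_penultimate h0 i
    · exact h.supp _ n hn

theorem IsFlag.last_eq {j : ℕ} {v : Fin (j + 2) → ℕ → ℤ}
    (h : IsFlag (j + 1) v) (h0 : v (Fin.last j).castSucc j = 0)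
    (hpos : 0 < v (Fin.last (j + 1)) j) :
    v (Fin.last (j + 1)) = Function.update (v (Fin.last j).castSucc) j 1 := by
  obtain ⟨k, hk, hk', hk''⟩ := h.cov (Fin.last j).castSucc (Fin.last (j + 1)) (by simp)
  have hkj : k = j := by
    by_contra hkj
    have := hk'' j (Ne.symm hkj)
    omega
  subst hkj
  funext n
  by_cases hn : n = k
  · subst hn; simp; omega
  · rw [Function.update_of_ne hn, hk'' n hn]

theorem IsFlag.snoc {j : ℕ} {u : Fin (j + 1) → ℕ → ℤ} (h : IsFlag j u) :
    IsFlag (j + 1)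
      (Fin.snoc (α := fun _ => ℕ → ℤ) u (Function.update (u (Fin.last j)) j 1)) where
  cov i k hik := by
    induction i using Fin.lastCases with
    | last => simp at hik; omega
    | cast i =>
      rw [Fin.snoc_castSucc]
      induction k using Fin.lastCases with
      | last =>
        have hi : i = Fin.last j := by ext; simp at hik ⊢; omega
        subst hi
        rw [Fin.snoc_last]
        refine ⟨j, by simp, ?_, fun m hm => by simp [hm]⟩
        simp [h.supp _ j le_rfl]
      | cast k =>
        rw [Fin.snoc_castSucc]
        exact h.cov i k (by simpa using hik)
  even n := by
    rw [← Fin.castSucc_zero, Fin.snoc_castSucc]; exact h.even n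
  odd n hn := by
    rw [Fin.snoc_last]
    by_cases hnj : n = j
    · subst hnj; simp
    · rw [Function.update_of_ne hnj]; exact h.odd n (by omega)
  supp i n hn := by
    induction i using Fin.lastCases with
    | last => rw [Fin.snoc_last, Function.update_of_ne (by omega)]; exact h.supp _ n (by omega)
    | cast i => rw [Fin.snoc_castSucc]; exact h.supp _ n (by omega)

theorem sum_upperFlagsIn_add {j : ℕ} (A : Finset (ℕ → ℤ))
    (b : (Fin (j + 1) → ℕ → ℤ) → ZMod 2)
    (hb : ∀ v : Fin (j + 2) → ℕ → ℤ, IsFlag (j + 1) v → ∀ r, (∀ i, i ≠ r → v i ∈ A) →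
      v r ∉ A → b (v ∘ r.succAbove) = 0) :
    ∑ v ∈ upperFlagsIn A j, ∑ r : Fin (j + 2), b (v ∘ r.succAbove) +
      ∑ u ∈ flagsIn A j, b u = 0 := by
  have hmem : ∀ v r, ((∀ i, v i ∈ A) ∧ IsFlag (j + 1) v) → b (v ∘ r.succAbove) ≠ 0 →
      ((∀ i, flagFlip v r i ∈ A) ∧ IsFlag (j + 1) (flagFlip v r)) := by
    rintro v r ⟨hvA, hv⟩ hne
    have hi : ∀ i, i ≠ r → flagFlip v r i ∈ A := fun i hi => by
      rw [flagFlip_of_ne _ hi]; exact hvA i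
    refine ⟨fun i => ?_, hv.flip r⟩
    by_cases hir : i = r
    · subst hir
      by_contra hnot
      refine hne ?_
      rw [← flagFlip_comp_succAbove]
      exact hb _ (hv.flip i) i hi hnot
    · exact hi i hir
  rw [Finset.sum_comm, Fin.sum_univ_castSucc, Finset.sum_eq_zero, zero_add]
  · have hlast : (Fin.last (j + 1)).succAbove = Fin.castSucc := by
      funext i; simp
    rw [← Finset.sum_filter_add_sum_filter_not _ fun v => v (Fin.last j).castSucc j = 0,
      sum_eq_zero_of_flip _ b ((upperFlagsIn A j).filter fun v => ¬v (Fin.last j).castSucc j = 0),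
      add_zero]
    · have : ∑ v ∈ upperFlagsIn A j with v (Fin.last j).castSucc j = 0,
          b (v ∘ (Fin.last (j + 1)).succAbove) = ∑ u ∈ flagsIn A j, b u := by
        refine Finset.sum_bij_ne_zero (fun v _ _ => v ∘ Fin.castSucc) ?_ ?_ ?_ ?_
        · intro v hv _
          rw [Finset.mem_filter, mem_upperFlagsIn] at hv
          exact mem_flagsIn.2 ⟨fun i => hv.1.1.1 _, hv.1.1.2.comp_castSucc hv.2⟩
        · intro v hv _ v' hv' _ heq
          rw [Finset.mem_filter, mem_upperFlagsIn] at hv hv'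
          have hcast : ∀ i : Fin (j + 1), v i.castSucc = v' i.castSucc := congrFun heq
          funext i
          induction i using Fin.lastCases with
          | last =>
            rw [hv.1.1.2.last_eq hv.2 hv.1.2, hv'.1.1.2.last_eq hv'.2 hv'.1.2, hcast]
          | cast i => exact hcast i
        · intro u hu hne
          obtain ⟨huA, hu⟩ := mem_flagsIn.1 hu
          set v : Fin (j + 2) → ℕ → ℤ :=
            Fin.snoc (α := fun _ => ℕ → ℤ) u (Function.update (u (Fin.last j)) j 1) with hv
          have hvc : v ∘ Fin.castSucc = u := by
            funext i; exact Fin.snoc_castSucc (α := fun _ => ℕ → ℤ) _ _ _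
          have hvl : v (Fin.last (j + 1)) = Function.update (u (Fin.last j)) j 1 :=
            Fin.snoc_last (α := fun _ => ℕ → ℤ) _ _
          have hvf : IsFlag (j + 1) v := hu.snoc
          have hvA : ∀ i, i ≠ Fin.last (j + 1) → v i ∈ A := by
            intro i hi
            induction i using Fin.lastCases with
            | last => exact absurd rfl hi
            | cast i => rw [← Function.comp_apply (f := v), hvc]; exact huA i
          have hne' : b (v ∘ (Fin.last (j + 1)).succAbove) ≠ 0 := by rwa [hlast, hvc]
          have hvA' : ∀ i, v i ∈ A := by
            intro i
            by_cases hi : i = Fin.last (j + 1)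
            · subst hi
              by_contra hnot
              exact hne' (hb v hvf _ hvA hnot)
            · exact hvA i hi
          refine ⟨v, ?_, hne', hvc⟩
          rw [Finset.mem_filter, mem_upperFlagsIn]
          refine ⟨⟨⟨hvA', hvf⟩, by simp [hvl]⟩, ?_⟩
          rw [← Function.comp_apply (f := v), hvc]
          exact hu.supp _ _ le_rfl
        · intro v _ _
          rw [hlast]
      rw [this]; exact CharTwo.add_self_eq_zero _
    · intro v hv
      exact (mem_upperFlagsIn.1 (Finset.mem_filter.1 hv).1).1.2
    · intro v hv hne
      rw [Finset.mem_filter, mem_upperFlagsIn] at hv ⊢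
      have hv0 : flagFlip v (Fin.last (j + 1)) (Fin.last j).castSucc = v (Fin.last j).castSucc :=
        flagFlip_of_ne _ (Fin.castSucc_lt_last _).ne
      refine ⟨⟨hmem v _ hv.1.1 hne, ?_⟩, by rw [hv0]; exact hv.2⟩
      rw [flagFlip_self, ← lowerIdx_eq_upperIdx (Or.inr rfl),
        lowerIdx_eq (i := (Fin.last j).castSucc) rfl]
      obtain ⟨k, hk, hk', hk''⟩ :=
        hv.1.1.2.cov (Fin.last j).castSucc (Fin.last (j + 1)) (by simp)
      have h0 := hv.2
      have hpos := hv.1.2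
      simp only [Pi.sub_apply, Pi.add_apply]
      by_cases hkj : j = k
      · subst hkj
        rw [Int.odd_iff] at hk; omega
      · have := hk'' j hkj; omega
  · intro r _
    refine sum_eq_zero_of_flip _ b _ (fun v hv => (mem_upperFlagsIn.1 hv).1.2) ?_
    intro v hv hne
    rw [mem_upperFlagsIn] at hv ⊢
    refine ⟨hmem v _ hv.1 hne, ?_⟩
    rw [flagFlip_of_ne _ (Fin.castSucc_lt_last _).ne']
    exact hv.2

theorem sum_flagsIn_succ {A : Finset (ℕ → ℤ)} (hA : ∀ x ∈ A, -x ∈ A) (j : ℕ)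
    (g : (Fin (j + 2) → ℕ → ℤ) → ZMod 2) :
    ∑ v ∈ flagsIn A (j + 1), g v = ∑ v ∈ upperFlagsIn A j, (g v + g (-v)) := by
  rw [← Finset.sum_filter_add_sum_filter_not _ fun v => 0 < v (Fin.last (j + 1)) j,
    Finset.sum_add_distrib]
  congr 1
  refine Finset.sum_nbij' (fun v => -v) (fun v => -v) ?_ ?_ (fun v _ => neg_neg v)
    (fun v _ => neg_neg v) (fun v _ => by rw [neg_neg])
  · intro v hv
    rw [Finset.mem_filter, mem_flagsIn] at hv
    refine mem_upperFlagsIn.2 ⟨⟨fun i => hA _ (hv.1.1 i), hv.1.2.neg⟩, ?_⟩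
    have h1 := hv.1.2.odd j (by omega)
    have h2 := hv.2
    simp only [Pi.neg_apply]
    rw [Int.odd_iff] at h1; omega
  · intro v hv
    rw [mem_upperFlagsIn] at hv
    refine Finset.mem_filter.2 ⟨mem_flagsIn.2 ⟨fun i => hA _ (hv.1.1 i), hv.1.2.neg⟩, ?_⟩
    have h2 := hv.2
    simp only [Pi.neg_apply]
    omega

theorem sum_flagsIn_neg {A : Finset (ℕ → ℤ)} (hA : ∀ x ∈ A, -x ∈ A) (j : ℕ)
    (g : (Fin (j + 1) → ℕ → ℤ) → ZMod 2) :
    ∑ v ∈ flagsIn A j, g (-v) = ∑ v ∈ flagsIn A j, g v := by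
  have : ∀ v ∈ flagsIn A j, -v ∈ flagsIn A j := fun v hv => by
    rw [mem_flagsIn] at hv ⊢
    exact ⟨fun i => hA _ (hv.1 i), hv.2.neg⟩
  exact Finset.sum_nbij' (fun v => -v) (fun v => -v) this this (fun v _ => neg_neg v)
    (fun v _ => neg_neg v) (fun v _ => rfl)

theorem sum_boundary_succ {A : Finset (ℕ → ℤ)} (hA : ∀ x ∈ A, -x ∈ A) (l : (ℕ → ℤ) → ℤ)
    (hl : ∀ x, l (-x) = -l x) (j : ℕ)
    (hopp : ∀ x ∈ A, ∀ y ∈ A, ∀ z ∉ A, (∀ n, j + 1 ≤ n → z n = 0) →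
      (∀ n, |x n - z n| ≤ (j + 1 : ℕ)) → (∀ n, |y n - z n| ≤ (j + 1 : ℕ)) → l x + l y ≠ 0) :
    ∑ v ∈ flagsIn A (j + 1), ∑ r : Fin (j + 2),
        fanCochain (List.ofFn (l ∘ v ∘ r.succAbove)) =
      ∑ v ∈ flagsIn A j, ∑ r : Fin (j + 1), fanCochain (List.ofFn (l ∘ v ∘ r.succAbove)) := by
  let a : (Fin (j + 1) → ℕ → ℤ) → ZMod 2 := fun t => fanCochain (List.ofFn (l ∘ t))
  let d : (Fin (j + 1) → ℕ → ℤ) → ZMod 2 := fun t =>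
    ∑ s : Fin (j + 1), fanCochain (List.ofFn (l ∘ t ∘ s.succAbove))
  have hneg : ∀ {k : ℕ} (t : Fin k → ℕ → ℤ), l ∘ (-t) = -(l ∘ t) := fun t =>
    funext fun i => hl _
  have key := sum_upperFlagsIn_add A (fun t => (a t + a (-t)) + d t) (by
    intro v hv r hvA hr
    have hno : NoOpposite (List.ofFn (l ∘ v ∘ r.succAbove)) := by
      intro x hx y hy
      rw [List.mem_ofFn'] at hx hy
      obtain ⟨i, rfl⟩ := hx
      obtain ⟨k, rfl⟩ := hy
      exact hopp _ (hvA _ (Fin.succAbove_ne r i)) _ (hvA _ (Fin.succAbove_ne r k)) _ hr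
        (hv.supp r) (hv.abs_sub_le _ _) (hv.abs_sub_le _ _)
    have := sum_fanCochain _ hno
    simp only [a, d, hneg, ← this]
    exact CharTwo.add_self_eq_zero _)
  have hdd : ∀ v : Fin (j + 2) → ℕ → ℤ, ∑ r : Fin (j + 2), d (v ∘ r.succAbove) = 0 := by
    intro v
    rw [← deletionSum_deletionSum fanCochain (List.ofFn (l ∘ v)), deletionSum_ofFn]
    refine Finset.sum_congr rfl fun r _ => ?_
    rw [deletionSum_ofFn]
    rfl
  have hK : ∑ u ∈ flagsIn A j, a u + ∑ u ∈ flagsIn A j, a (-u) = 0 := by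
    rw [sum_flagsIn_neg hA j a]
    exact CharTwo.add_self_eq_zero _
  simp only [Finset.sum_add_distrib, hdd, add_zero, hK, zero_add] at key
  have hsum := sum_flagsIn_succ hA j (fun v => ∑ r : Fin (j + 2), a (v ∘ r.succAbove))
  have hX : ∑ v ∈ flagsIn A (j + 1), ∑ r : Fin (j + 2), a (v ∘ r.succAbove) +
      ∑ u ∈ flagsIn A j, d u = 0 := by
    rw [hsum, ← key, Finset.sum_add_distrib]
    rfl
  exact CharTwo.add_eq_zero.1 hX

/-- A combinatorial Borsuk theorem: an odd labelling of the integer points by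
`0, ±1, …, ±N` has, for each symmetric finite neighbourhood `A` of the origin in dimension
`N + 1`, two opposite labels in `A` close to a common point outside of `A`. -/
theorem exists_opposite_labels {N : ℕ} {A : Finset (ℕ → ℤ)} (hA0 : 0 ∈ A)
    (hA : ∀ x ∈ A, -x ∈ A) (l : (ℕ → ℤ) → ℤ) (hl : ∀ x, l (-x) = -l x)
    (hlN : ∀ x, |l x| ≤ N) :
    ∃ x ∈ A, ∃ y ∈ A, ∃ z ∉ A, (∀ n, N + 1 ≤ n → z n = 0) ∧
      (∀ n, |x n - z n| ≤ (N + 1 : ℕ)) ∧ (∀ n, |y n - z n| ≤ (N + 1 : ℕ)) ∧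
      l x + l y = 0 := by
  by_contra! hcon
  have hY : ∀ j ≤ N + 1, ∑ v ∈ flagsIn A j, ∑ r : Fin (j + 1),
      fanCochain (List.ofFn (l ∘ v ∘ r.succAbove)) = 1 := by
    intro j
    induction j with
    | zero =>
      intro _
      have : flagsIn A 0 = {0} := by
        ext v
        rw [mem_flagsIn, Finset.mem_singleton]
        constructor
        · rintro ⟨-, hv⟩
          funext i n
          exact hv.supp i n (Nat.zero_le n)
        · rintro rfl
          exact ⟨fun _ => hA0, fun i k hik => by omega, fun n => by simp, fun n hn => by omega,
            fun _ _ _ => rfl⟩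
      rw [this]
      simp [fanCochain, NoOpposite, absSort, altSign]
    | succ j ih =>
      intro hj
      rw [sum_boundary_succ hA l hl j, ih (by omega)]
      intro x hx y hy z hz hz' hxz hyz
      refine hcon x hx y hy z hz (fun n hn => hz' n (by omega)) (fun n => ?_) (fun n => ?_)
      · exact (hxz n).trans (by exact_mod_cast hj)
      · exact (hyz n).trans (by exact_mod_cast hj)
  have h1 := hY (N + 1) le_rfl
  rw [Finset.sum_eq_zero] at h1
  · exact zero_ne_one h1
  · intro v _
    refine Finset.sum_eq_zero fun r _ => fanCochain_eq_zero (N := N) (by simp) ?_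
    intro x hx
    rw [List.mem_ofFn'] at hx
    obtain ⟨i, rfl⟩ := hx
    exact hlN _

theorem exists_odd_labelling (N : ℕ) :
    ∃ lab : (Fin N → ℝ) → ℤ, (∀ u, lab (-u) = -lab u) ∧ (∀ u, |lab u| ≤ N) ∧
      ∀ u w, lab u + lab w = 0 → ‖u‖ ≤ ‖u - w‖ := by
  classical
  have hmax : ∀ a : Fin N → ℝ, ∃ k : ℕ, ∀ u : Fin N → ℝ, u ≠ 0 → (fun i => |u i|) = a →
      ∃ i : Fin N, i.val = k ∧ |u i| = ‖u‖ := by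
    intro a
    by_cases hN : Nonempty (Fin N)
    · obtain ⟨i, hi⟩ := Finite.exists_max a
      refine ⟨i, fun u _ hua => ⟨i, rfl, ?_⟩⟩
      subst hua
      exact le_antisymm (norm_le_pi_norm u i)
        ((pi_norm_le_iff_of_nonneg (abs_nonneg _)).2 hi)
    · refine ⟨0, fun u hu _ => absurd ?_ hu⟩
      funext i
      exact absurd ⟨i⟩ hN
  choose idx hidx using hmax
  let c : (Fin N → ℝ) → ℕ := fun u => idx fun i => |u i|
  have hc : ∀ u : Fin N → ℝ, u ≠ 0 → ∃ i : Fin N, i.val = c u ∧ |u i| = ‖u‖ := fun u hu =>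
    hidx _ u hu rfl
  have hcneg : ∀ u, c (-u) = c u := fun u => by simp [c]
  let sg : (Fin N → ℝ) → Prop := fun u => ∃ i : Fin N, i.val = c u ∧ 0 < u i
  refine ⟨fun u => if u = 0 then 0 else if sg u then (c u : ℤ) + 1 else -((c u : ℤ) + 1),
    fun u => ?_, fun u => ?_, fun u w h => ?_⟩
  · by_cases hu : u = 0
    · simp [hu]
    · obtain ⟨i, hi, hiu⟩ := hc u hu
      have hpos : 0 < |u i| := by rw [hiu]; exact norm_pos_iff.2 hu
      have hne : u i ≠ 0 := abs_pos.1 hpos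
      have h1 : sg u ↔ 0 < u i := by
        constructor
        · rintro ⟨k, hk, hk'⟩
          rwa [Fin.ext (a := i) (b := k) (by omega)]
        · exact fun h => ⟨i, hi, h⟩
      have h2 : sg (-u) ↔ u i < 0 := by
        constructor
        · rintro ⟨k, hk, hk'⟩
          rw [hcneg] at hk
          rw [Fin.ext (a := i) (b := k) (by omega)]
          simpa using hk'
        · exact fun h => ⟨i, by rw [hcneg, hi], by simpa using h⟩
      simp only [neg_eq_zero, hu, if_false, hcneg, h1, h2]
      rcases lt_or_gt_of_ne hne with h | h
      · simp [h, not_lt.2 h.le]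
      · simp [h, not_lt.2 h.le]
  · by_cases hu : u = 0
    · simp [hu]
    · obtain ⟨i, hi, -⟩ := hc u hu
      have := i.2
      simp only [hu, if_false]
      split_ifs <;> rw [abs_le] <;> omega
  · by_cases hu : u = 0
    · simp [hu]
    by_cases hw : w = 0
    · simp [hw]
    obtain ⟨i, hi, hiu⟩ := hc u hu
    obtain ⟨k, hk, hkw⟩ := hc w hw
    simp only [hu, hw, if_false] at h
    have hopp : i = k ∧ (sg u ↔ ¬ sg w) := by
      rw [Fin.ext_iff]
      split_ifs at h with h1 h2 h2 <;> simp only [h1, h2] <;> constructor <;> first | omega | tauto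
    obtain ⟨rfl, hs⟩ := hopp
    have h1 : sg u ↔ 0 < u i := by
      constructor
      · rintro ⟨k, hk, hk'⟩
        rwa [Fin.ext (a := i) (b := k) (by omega)]
      · exact fun h => ⟨i, hi, h⟩
    have h2 : sg w ↔ 0 < w i := by
      constructor
      · rintro ⟨l, hl, hl'⟩
        rwa [Fin.ext (a := i) (b := l) (by omega)]
      · exact fun h => ⟨i, hk, h⟩
    rw [h1, h2, not_lt] at hs
    rw [← hiu]
    refine le_trans ?_ (norm_le_pi_norm (u - w) i)
    rw [Pi.sub_apply, Real.norm_eq_abs]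
    by_cases hpos : 0 < u i
    · rw [abs_of_pos hpos]
      exact le_trans (by linarith [hs.1 hpos]) (le_abs_self _)
    · have hw0 : 0 < w i := not_le.1 fun h => hpos (hs.2 h)
      rw [abs_of_nonpos (not_lt.1 hpos)]
      exact le_trans (by linarith) (neg_le_abs _)

/-- Borsuk's theorem, for a neighbourhood of the origin given by an even function `e`: an odd
map `ℝ^{N+1} → ℝ^N` has a zero on the zero set of `e`. -/
theorem exists_zero_of_odd {N : ℕ} {H : (Fin (N + 1) → ℝ) → Fin N → ℝ} (hH : Continuous H)
    (hodd : ∀ v, H (-v) = -H v) {e : (Fin (N + 1) → ℝ) → ℝ} (he : Continuous e)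
    (heven : ∀ v, e (-v) = e v) (h0 : 0 < e 0) {R : ℝ} (hR : ∀ v, R < ‖v‖ → e v ≤ 0) :
    ∃ v, H v = 0 ∧ e v = 0 := by
  by_contra! hcon
  have hB : IsCompact (Metric.closedBall (0 : Fin (N + 1) → ℝ) (R + 1)) :=
    isCompact_closedBall _ _
  have hR0 : 0 ≤ R := by
    by_contra hlt
    exact absurd h0 (not_lt.2 (hR 0 (by rw [norm_zero]; linarith)))
  obtain ⟨ε, hε, hεle⟩ : ∃ ε > 0, ∀ v ∈ Metric.closedBall (0 : Fin (N + 1) → ℝ) (R + 1),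
      ε ≤ max ‖H v‖ |e v| := by
    obtain ⟨v₀, -, hv₀⟩ := hB.exists_isMinOn ⟨0, by simp; linarith⟩
      (f := fun v => max ‖H v‖ |e v|) (by fun_prop)
    refine ⟨max ‖H v₀‖ |e v₀|, ?_, fun v hv => hv₀ hv⟩
    by_cases hv : H v₀ = 0
    · exact lt_max_of_lt_right (abs_pos.2 (hcon _ hv))
    · exact lt_max_of_lt_left (norm_pos_iff.2 hv)
  obtain ⟨δ₁, hδ₁, hδH⟩ := Metric.uniformContinuousOn_iff.1
    (hB.uniformContinuousOn_of_continuous hH.continuousOn) ε hε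
  obtain ⟨δ₂, hδ₂, hδe⟩ := Metric.uniformContinuousOn_iff.1
    (hB.uniformContinuousOn_of_continuous he.continuousOn) ε hε
  obtain ⟨η, hη, hη₁, hη₂, hη₃⟩ : ∃ η > 0, 2 * η < δ₁ ∧ η < δ₂ ∧ η ≤ 1 :=
    ⟨min (δ₁ / 3) (min (δ₂ / 2) 1), by positivity,
      by linarith [min_le_left (δ₁ / 3) (min (δ₂ / 2) 1)],
      by linarith [min_le_right (δ₁ / 3) (min (δ₂ / 2) 1), min_le_left (δ₂ / 2) 1],
      by linarith [min_le_right (δ₁ / 3) (min (δ₂ / 2) 1), min_le_right (δ₂ / 2) 1]⟩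
  set h : ℝ := η / (N + 1 : ℕ) with hh
  have hpos : 0 < h := by positivity
  have hhN : h * (N + 1 : ℕ) = η := by rw [hh]; field_simp
  let p : (ℕ → ℤ) → Fin (N + 1) → ℝ := fun x i => h * x i
  have hpneg : ∀ x, p (-x) = -p x := fun x => by funext i; simp [p]
  have hpdist : ∀ x z : ℕ → ℤ, (∀ n, |x n - z n| ≤ (N + 1 : ℕ)) → dist (p x) (p z) ≤ η := by
    intro x z hxz
    rw [dist_pi_le_iff hη.le]
    intro i
    rw [Real.dist_eq, ← mul_sub, abs_mul, abs_of_pos hpos, ← hhN]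
    gcongr
    exact_mod_cast hxz i
  have hfin : {x : ℕ → ℤ | (∀ n, N + 1 ≤ n → x n = 0) ∧ 0 < e (p x)}.Finite := by
    let M : ℤ := ⌈R / h⌉
    let g : (Fin (N + 1) → ℤ) → ℕ → ℤ := fun u n => if hn : n < N + 1 then u ⟨n, hn⟩ else 0
    refine ((Set.finite_Icc (fun _ => -M : Fin (N + 1) → ℤ) (fun _ => M)).image g).subset ?_
    rintro x ⟨hx, hex⟩
    refine ⟨fun i => x i, ?_, ?_⟩
    · have hnorm : ‖p x‖ ≤ R := not_lt.1 fun hlt => absurd hex (not_lt.2 (hR _ hlt))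
      have hxi : ∀ i : Fin (N + 1), |x i| ≤ M := by
        intro i
        have h1 := (norm_le_pi_norm (p x) i).trans hnorm
        rw [Real.norm_eq_abs, abs_mul, abs_of_pos hpos, mul_comm, ← le_div_iff₀ hpos] at h1
        have h2 := h1.trans (Int.le_ceil _)
        exact_mod_cast h2
      exact ⟨fun i => (abs_le.1 (hxi i)).1, fun i => (abs_le.1 (hxi i)).2⟩
    · funext n
      by_cases hn : n < N + 1
      · exact dif_pos hn
      · exact (dif_neg hn).trans (hx n (not_lt.1 hn)).symm
  obtain ⟨lab, hlabneg, hlabN, hlab⟩ := exists_odd_labelling N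
  obtain ⟨x, hx, y, hy, z, hz, hz', hxz, hyz, hxy⟩ :=
    exists_opposite_labels (N := N) (A := hfin.toFinset)
      (by
        have : p 0 = 0 := by funext i; simp [p]
        simp [this, h0])
      (by
        intro x hx
        rw [Set.Finite.mem_toFinset] at hx ⊢
        exact ⟨fun n hn => by simp [hx.1 n hn], by rw [hpneg, heven]; exact hx.2⟩)
      (fun x => lab (H (p x))) (fun x => by rw [hpneg, hodd, hlabneg]) (fun x => hlabN _)
  rw [Set.Finite.mem_toFinset] at hx hy hz
  have hez : e (p z) ≤ 0 := not_lt.1 fun hlt => hz ⟨hz', hlt⟩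
  have hball : ∀ x, 0 < e (p x) → ‖p x‖ ≤ R := fun x hx =>
    not_lt.1 fun hlt => absurd hx (not_lt.2 (hR _ hlt))
  have hxR := hball x hx.2
  have hyR := hball y hy.2
  have hdxz := hpdist x z hxz
  have hdyz := hpdist y z hyz
  have hxB : p x ∈ Metric.closedBall (0 : Fin (N + 1) → ℝ) (R + 1) := by
    rw [mem_closedBall_zero_iff]; linarith
  have hyB : p y ∈ Metric.closedBall (0 : Fin (N + 1) → ℝ) (R + 1) := by
    rw [mem_closedBall_zero_iff]; linarith
  have hzB : p z ∈ Metric.closedBall (0 : Fin (N + 1) → ℝ) (R + 1) := by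
    rw [Metric.mem_closedBall, dist_comm]
    have := dist_triangle (0 : Fin (N + 1) → ℝ) (p x) (p z)
    rw [dist_zero_left (p x)] at this
    linarith
  have hex := hδe _ hxB _ hzB (by linarith)
  have hHxy := hδH _ hxB _ hyB (by
    have := dist_triangle_right (p x) (p y) (p z)
    linarith)
  rw [Real.dist_eq, abs_lt] at hex
  rw [dist_eq_norm] at hHxy
  have hsmall : |e (p x)| < ε := by
    rw [abs_of_pos hx.2]; linarith
  have := hεle _ hxB
  rcases le_max_iff.1 this with h1 | h1
  · exact absurd (hlab _ _ hxy) (by linarith)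
  · linarith

/-- A signed distance to the boundary of a compact set. -/
theorem IsCompact.exists_signed_function {E : Type*} [NormedAddCommGroup E] [NormedSpace ℝ E]
    [Nontrivial E] {W : Set E} (hW : IsCompact W) (hne : W.Nonempty) :
    ∃ φ : E → ℝ, Continuous φ ∧ (∀ x ∈ interior W, 0 < φ x) ∧ (∀ x, 0 ≤ φ x → x ∈ W) ∧
      ∀ x, φ x = 0 → x ∈ W \ interior W := by
  have : NoncompactSpace E := NormedSpace.noncompactSpace ℝ E
  have hcl : IsClosed (interior W)ᶜ := isOpen_interior.isClosed_compl
  have hne' : (interior W)ᶜ.Nonempty := by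
    rw [Set.nonempty_compl]
    intro h
    exact hW.ne_univ (Set.eq_univ_of_univ_subset (h ▸ interior_subset))
  have hpos : ∀ x ∈ interior W,
      0 < Metric.infDist x (interior W)ᶜ - Metric.infDist x W := by
    intro x hx
    rw [Metric.infDist_zero_of_mem (interior_subset hx), sub_zero]
    exact (hcl.notMem_iff_infDist_pos hne').1 (fun h => h hx)
  have hmem : ∀ x, 0 ≤ Metric.infDist x (interior W)ᶜ - Metric.infDist x W → x ∈ W := by
    intro x hx
    by_contra hxW
    have h1 := (hW.isClosed.notMem_iff_infDist_pos hne).1 hxW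
    have h2 : Metric.infDist x (interior W)ᶜ = 0 :=
      Metric.infDist_zero_of_mem fun h => hxW (interior_subset h)
    linarith
  exact ⟨fun x => Metric.infDist x (interior W)ᶜ - Metric.infDist x W,
    (Metric.continuous_infDist_pt _).sub (Metric.continuous_infDist_pt _), hpos, hmem,
    fun x hx => ⟨hmem x hx.ge, fun h => (hpos x h).ne' hx⟩⟩

/-- For a compact `W ⊆ ℝ^{m+1}` that is the closure of its nonempty interior,
and a continuous `f : ∂W → ℝ^m`, every interior point `w` is the "midpoint" of a
Borsuk–Ulam solution: there are a unit vector `x` and `λ, μ > 0` with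
`w + λx, w - μx ∈ ∂W` and `f(w + λx) = f(w - μx)`. -/
theorem stmt1 (m : ℕ) (hm : 1 ≤ m)
    (W : Set (EuclideanSpace ℝ (Fin (m + 1))))
    (hWcpt : IsCompact W)
    (hWint : (interior W).Nonempty)
    (hWcl : W = closure (interior W))
    (f : EuclideanSpace ℝ (Fin (m + 1)) → EuclideanSpace ℝ (Fin m))
    (hf : ContinuousOn f (W \ interior W)) :
    ∀ w ∈ interior W,
      ∃ x : EuclideanSpace ℝ (Fin (m + 1)), ‖x‖ = 1 ∧
        ∃ lam > (0 : ℝ), ∃ mu > (0 : ℝ),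
          w + lam • x ∈ W \ interior W ∧
          w - mu • x ∈ W \ interior W ∧
          f (w + lam • x) = f (w - mu • x) := by

  intro w hw
  obtain ⟨φ, hφ, hφpos, hφW, hφ0⟩ := hWcpt.exists_signed_function ⟨w, interior_subset hw⟩
  obtain ⟨F, hF, hFf⟩ : ∃ F : EuclideanSpace ℝ (Fin (m + 1)) → Fin m → ℝ, Continuous F ∧
      ∀ x ∈ W \ interior W, F x = (f x).ofLp := by
    have hcl : IsClosed (W \ interior W) := hWcpt.isClosed.sdiff isOpen_interior
    obtain ⟨G, hG⟩ := ContinuousMap.exists_restrict_eq hcl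
      (⟨fun x => (f x).ofLp,
        (PiLp.continuous_ofLp 2 _).comp (continuousOn_iff_continuous_domRestrict.1 hf)⟩ :
        C((W \ interior W : Set (EuclideanSpace ℝ (Fin (m + 1)))), Fin m → ℝ))
    exact ⟨G, G.continuous, fun x hx => DFunLike.congr_fun hG ⟨x, hx⟩⟩
  obtain ⟨ρ, hρ, hWρ⟩ : ∃ ρ > 0, ∀ x ∈ W, ‖x - w‖ ≤ ρ := by
    obtain ⟨ρ, hρ, h⟩ := hWcpt.isBounded.subset_closedBall_lt 0 w
    exact ⟨ρ, hρ, fun x hx => mem_closedBall_iff_norm.1 (h hx)⟩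
  obtain ⟨r, hr, hrW⟩ := Metric.isOpen_iff.1 isOpen_interior w hw
  obtain ⟨S, hS1, hSr⟩ : ∃ S : ℝ, 1 ≤ S ∧ ρ < r * Real.exp (2 * S) := by
    refine ⟨max 1 (ρ / r), le_max_left _ _, ?_⟩
    have h1 := Real.add_one_le_exp (2 * max 1 (ρ / r))
    have h2 : ρ / r < Real.exp (2 * max 1 (ρ / r)) := by
      linarith [le_max_left 1 (ρ / r), le_max_right 1 (ρ / r)]
    rwa [div_lt_iff₀' hr] at h2
  let y : (Fin (m + 2) → ℝ) → EuclideanSpace ℝ (Fin (m + 1)) := fun v =>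
    WithLp.toLp 2 fun i => v i.succ
  have hy : Continuous y := (PiLp.continuous_toLp 2 _).comp (by fun_prop)
  have hyneg : ∀ v, y (-v) = -y v := fun v => rfl
  let P : (Fin (m + 2) → ℝ) → EuclideanSpace ℝ (Fin (m + 1)) := fun v =>
    w + Real.exp (v 0) • y v
  let Q : (Fin (m + 2) → ℝ) → EuclideanSpace ℝ (Fin (m + 1)) := fun v =>
    w - Real.exp (-v 0) • y v
  have hP : Continuous P := by fun_prop
  have hQ : Continuous Q := by fun_prop
  have hPneg : ∀ v, P (-v) = Q v := fun v => by
    simp only [P, Q, hyneg, Pi.neg_apply, smul_neg, sub_eq_add_neg]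
  have hQneg : ∀ v, Q (-v) = P v := fun v => by
    simp only [P, Q, hyneg, Pi.neg_apply, smul_neg, neg_neg, sub_neg_eq_add]
  have hPnorm : ∀ v, ‖P v - w‖ = Real.exp (v 0) * ‖y v‖ := fun v => by
    simp [P, norm_smul]
  have hQnorm : ∀ v, ‖Q v - w‖ = Real.exp (-v 0) * ‖y v‖ := fun v => by
    simp [Q, norm_smul]
  let e : (Fin (m + 2) → ℝ) → ℝ := fun v => min (φ (P v) + φ (Q v)) (S - |v 0|)
  let H : (Fin (m + 2) → ℝ) → Fin (m + 1) → ℝ := fun v =>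
    Fin.cons (α := fun _ => ℝ)
      (φ (P v) - φ (Q v) - (φ (P v) + φ (Q v)) * v 0) (F (P v) - F (Q v))
  obtain ⟨v, hHv, hev⟩ : ∃ v, H v = 0 ∧ e v = 0 := by
    refine exists_zero_of_odd (R := max S (ρ * Real.exp S)) ?_ ?_ ?_ ?_ ?_ ?_
    · refine continuous_pi fun i => ?_
      induction i using Fin.cases with
      | zero => simp only [H, Fin.cons_zero]; fun_prop
      | succ i => simp only [H, Fin.cons_succ, Pi.sub_apply]; fun_prop
    · intro v
      funext i
      induction i using Fin.cases with
      | zero =>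
        simp only [H, Fin.cons_zero, hPneg, hQneg, Pi.neg_apply]; ring
      | succ i => simp only [H, Fin.cons_succ, hPneg, hQneg, Pi.neg_apply, Pi.sub_apply]; ring
    · fun_prop
    · intro v
      simp only [e, hPneg, hQneg, Pi.neg_apply, abs_neg, add_comm]
    · have hy0 : y 0 = 0 := rfl
      have := hφpos w hw
      simp only [e, P, Q, hy0, smul_zero, add_zero, sub_zero, Pi.zero_apply, abs_zero]
      exact lt_min (by linarith) (by linarith)
    · intro v hv
      by_contra! hlt
      obtain ⟨h1, h2⟩ := lt_min_iff.1 hlt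
      have hv0 := abs_le.1 (sub_pos.1 h2).le
      have hyv : ‖y v‖ ≤ ρ * Real.exp S := by
        have hexp : ∀ s, -S ≤ s → Real.exp s * ‖y v‖ ≤ ρ → ‖y v‖ ≤ ρ * Real.exp S := by
          intro s hs hle
          calc ‖y v‖ = Real.exp (-s) * (Real.exp s * ‖y v‖) := by
                rw [← mul_assoc, ← Real.exp_add]; simp
            _ ≤ Real.exp S * ρ := by gcongr; linarith
            _ = ρ * Real.exp S := mul_comm _ _
        by_cases hPv : 0 ≤ φ (P v)
        · exact hexp _ hv0.1 (hPnorm v ▸ hWρ _ (hφW _ hPv))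
        · exact hexp (-v 0) (by linarith) (hQnorm v ▸ hWρ _ (hφW _ (by linarith)))
      refine absurd hv (not_lt.2 ?_)
      refine (pi_norm_le_iff_of_nonneg (le_max_of_le_left (by linarith))).2 fun i => ?_
      induction i using Fin.cases with
      | zero => exact le_max_of_le_left (sub_pos.1 h2).le
      | succ i => exact le_max_of_le_right ((PiLp.norm_apply_le (y v) i).trans hyv)
  have hH0 : φ (P v) - φ (Q v) - (φ (P v) + φ (Q v)) * v 0 = 0 := congrFun hHv 0
  have hHF : F (P v) = F (Q v) := by
    funext i
    exact sub_eq_zero.1 (congrFun hHv i.succ)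
  have hsum : 0 ≤ φ (P v) + φ (Q v) := hev.symm.le.trans (min_le_left _ _)
  have habs : 0 ≤ S - |v 0| := hev.symm.le.trans (min_le_right _ _)
  have hsmall : ∀ s z, |s| = S → s ≤ -1 → ‖z - w‖ = Real.exp s * ‖y v‖ →
      Real.exp (-s) * ‖y v‖ ≤ ρ → 0 < φ z := by
    intro s z hs hs' hz hle
    rw [abs_of_nonpos (by linarith)] at hs
    refine hφpos z (hrW ?_)
    rw [mem_ball_iff_norm, hz]
    have h1 : Real.exp S * ‖y v‖ < r * Real.exp (2 * S) := by rw [← hs] at hSr ⊢; linarith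
    have h2 : Real.exp s * ‖y v‖ = Real.exp (-(2 * S)) * (Real.exp S * ‖y v‖) := by
      rw [← mul_assoc, ← Real.exp_add, ← hs]; congr 2; ring
    rw [h2]
    calc Real.exp (-(2 * S)) * (Real.exp S * ‖y v‖)
        < Real.exp (-(2 * S)) * (r * Real.exp (2 * S)) := by gcongr
      _ = r := by rw [mul_left_comm, ← Real.exp_add]; simp
  have hsum0 : φ (P v) + φ (Q v) = 0 := by
    by_contra hne
    have hpos : 0 < φ (P v) + φ (Q v) := lt_of_le_of_ne hsum (Ne.symm hne)
    have hvS : |v 0| = S := by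
      rcases min_choice (φ (P v) + φ (Q v)) (S - |v 0|) with h | h
      · exact absurd (h.symm.trans hev) hne
      · linarith [h.symm.trans hev]
    rcases le_total 0 (v 0) with h | h
    · have hv1 : 1 ≤ v 0 := by rwa [← hvS, abs_of_nonneg h] at hS1
      have hQle : φ (Q v) ≤ 0 := by nlinarith
      have := hsmall (-v 0) (Q v) (by rwa [abs_neg]) (by linarith) (hQnorm v)
        (by rw [neg_neg]; exact hPnorm v ▸ hWρ _ (hφW _ (by linarith)))
      linarith
    · have hv1 : v 0 ≤ -1 := by rw [← hvS, abs_of_nonpos h] at hS1; linarith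
      have hPle : φ (P v) ≤ 0 := by nlinarith
      have := hsmall (v 0) (P v) hvS hv1 (hPnorm v)
        (hQnorm v ▸ hWρ _ (hφW _ (by linarith)))
      linarith
  rw [hsum0, zero_mul, sub_zero] at hH0
  have hPb := hφ0 (P v) (by linarith)
  have hQb := hφ0 (Q v) (by linarith)
  have hy0 : y v ≠ 0 := by
    intro h
    refine hPb.2 ?_
    simpa [P, h] using hw
  have hny : 0 < ‖y v‖ := norm_pos_iff.2 hy0
  have hPx : w + (Real.exp (v 0) * ‖y v‖) • (‖y v‖⁻¹ • y v) = P v := by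
    rw [smul_smul, mul_assoc, mul_inv_cancel₀ hny.ne', mul_one]
  have hQx : w - (Real.exp (-v 0) * ‖y v‖) • (‖y v‖⁻¹ • y v) = Q v := by
    rw [smul_smul, mul_assoc, mul_inv_cancel₀ hny.ne', mul_one]
  refine ⟨‖y v‖⁻¹ • y v, by rw [norm_smul, norm_inv, norm_norm, inv_mul_cancel₀ hny.ne'],
    Real.exp (v 0) * ‖y v‖, by positivity, Real.exp (-v 0) * ‖y v‖, by positivity, ?_⟩
  rw [hPx, hQx]
  refine ⟨hPb, hQb, ?_⟩
  have := hHF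
  rw [hFf _ hPb, hFf _ hQb] at this
  exact WithLp.ofLp_injective 2 this
end

section
/- Let n ≥ 2 and let W ⊆ ℝ^n be a compact n-dimensional topological manifold with boundary ∂W (embedded so that the manifold boundary coincides with the topological frontier of W in ℝ^n), and let f : ∂W → ℝ^{n−1} be continuous. Define Z := {(x,v) ∈ W × ℝ^{n−1} : there exist x₁, x₂ ∈ ∂W with x lying on the segment [x₁,x₂] and f(x₁) = v = f(x₂)}. Then Z is compact and the projection Z → W, (x,v) ↦ x, is surjective. -/
open scoped Manifold

theorem LipschitzWith.exists_global_integralCurve {E : Type*} [NormedAddCommGroup E]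
    [NormedSpace ℝ E] [CompleteSpace E] {X : E → E} {K L : NNReal} (hX : LipschitzWith K X)
    (hL : ∀ x, ‖X x‖ ≤ L) (x₀ : E) :
    ∃ γ : ℝ → E, γ 0 = x₀ ∧ ∀ t, HasDerivAt γ (X (γ t)) t := by
  have key : ∀ N : ℕ, ∃ α : ℝ → E, α 0 = x₀ ∧
      ∀ t ∈ Set.Ioo (-(N + 1 : ℝ)) (N + 1), HasDerivAt α (X (α t)) t := by
    intro N
    have h0 : (0 : ℝ) ∈ Set.Icc (-(N + 1 : ℝ)) (N + 1) :=
      ⟨by linarith [N.cast_nonneg (α := ℝ)], by positivity⟩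
    have hP : IsPicardLindelof (fun _ => X) (⟨0, h0⟩ : Set.Icc (-(N + 1 : ℝ)) (N + 1)) x₀
        (L * (N + 1)) 0 L K :=
      .of_time_independent (fun x _ => hL x) hX.lipschitzOnWith (by simp)
    obtain ⟨α, h1, h2⟩ := hP.exists_eq_forall_mem_Icc_hasDerivWithinAt₀
    exact ⟨α, h1, fun t ht => (h2 t (Set.Ioo_subset_Icc_self ht)).hasDerivAt
      (Icc_mem_nhds ht.1 ht.2)⟩
  choose α h0 hd using key
  have huniq : ∀ M N : ℕ, M ≤ N → Set.EqOn (α M) (α N) (Set.Ioo (-(M + 1 : ℝ)) (M + 1)) := by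
    intro M N hMN
    have hcast : (M : ℝ) ≤ N := by exact_mod_cast hMN
    refine ODE_solution_unique_of_mem_Ioo (v := fun _ => X) (s := fun _ => Set.univ) (t₀ := 0)
      (K := K) (fun _ _ => hX.lipschitzOnWith) ⟨by linarith [M.cast_nonneg (α := ℝ)], by positivity⟩
      (fun t ht => ⟨hd M t ht, trivial⟩)
      (fun t ht => ⟨hd N t ⟨by linarith [ht.1], by linarith [ht.2]⟩, trivial⟩) (by rw [h0, h0])
  have hγ : ∀ (N : ℕ) (t : ℝ), t ∈ Set.Ioo (-(N + 1 : ℝ)) (N + 1) → α ⌈|t|⌉₊ t = α N t := by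
    intro N t ht
    rcases le_total ⌈|t|⌉₊ N with h | h
    · refine huniq _ _ h ?_
      have := Nat.le_ceil |t|
      exact ⟨by linarith [neg_abs_le t], by linarith [le_abs_self t]⟩
    · exact (huniq _ _ h ht).symm
  refine ⟨fun t => α ⌈|t|⌉₊ t, by simpa using h0 0, fun t => ?_⟩
  have ht : t ∈ Set.Ioo (-((⌈|t|⌉₊ : ℝ) + 1)) ((⌈|t|⌉₊ : ℝ) + 1) := by
    have := Nat.le_ceil |t|
    exact ⟨by linarith [neg_abs_le t], by linarith [le_abs_self t]⟩
  refine (hd _ t ht).congr_of_eventuallyEq ?_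
  filter_upwards [Ioo_mem_nhds ht.1 ht.2] with s hs using hγ _ s hs

/-- An integral curve through the origin of an even vector field that does not vanish there is
odd, and therefore never returns to a point it has already visited. -/
theorem integralCurve_injective_of_even {E : Type*} [NormedAddCommGroup E] [NormedSpace ℝ E]
    {X : E → E} {K : NNReal} (hX : LipschitzWith K X) (heven : ∀ x, X (-x) = X x) (hX0 : X 0 ≠ 0)
    {γ : ℝ → E} (hγ0 : γ 0 = 0) (hγ : ∀ t, HasDerivAt γ (X (γ t)) t) : Function.Injective γ := by
  have huniq : ∀ {α β : ℝ → E} (t₀ : ℝ), (∀ t, HasDerivAt α (X (α t)) t) →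
      (∀ t, HasDerivAt β (X (β t)) t) → α t₀ = β t₀ → α = β := fun t₀ hα hβ h =>
    ODE_solution_unique_univ (v := fun _ => X) (s := fun _ => Set.univ) (t₀ := t₀) (K := K)
      (fun _ => hX.lipschitzOnWith) (fun t => ⟨hα t, trivial⟩) (fun t => ⟨hβ t, trivial⟩) h
  have hodd : ∀ t, γ (-t) = -γ t := by
    have : (fun t => -γ (-t)) = γ := by
      refine huniq 0 (fun t => ?_) hγ (by simp [hγ0])
      have := ((hγ (-t)).scomp t (hasDerivAt_neg t)).neg
      simp only [neg_smul, one_smul, neg_neg] at this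
      rw [heven]
      exact this
    intro t
    have h := congrFun this t
    rw [← h, neg_neg]
  have hper : ∀ T, γ T = 0 → ∀ t, γ (t + T) = γ t := by
    intro T hT t
    exact congrFun (huniq 0 (fun t => (hγ (t + T)).comp_add_const t T) hγ (by simp [hT, hγ0])) t
  have hhalf : ∀ T, (∀ t, γ (t + T) = γ t) → γ (T / 2) = 0 := by
    intro T hT
    have h1 := hT (-(T / 2))
    rw [hodd, show -(T / 2) + T = T / 2 by ring] at h1
    have h2 : (2 : ℝ) • γ (T / 2) = 0 := by
      rw [two_smul]
      exact eq_neg_iff_add_eq_zero.mp h1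
    exact (smul_eq_zero.mp h2).resolve_left two_ne_zero
  have hpow : ∀ T, γ T = 0 → ∀ k : ℕ, γ (T / 2 ^ k) = 0 := by
    intro T hT k
    induction k with
    | zero => simpa using hT
    | succ k ih =>
      rw [pow_succ, ← div_div]
      exact hhalf _ (hper _ ih)
  intro a b hab
  by_contra hne
  have hT : γ ((a - b) / 2) = 0 := by
    refine hhalf _ fun t => ?_
    refine congrFun (huniq b (fun t => (hγ (t + (a - b))).comp_add_const t (a - b)) hγ ?_) t
    simpa using hab
  have hT0 : (a - b) / 2 ≠ 0 := div_ne_zero (sub_ne_zero.mpr hne) two_ne_zero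
  have hlim : Filter.Tendsto (fun k : ℕ => (a - b) / 2 / 2 ^ k) Filter.atTop (nhdsWithin 0 {0}ᶜ) := by
    refine tendsto_nhdsWithin_iff.mpr ⟨?_, Filter.Eventually.of_forall fun k => ?_⟩
    · have := (tendsto_pow_atTop_nhds_zero_of_lt_one (r := (1 / 2 : ℝ)) (by norm_num)
        (by norm_num)).const_mul ((a - b) / 2)
      simpa [div_eq_mul_inv] using this
    · exact div_ne_zero hT0 (by positivity)
  have hslope := (hasDerivAt_iff_tendsto_slope.mp (hγ 0)).comp hlim
  rw [hγ0] at hslope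
  refine hX0 (tendsto_nhds_unique hslope ?_)
  refine tendsto_const_nhds.congr fun k => ?_
  simp [slope, hpow _ hT, hγ0]

/-- A bounded integral curve that stays in a closed set which is locally a flow line is not
injective: it comes back arbitrarily close to an accumulation point, hence to its own trace. -/
theorem not_injective_integralCurve_of_bounded {E : Type*} [NormedAddCommGroup E]
    [NormedSpace ℝ E] [ProperSpace E] {X : E → E} (hXc : Continuous X) {L : ℝ}
    (hL : ∀ x, ‖X x‖ ≤ L) {γ : ℝ → E} (hγ : ∀ t, HasDerivAt γ (X (γ t)) t)
    {S : Set E} (hS : IsClosed S) (hSb : Bornology.IsBounded S) (hγS : ∀ t, γ t ∈ S)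
    (hloc : ∀ p ∈ S, ∃ φ : E →L[ℝ] ℝ, 0 < φ (X p) ∧ ∃ N ∈ nhds p, Set.InjOn
      (fun y => φ y) (N ∩ S)) : ¬ Function.Injective γ := by
  intro hinj
  have hL0 : 0 ≤ L := (norm_nonneg _).trans (hL 0)
  obtain ⟨p, hpS, σ, hσ, hlim⟩ := (Metric.isCompact_of_isClosed_isBounded hS hSb).tendsto_subseq
    (fun k : ℕ => hγS (k : ℝ))
  obtain ⟨φ, hφ, N, hN, hNinj⟩ := hloc p hpS
  set c := φ (X p) / 2 with hc
  have hcpos : 0 < c := half_pos hφ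
  have hN' : N ∩ {y | c < φ (X y)} ∈ nhds p :=
    Filter.inter_mem hN ((isOpen_lt continuous_const (φ.continuous.comp hXc)).mem_nhds
      (by change φ (X p) / 2 < φ (X p); linarith))
  obtain ⟨r, hr, hball⟩ := Metric.mem_nhds_iff.mp hN'
  obtain ⟨τ, hτ, hτ1, hτ2⟩ : ∃ τ : ℝ, 0 < τ ∧ τ < 1 ∧ L * τ < r / 2 := by
    refine ⟨min (1 / 2) (r / 2 / (L + 1)), by positivity, by
      exact (min_le_left _ _).trans_lt (by norm_num), ?_⟩
    calc L * min (1 / 2) (r / 2 / (L + 1)) ≤ L * (r / 2 / (L + 1)) := by gcongr; exact min_le_right _ _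
      _ = (r / 2) * (L / (L + 1)) := by ring
      _ < (r / 2) * 1 := by
        gcongr
        rw [div_lt_one (by linarith)]; linarith
      _ = r / 2 := mul_one _
  have hlip : ∀ s t, ‖γ s - γ t‖ ≤ L * ‖s - t‖ := fun s t =>
    convex_univ.norm_image_sub_le_of_norm_hasDerivWithin_le
      (fun x _ => (hγ x).hasDerivWithinAt) (fun x _ => hL _) trivial trivial
  have hev : ∀ᶠ k in Filter.atTop, dist (γ (σ k)) p < r / 2 ∧
      dist (φ (γ (σ k))) (φ p) < c * τ / 2 :=
    ((Metric.tendsto_nhds.mp hlim) _ (by positivity)).and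
      ((Metric.tendsto_nhds.mp ((φ.continuous.tendsto p).comp hlim)) _ (by positivity))
  obtain ⟨k, hk⟩ := Filter.eventually_atTop.mp hev
  obtain ⟨hk1, hk2⟩ := hk k le_rfl
  obtain ⟨hk3, hk4⟩ := hk (k + 1) (Nat.le_succ k)
  set a : ℝ := (σ k : ℝ) with ha
  set b : ℝ := (σ (k + 1) : ℝ) with hb
  have hab : a + 1 ≤ b := by
    have : σ k + 1 ≤ σ (k + 1) := hσ (Nat.lt_succ_self k)
    rw [ha, hb]; exact_mod_cast this
  have hnear : ∀ s ∈ Set.Icc (a - τ) (a + τ), γ s ∈ Metric.ball p r := by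
    intro s hs
    have h1 : ‖γ s - γ a‖ ≤ L * τ := (hlip s a).trans (by
      gcongr; rw [Real.norm_eq_abs, abs_le]; constructor <;> linarith [hs.1, hs.2])
    rw [Metric.mem_ball]
    calc dist (γ s) p ≤ dist (γ s) (γ a) + dist (γ a) p := dist_triangle _ _ _
      _ < r / 2 + r / 2 := by rw [dist_eq_norm]; linarith
      _ = r := by ring
  have hφd : ∀ t, HasDerivAt (fun t => φ (γ t)) (φ (X (γ t))) t := fun t =>
    φ.hasFDerivAt.comp_hasDerivAt t (hγ t)
  have hφc : Continuous fun t => φ (γ t) :=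
    continuous_iff_continuousAt.mpr fun t => (hφd t).continuousAt
  have hgrow : ∀ s ∈ Set.Icc (a - τ) (a + τ), ∀ t ∈ Set.Icc (a - τ) (a + τ), s ≤ t →
      c * (t - s) ≤ φ (γ t) - φ (γ s) :=
    (convex_Icc _ _).mul_sub_le_image_sub_of_le_deriv hφc.continuousOn
      (fun t _ => (hφd t).differentiableAt.differentiableWithinAt) (fun t ht => by
        rw [(hφd t).deriv]
        exact (hball (hnear t (interior_subset ht))).2.le)
  have hma : a ∈ Set.Icc (a - τ) (a + τ) := ⟨by linarith, by linarith⟩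
  have hml : a - τ ∈ Set.Icc (a - τ) (a + τ) := ⟨le_rfl, by linarith⟩
  have hmr : a + τ ∈ Set.Icc (a - τ) (a + τ) := ⟨by linarith, le_rfl⟩
  have hlo := hgrow _ hml _ hma (by linarith)
  have hhi := hgrow _ hma _ hmr (by linarith)
  rw [Real.dist_eq, abs_lt] at hk2 hk4
  have hmem : φ (γ b) ∈ Set.Icc (φ (γ (a - τ))) (φ (γ (a + τ))) := by
    constructor <;> nlinarith
  obtain ⟨s, hs, hsb⟩ := intermediate_value_Icc (by linarith : a - τ ≤ a + τ)
    hφc.continuousOn hmem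
  have hbb : γ b ∈ Metric.ball p r := by
    rw [Metric.mem_ball]; exact hk3.trans (by linarith)
  have := hinj (hNinj ⟨(hball (hnear s hs)).1, hγS s⟩ ⟨(hball hbb).1, hγS b⟩ hsb)
  linarith [hs.2]

/-- The Jacobian matrix of a map `ℝⁿ⁺¹ → ℝⁿ`. -/
noncomputable def jacobianMatrix {n : ℕ} (F : (Fin (n + 1) → ℝ) → (Fin n → ℝ))
    (x : Fin (n + 1) → ℝ) : Matrix (Fin n) (Fin (n + 1)) ℝ :=
  LinearMap.toMatrix' (fderiv ℝ F x).toLinearMap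

theorem jacobianMatrix_mulVec {n : ℕ} (F : (Fin (n + 1) → ℝ) → (Fin n → ℝ))
    (x z : Fin (n + 1) → ℝ) : (jacobianMatrix F x).mulVec z = fderiv ℝ F x z :=
  LinearMap.toMatrix'_mulVec _ _

theorem jacobianMatrix_apply {n : ℕ} (F : (Fin (n + 1) → ℝ) → (Fin n → ℝ))
    (x : Fin (n + 1) → ℝ) (i : Fin n) (j : Fin (n + 1)) :
    jacobianMatrix F x i j = fderiv ℝ F x (Pi.single j 1) i := by
  rw [← jacobianMatrix_mulVec, Matrix.mulVec_single_one]
  rfl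

/-- The generalized cross product of the `n` rows of an `n × (n + 1)` matrix. -/
def rowCrossProduct {n : ℕ} (M : Matrix (Fin n) (Fin (n + 1)) ℝ) : Fin (n + 1) → ℝ :=
  fun i => (-1) ^ (i : ℕ) * (M.submatrix id i.succAbove).det

theorem det_of_cons {n : ℕ} (v : Fin (n + 1) → ℝ) (M : Matrix (Fin n) (Fin (n + 1)) ℝ) :
    (Matrix.of (Fin.cons v M : Fin (n + 1) → Fin (n + 1) → ℝ)).det =
      v ⬝ᵥ rowCrossProduct M := by
  rw [Matrix.det_succ_row_zero, dotProduct]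
  refine Finset.sum_congr rfl fun i _ => ?_
  have : (Matrix.of (Fin.cons v M : Fin (n + 1) → Fin (n + 1) → ℝ)).submatrix Fin.succ i.succAbove
      = M.submatrix id i.succAbove := by
    ext a b; rfl
  rw [this, rowCrossProduct]
  change (-1) ^ (i : ℕ) * v i * _ = _
  ring

theorem mulVec_rowCrossProduct {n : ℕ} (M : Matrix (Fin n) (Fin (n + 1)) ℝ) :
    M.mulVec (rowCrossProduct M) = 0 := by
  ext j
  change M j ⬝ᵥ rowCrossProduct M = 0
  rw [← det_of_cons]
  refine Matrix.det_zero_of_row_eq (i := 0) (j := j.succ) (Fin.succ_ne_zero j).symm rfl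

theorem rowCrossProduct_ne_zero {n : ℕ} {M : Matrix (Fin n) (Fin (n + 1)) ℝ}
    (hM : LinearIndependent ℝ M.row) : rowCrossProduct M ≠ 0 := by
  intro h
  obtain ⟨v, hv⟩ : ∃ v, v ∉ Submodule.span ℝ (Set.range M.row) := by
    by_contra! hall
    have htop : Submodule.span ℝ (Set.range M.row) = ⊤ := by
      ext v; simp [hall v]
    have h1 := finrank_span_eq_card hM
    rw [htop, finrank_top] at h1
    simp at h1
  have hli : LinearIndependent ℝ (Fin.cons v M.row : Fin (n + 1) → Fin (n + 1) → ℝ) :=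
    linearIndependent_finCons.mpr ⟨hM, hv⟩
  have hunit := (Matrix.linearIndependent_rows_iff_isUnit
    (A := Matrix.of (Fin.cons v M : Fin (n + 1) → Fin (n + 1) → ℝ))).mp hli
  have hdet := (Matrix.isUnit_iff_isUnit_det _).mp hunit
  rw [det_of_cons, h, dotProduct_zero] at hdet
  exact not_isUnit_zero hdet

theorem contDiff_rowCrossProduct_jacobianMatrix {n : ℕ} {F : (Fin (n + 1) → ℝ) → (Fin n → ℝ)}
    (hF : ContDiff ℝ 2 F) : ContDiff ℝ 1 fun x => rowCrossProduct (jacobianMatrix F x) := by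
  refine contDiff_pi.mpr fun i => ?_
  unfold rowCrossProduct
  simp only [Matrix.det_apply, Matrix.submatrix_apply, jacobianMatrix_apply]
  refine contDiff_const.mul (ContDiff.sum fun σ _ => ContDiff.const_smul _ (contDiff_prod fun j _ => ?_))
  have h1 : ContDiff ℝ 1 (fderiv ℝ F) := hF.fderiv_right (by norm_num)
  exact contDiff_pi.mp (h1.clm_apply contDiff_const) _

theorem fderiv_neg_of_odd {E V : Type*} [NormedAddCommGroup E] [NormedSpace ℝ E]
    [NormedAddCommGroup V] [NormedSpace ℝ V] {F : E → V} (hodd : ∀ x, F (-x) = -F x) (x : E) :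
    fderiv ℝ F (-x) = fderiv ℝ F x := by
  have h : F = fun y => -F (-y) := by
    funext y; rw [hodd, neg_neg]
  conv_rhs => rw [h]
  have h1 := fderiv_comp_smul (𝕜 := ℝ) (f := F) (x := x) (-1 : ℝ)
  simp only [neg_smul, one_smul] at h1
  rw [fderiv_fun_neg, h1, neg_neg]

/-- Near a regular zero, the zero set of `F` is a graph over the line spanned by the
generalized cross product of the gradients. -/
theorem exists_injOn_zeros_of_regular {n : ℕ} {F : (Fin (n + 1) → ℝ) → (Fin n → ℝ)}
    (hF : ContDiff ℝ 2 F) {p : Fin (n + 1) → ℝ}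
    (hp : LinearIndependent ℝ (jacobianMatrix F p).row) :
    ∃ φ : (Fin (n + 1) → ℝ) →L[ℝ] ℝ, 0 < φ (rowCrossProduct (jacobianMatrix F p)) ∧
      ∃ N ∈ nhds p, Set.InjOn (fun y => φ y) (N ∩ {x | F x = 0}) := by
  set w := rowCrossProduct (jacobianMatrix F p) with hw
  have hwpos : 0 < w ⬝ᵥ w := by
    have h1 : 0 ≤ w ⬝ᵥ w := Finset.sum_nonneg fun i _ => mul_self_nonneg _
    exact h1.lt_of_ne' fun h2 => rowCrossProduct_ne_zero hp (dotProduct_self_eq_zero.mp h2)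
  let φ : (Fin (n + 1) → ℝ) →L[ℝ] ℝ := (LinearMap.toContinuousLinearMap
    (dotProductBilin ℝ ℝ w))
  have hφ : ∀ y, φ y = w ⬝ᵥ y := fun y => rfl
  refine ⟨φ, hwpos, ?_⟩
  let A : (Fin (n + 1) → ℝ) →L[ℝ] ((Fin n → ℝ) × ℝ) := (fderiv ℝ F p).prod φ
  have hA : Function.Injective A := by
    rw [injective_iff_map_eq_zero]
    intro z hz
    have h1 : fderiv ℝ F p z = 0 := congrArg Prod.fst hz
    have h2 : φ z = 0 := congrArg Prod.snd hz
    have hdet : (Matrix.of (Fin.cons w (jacobianMatrix F p) :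
        Fin (n + 1) → Fin (n + 1) → ℝ)).det ≠ 0 := by
      rw [det_of_cons]; exact hwpos.ne'
    refine Matrix.eq_zero_of_mulVec_eq_zero hdet ?_
    rw [← jacobianMatrix_mulVec] at h1
    ext i
    refine Fin.cases ?_ (fun j => ?_) i
    · exact h2
    · exact congrFun h1 j
  let e : (Fin (n + 1) → ℝ) ≃L[ℝ] ((Fin n → ℝ) × ℝ) :=
    (LinearEquiv.ofInjectiveOfFinrankEq A.toLinearMap hA (by simp)).toContinuousLinearEquiv
  have he : (e : (Fin (n + 1) → ℝ) →L[ℝ] ((Fin n → ℝ) × ℝ)) = A := by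
    ext <;> rfl
  have hG : HasStrictFDerivAt (fun y => (F y, φ y))
      (e : (Fin (n + 1) → ℝ) →L[ℝ] ((Fin n → ℝ) × ℝ)) p := by
    rw [he]
    exact (hF.contDiffAt.hasStrictFDerivAt (by norm_num)).prodMk φ.hasStrictFDerivAt
  refine ⟨(hG.toOpenPartialHomeomorph _).source, (hG.toOpenPartialHomeomorph _).open_source.mem_nhds
    hG.mem_toOpenPartialHomeomorph_source, ?_⟩
  intro y hy z hz hyz
  refine (hG.toOpenPartialHomeomorph _).injOn hy.1 hz.1 ?_
  have h1 : F y = F z := Eq.trans hy.2 (Eq.symm hz.2)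
  simpa [h1] using hyz

/-- Following the zero set of a regular odd map `ℝⁿ⁺¹ → ℝⁿ` from the origin, one leaves every
bounded set. -/
theorem exists_common_zero_of_regular {n : ℕ} {F : (Fin (n + 1) → ℝ) → (Fin n → ℝ)}
    (hF : ContDiff ℝ 2 F) (hodd : ∀ x, F (-x) = -F x)
    (hreg : ∀ x, F x = 0 → LinearIndependent ℝ (jacobianMatrix F x).row)
    {h : (Fin (n + 1) → ℝ) → ℝ} (hc : Continuous h) (h0 : 0 < h 0) {R : ℝ}
    (hR : ∀ x, 0 ≤ h x → ‖x‖ ≤ R) : ∃ x, F x = 0 ∧ h x = 0 := by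
  by_contra! hno
  have hR0 : 0 ≤ R := (norm_nonneg _).trans (hR 0 h0.le)
  have hF0 : F 0 = 0 := by
    have h1 := hodd 0
    rw [neg_zero] at h1
    ext i
    have h2 := congrFun h1 i
    simp only [Pi.neg_apply, Pi.zero_apply] at h2 ⊢
    linarith
  let b : ContDiffBump (0 : Fin (n + 1) → ℝ) := ⟨R + 1, R + 2, by linarith, by linarith⟩
  have hb : ∀ x, ‖x‖ ≤ R → b x = 1 := fun x hx =>
    b.one_of_mem_closedBall (by rw [mem_closedBall_zero_iff]; change ‖x‖ ≤ R + 1; linarith)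
  set Y : (Fin (n + 1) → ℝ) → (Fin (n + 1) → ℝ) := fun x => rowCrossProduct (jacobianMatrix F x)
    with hY
  set X : (Fin (n + 1) → ℝ) → (Fin (n + 1) → ℝ) := fun x => b x • Y x with hX
  have hXY : ∀ x, ‖x‖ ≤ R → X x = Y x := fun x hx => by simp only [hX, hb x hx, one_smul]
  have hXs : ContDiff ℝ 1 X := b.contDiff.smul (contDiff_rowCrossProduct_jacobianMatrix hF)
  have hXcs : HasCompactSupport X := b.hasCompactSupport.smul_right
  obtain ⟨K, hK⟩ := hXs.lipschitzWith_of_hasCompactSupport hXcs one_ne_zero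
  obtain ⟨L, hL⟩ := hXcs.exists_bound_of_continuous hXs.continuous
  have hL0 : 0 ≤ L := (norm_nonneg _).trans (hL 0)
  obtain ⟨γ, hγ0, hγ⟩ := hK.exists_global_integralCurve (L := ⟨L, hL0⟩) hL 0
  have hγc : Continuous γ := continuous_iff_continuousAt.mpr fun t => (hγ t).continuousAt
  have heven : ∀ x, X (-x) = X x := by
    intro x
    simp only [hX, hY, b.neg, jacobianMatrix, fderiv_neg_of_odd hodd]
  have hX0 : X 0 ≠ 0 := by
    rw [hXY 0 (by simpa using hR0)]
    exact rowCrossProduct_ne_zero (hreg 0 hF0)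
  have hFd : ∀ t, HasDerivAt (fun t => F (γ t)) 0 t := by
    intro t
    have h1 := ((hF.differentiable (by norm_num)) (γ t)).hasFDerivAt.comp_hasDerivAt t (hγ t)
    have h2 : fderiv ℝ F (γ t) (X (γ t)) = 0 := by
      rw [hX, map_smul, ← jacobianMatrix_mulVec, mulVec_rowCrossProduct, smul_zero]
    rwa [h2] at h1
  have hFγ : ∀ t, F (γ t) = 0 := by
    intro t
    have h1 := is_const_of_deriv_eq_zero (fun t => (hFd t).differentiableAt)
      (fun t => (hFd t).deriv) t 0
    rwa [hγ0, hF0] at h1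
  have hpos : ∀ t, 0 < h (γ t) := by
    intro t
    by_contra! hle
    obtain ⟨s, hs⟩ := mem_range_of_exists_le_of_exists_ge (hc.comp hγc) ⟨t, hle⟩
      ⟨0, by simpa [hγ0] using h0.le⟩
    exact hno _ (hFγ s) hs
  refine not_injective_integralCurve_of_bounded hXs.continuous hL hγ
    (S := {x | F x = 0} ∩ Metric.closedBall 0 R)
    ((isClosed_eq hF.continuous continuous_const).inter Metric.isClosed_closedBall)
    (Metric.isBounded_closedBall.subset Set.inter_subset_right)
    (fun t => ⟨hFγ t, by simpa using hR _ (hpos t).le⟩) ?_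
    (integralCurve_injective_of_even hK heven hX0 hγ0 hγ)
  rintro p ⟨hp, hpR⟩
  obtain ⟨φ, hφ, N, hN, hinj⟩ := exists_injOn_zeros_of_regular hF (hreg p hp)
  refine ⟨φ, ?_, N, hN, hinj.mono (Set.inter_subset_inter_right _ Set.inter_subset_left)⟩
  rwa [hXY p (by simpa using hpR)]

/-- The odd cubic perturbation `x ↦ G x + b x + c x³` of `G`, where `x³` is taken
coordinatewise. -/
def cubicPerturbation {n : ℕ} (G : (Fin (n + 1) → ℝ) → (Fin n → ℝ))
    (q : (Fin n → Fin (n + 1) → ℝ) × (Fin n → Fin (n + 1) → ℝ)) (x : Fin (n + 1) → ℝ) :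
    Fin n → ℝ :=
  fun i => G x i + ∑ l, (q.1 i l * x l + q.2 i l * x l ^ 3)

theorem contDiff_cubicPerturbation {n : ℕ} {G : (Fin (n + 1) → ℝ) → (Fin n → ℝ)}
    (hG : ContDiff ℝ 2 G) (q : (Fin n → Fin (n + 1) → ℝ) × (Fin n → Fin (n + 1) → ℝ)) :
    ContDiff ℝ 2 (cubicPerturbation G q) := by
  unfold cubicPerturbation
  fun_prop

theorem cubicPerturbation_neg {n : ℕ} {G : (Fin (n + 1) → ℝ) → (Fin n → ℝ)}
    (hodd : ∀ x, G (-x) = -G x)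
    (q : (Fin n → Fin (n + 1) → ℝ) × (Fin n → Fin (n + 1) → ℝ)) (x : Fin (n + 1) → ℝ) :
    cubicPerturbation G q (-x) = -cubicPerturbation G q x := by
  ext i
  simp only [cubicPerturbation, hodd, Pi.neg_apply, neg_add, ← Finset.sum_neg_distrib]
  congr 1
  exact Finset.sum_congr rfl fun l _ => by ring

theorem jacobianMatrix_cubicPerturbation {n : ℕ} {G : (Fin (n + 1) → ℝ) → (Fin n → ℝ)}
    (hG : ContDiff ℝ 2 G) (q : (Fin n → Fin (n + 1) → ℝ) × (Fin n → Fin (n + 1) → ℝ))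
    (x : Fin (n + 1) → ℝ) (i : Fin n) (k : Fin (n + 1)) :
    jacobianMatrix (cubicPerturbation G q) x i k =
      jacobianMatrix G x i k + q.1 i k + 3 * q.2 i k * x k ^ 2 := by
  have hGd : HasFDerivAt G (fderiv ℝ G x) x := (hG.differentiable (by norm_num) x).hasFDerivAt
  have hd : HasFDerivAt (fun y => cubicPerturbation G q y i)
      ((ContinuousLinearMap.proj i).comp (fderiv ℝ G x) +
        ∑ l, (q.1 i l + 3 * q.2 i l * x l ^ 2) •
          (ContinuousLinearMap.proj l : (Fin (n + 1) → ℝ) →L[ℝ] ℝ)) x := by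
    refine (hasFDerivAt_pi'.mp hGd i).add (HasFDerivAt.fun_sum fun l _ => ?_)
    have h1 : HasFDerivAt (fun y : Fin (n + 1) → ℝ => y l)
      (ContinuousLinearMap.proj l : (Fin (n + 1) → ℝ) →L[ℝ] ℝ) x := hasFDerivAt_apply l x
    convert (h1.const_mul (q.1 i l)).add ((h1.pow 3).const_mul (q.2 i l)) using 1
    · rfl
    · simp only [smul_smul, ← add_smul]
      congr 1
      simp
      ring
  rw [jacobianMatrix_apply, jacobianMatrix_apply]
  have hdiff : DifferentiableAt ℝ (cubicPerturbation G q) x :=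
    (contDiff_cubicPerturbation hG q).differentiable (by norm_num) x
  rw [show fderiv ℝ (cubicPerturbation G q) x (Pi.single k 1) i =
      fderiv ℝ (fun y => cubicPerturbation G q y i) x (Pi.single k 1) by
    rw [(hasFDerivAt_pi'.mp hdiff.hasFDerivAt i).fderiv]; rfl, hd.fderiv]
  simp [Pi.single_apply]
  ring

/-- Complete rows `g` by the row with index `j` that is the combination of them with
coefficients `w`. -/
def fillRow {n : ℕ} (j : Fin n) (w : {i // i ≠ j} → ℝ) (g : {i // i ≠ j} → Fin (n + 1) → ℝ) :
    Fin n → Fin (n + 1) → ℝ :=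
  fun i l => if h : i ≠ j then g ⟨i, h⟩ l else ∑ a, w a * g a l

/-- The cubic coefficients of a perturbation of `G` with prescribed Jacobian matrix `g` at a
zero `x`, in terms of those outside the column `k`. -/
noncomputable def fillColumn {n : ℕ} (G : (Fin (n + 1) → ℝ) → (Fin n → ℝ)) (k : Fin (n + 1))
    (x : Fin (n + 1) → ℝ) (g : Fin n → Fin (n + 1) → ℝ) (c : Fin n → {l // l ≠ k} → ℝ) :
    Fin n → Fin (n + 1) → ℝ :=
  fun i l => if h : l ≠ k then c i ⟨l, h⟩ else
    (G x i + ∑ a, (g i a - jacobianMatrix G x i a) * x a - 2 * ∑ a, c i a * x a ^ 3) / (2 * x k ^ 3)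

theorem exists_fillRow_of_not_linearIndependent {n : ℕ} {M : Matrix (Fin n) (Fin (n + 1)) ℝ}
    (hM : ¬ LinearIndependent ℝ M.row) :
    ∃ (j : Fin n) (w : {i // i ≠ j} → ℝ), fillRow j w (fun i => M i) = M := by
  obtain ⟨w, hw, j, hj⟩ := Fintype.not_linearIndependent_iff.mp hM
  refine ⟨j, fun i => -(w i / w j), ?_⟩
  funext i l
  unfold fillRow
  split_ifs with h
  · rfl
  · rw [not_not] at h
    subst h
    have h1 := congrFun hw l
    simp only [Finset.sum_apply, Pi.smul_apply, smul_eq_mul, Pi.zero_apply, Matrix.row] at h1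
    rw [Fintype.sum_eq_add_sum_subtype_ne _ i] at h1
    have h2 : M i l = -(∑ a : {a // a ≠ i}, w a * M a l) / w i := by
      field_simp
      linarith
    rw [h2, neg_div, Finset.sum_div, ← Finset.sum_neg_distrib]
    exact Finset.sum_congr rfl fun a _ => by ring

theorem fillColumn_eq {n : ℕ} {G : (Fin (n + 1) → ℝ) → (Fin n → ℝ)} (hG : ContDiff ℝ 2 G)
    {q : (Fin n → Fin (n + 1) → ℝ) × (Fin n → Fin (n + 1) → ℝ)} {x : Fin (n + 1) → ℝ}
    (hx : cubicPerturbation G q x = 0) {k : Fin (n + 1)} (hk : x k ≠ 0) :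
    fillColumn G k x (jacobianMatrix (cubicPerturbation G q) x) (fun i l => q.2 i l) = q.2 := by
  funext i l
  unfold fillColumn
  split_ifs with h
  · rfl
  · rw [not_not] at h
    subst h
    rw [div_eq_iff (by positivity)]
    have h1 := congrFun hx i
    simp only [cubicPerturbation, Finset.sum_add_distrib, Pi.zero_apply] at h1
    have h2 : ∑ a, (jacobianMatrix (cubicPerturbation G q) x i a - jacobianMatrix G x i a) * x a =
        ∑ a, q.1 i a * x a + 3 * ∑ a, q.2 i a * x a ^ 3 := by
      rw [Finset.mul_sum, ← Finset.sum_add_distrib]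
      refine Finset.sum_congr rfl fun a _ => ?_
      rw [jacobianMatrix_cubicPerturbation hG]
      ring
    have h3 := Fintype.sum_eq_add_sum_subtype_ne (fun a => q.2 i a * x a ^ 3) l
    rw [h2]
    linarith

theorem contDiff_fillRow {n : ℕ} {E : Type*} [NormedAddCommGroup E] [NormedSpace ℝ E]
    {j : Fin n} {w : E → {i // i ≠ j} → ℝ} {g : E → {i // i ≠ j} → Fin (n + 1) → ℝ}
    (hw : ContDiff ℝ 1 w) (hg : ContDiff ℝ 1 g) (i : Fin n) (l : Fin (n + 1)) :
    ContDiff ℝ 1 fun p => fillRow j (w p) (g p) i l := by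
  unfold fillRow
  split_ifs <;> fun_prop

theorem contDiff_jacobianMatrix_apply {n : ℕ} {G : (Fin (n + 1) → ℝ) → (Fin n → ℝ)}
    (hG : ContDiff ℝ 2 G) (i : Fin n) (l : Fin (n + 1)) :
    ContDiff ℝ 1 fun x => jacobianMatrix G x i l := by
  simp only [jacobianMatrix_apply]
  have h1 : ContDiff ℝ 1 (fderiv ℝ G) := hG.fderiv_right (by norm_num)
  exact contDiff_pi.mp (h1.clm_apply contDiff_const) _

theorem contDiffOn_fillColumn {n : ℕ} {E : Type*} [NormedAddCommGroup E] [NormedSpace ℝ E]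
    {G : (Fin (n + 1) → ℝ) → (Fin n → ℝ)} (hG : ContDiff ℝ 2 G) {k : Fin (n + 1)}
    {x : E → Fin (n + 1) → ℝ} {g : E → Fin n → Fin (n + 1) → ℝ}
    {c : E → Fin n → {l // l ≠ k} → ℝ} (hx : ContDiff ℝ 1 x)
    (hg : ∀ i l, ContDiff ℝ 1 fun p => g p i l) (hc : ContDiff ℝ 1 c) (i : Fin n)
    (l : Fin (n + 1)) :
    ContDiffOn ℝ 1 (fun p => fillColumn G k (x p) (g p) (c p) i l) {p | 0 < x p k} := by
  unfold fillColumn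
  split_ifs with h
  · exact ContDiff.contDiffOn (by fun_prop)
  · have h1 : ∀ a, ContDiff ℝ 1 fun p => jacobianMatrix G (x p) i a := fun a =>
      (contDiff_jacobianMatrix_apply hG i a).comp hx
    have h2 : ContDiff ℝ 1 fun p => G (x p) i :=
      (contDiff_pi.mp (hG.of_le (by norm_num)) i).comp hx
    refine ContDiffOn.div (ContDiff.contDiffOn ?_) (ContDiff.contDiffOn ?_) fun p hp => ?_
    · exact (h2.add (ContDiff.sum fun a _ => ((hg i a).sub (h1 a)).mul
        (contDiff_pi.mp hx a))).sub (contDiff_const.mul (ContDiff.sum fun a _ =>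
          (contDiff_pi.mp (contDiff_pi.mp hc i) a).mul ((contDiff_pi.mp hx a).pow 3)))
    · exact contDiff_const.mul ((contDiff_pi.mp hx k).pow 3)
    · have : 0 < x p k := hp
      positivity


theorem dimH_image_le_finrank {E V : Type*} [NormedAddCommGroup E] [NormedSpace ℝ E]
    [FiniteDimensional ℝ E] [NormedAddCommGroup V] [NormedSpace ℝ V] {Φ : E → V} {s : Set E}
    (hs : Convex ℝ s) (hΦ : ContDiffOn ℝ 1 Φ s) : dimH (Φ '' s) ≤ Module.finrank ℝ E :=
  (hΦ.dimH_image_le hs subset_rfl).trans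
    ((dimH_mono (Set.subset_univ s)).trans (Real.dimH_univ_eq_finrank E).le)

/-- The perturbations having a critical zero with positive `k`-th coordinate at which the row `j`
of the Jacobian matrix is a combination of the others form a set of positive codimension. -/
theorem dimH_critical_pos_le {n : ℕ} {G : (Fin (n + 1) → ℝ) → (Fin n → ℝ)}
    (hG : ContDiff ℝ 2 G) (j : Fin n) (k : Fin (n + 1)) :
    dimH {q : (Fin n → Fin (n + 1) → ℝ) × (Fin n → Fin (n + 1) → ℝ) |
      ∃ x, 0 < x k ∧ cubicPerturbation G q x = 0 ∧ ∃ w : {i // i ≠ j} → ℝ,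
        fillRow j w (fun i => jacobianMatrix (cubicPerturbation G q) x i) =
          jacobianMatrix (cubicPerturbation G q) x} ≤ ((2 * n * (n + 1) - 1 : ℕ) : ENNReal) := by
  let E := (Fin (n + 1) → ℝ) × ({i // i ≠ j} → ℝ) × ({i // i ≠ j} → Fin (n + 1) → ℝ) ×
    (Fin n → {l // l ≠ k} → ℝ)
  let g : E → Fin n → Fin (n + 1) → ℝ := fun p => fillRow j p.2.1 p.2.2.1
  let c : E → Fin n → Fin (n + 1) → ℝ := fun p => fillColumn G k p.1 (g p) p.2.2.2
  let Φ : E → (Fin n → Fin (n + 1) → ℝ) × (Fin n → Fin (n + 1) → ℝ) := fun p =>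
    (fun i l => g p i l - jacobianMatrix G p.1 i l - 3 * c p i l * p.1 l ^ 2, c p)
  have hgc : ∀ i l, ContDiff ℝ 1 fun p => g p i l := fun i l =>
    contDiff_fillRow (E := E) (contDiff_fst.comp contDiff_snd)
      (contDiff_fst.comp (contDiff_snd.comp contDiff_snd)) i l
  have hcc : ∀ i l, ContDiffOn ℝ 1 (fun p => c p i l) {p : E | 0 < p.1 k} := fun i l =>
    contDiffOn_fillColumn (E := E) hG contDiff_fst hgc
      (contDiff_snd.comp (contDiff_snd.comp contDiff_snd)) i l
  have hΦ : ContDiffOn ℝ 1 Φ {p | 0 < p.1 k} := by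
    refine ContDiffOn.prodMk (contDiffOn_pi.mpr fun i => contDiffOn_pi.mpr fun l => ?_)
      (contDiffOn_pi.mpr fun i => contDiffOn_pi.mpr fun l => hcc i l)
    refine ContDiffOn.sub (ContDiff.contDiffOn ?_)
      ((contDiffOn_const.mul (hcc i l)).mul (ContDiff.contDiffOn ?_))
    · exact (hgc i l).sub ((contDiff_jacobianMatrix_apply hG i l).comp contDiff_fst)
    · exact (contDiff_pi.mp contDiff_fst l).pow 2
  have hconv : Convex ℝ {p : E | 0 < p.1 k} :=
    (convex_Ioi (0 : ℝ)).linear_preimage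
      ((LinearMap.proj k).comp (LinearMap.fst ℝ (Fin (n + 1) → ℝ) _))
  have hrank : Module.finrank ℝ E = 2 * n * (n + 1) - 1 := by
    obtain ⟨m, rfl⟩ : ∃ m, n = m + 1 := ⟨n - 1, by have := j.pos; omega⟩
    simp only [E, Module.finrank_prod, Module.finrank_pi_fintype, Module.finrank_self,
      Finset.sum_const, Finset.card_univ, Fintype.card_fin, smul_eq_mul, mul_one,
      Fintype.card_subtype_compl, Fintype.card_unique]
    refine (Nat.sub_eq_of_eq_add ?_).symm
    simp only [Nat.add_sub_cancel]
    ring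
  rw [← hrank]
  refine (dimH_mono ?_).trans (dimH_image_le_finrank hconv hΦ)
  rintro q ⟨x, hxk, hx, w, hw⟩
  refine ⟨(x, w, fun i => jacobianMatrix (cubicPerturbation G q) x i, fun i l => q.2 i l), hxk, ?_⟩
  have hc : c (x, w, fun i => jacobianMatrix (cubicPerturbation G q) x i, fun i l => q.2 i l) =
      q.2 := by
    simp only [c, g, hw]
    exact fillColumn_eq hG hx hxk.ne'
  refine Prod.ext ?_ hc
  funext i l
  simp only [Φ, hc, g, hw]
  rw [jacobianMatrix_cubicPerturbation hG]
  ring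

/-- The perturbations critical at the origin, where the row `j` of the Jacobian matrix is a
combination of the others, form a set of positive codimension. -/
theorem dimH_critical_zero_le {n : ℕ} {G : (Fin (n + 1) → ℝ) → (Fin n → ℝ)}
    (hG : ContDiff ℝ 2 G) (j : Fin n) :
    dimH {q : (Fin n → Fin (n + 1) → ℝ) × (Fin n → Fin (n + 1) → ℝ) |
      ∃ w : {i // i ≠ j} → ℝ,
        fillRow j w (fun i => jacobianMatrix (cubicPerturbation G q) 0 i) =
          jacobianMatrix (cubicPerturbation G q) 0} ≤ ((2 * n * (n + 1) - 1 : ℕ) : ENNReal) := by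
  let E := ({i // i ≠ j} → ℝ) × ({i // i ≠ j} → Fin (n + 1) → ℝ) × (Fin n → Fin (n + 1) → ℝ)
  let Φ : E → (Fin n → Fin (n + 1) → ℝ) × (Fin n → Fin (n + 1) → ℝ) := fun p =>
    (fun i l => fillRow j p.1 p.2.1 i l - jacobianMatrix G 0 i l, p.2.2)
  have hΦ : ContDiff ℝ 1 Φ := by
    refine ContDiff.prodMk (contDiff_pi.mpr fun i => contDiff_pi.mpr fun l => ?_)
      (contDiff_snd.comp contDiff_snd)
    exact (contDiff_fillRow (E := E) contDiff_fst (contDiff_fst.comp contDiff_snd) i l).sub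
      contDiff_const
  have hrank : Module.finrank ℝ E ≤ 2 * n * (n + 1) - 1 := by
    obtain ⟨m, rfl⟩ : ∃ m, n = m + 1 := ⟨n - 1, by have := j.pos; omega⟩
    simp only [E, Module.finrank_prod, Module.finrank_pi_fintype, Module.finrank_self,
      Finset.sum_const, Finset.card_univ, Fintype.card_fin, smul_eq_mul, mul_one,
      Fintype.card_subtype_compl, Fintype.card_unique]
    refine Nat.le_sub_of_add_le ?_
    simp only [Nat.add_sub_cancel]
    nlinarith
  refine le_trans ?_ (Nat.cast_le.mpr hrank)
  refine (dimH_mono ?_).trans (dimH_image_le_finrank convex_univ hΦ.contDiffOn)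
  rintro q ⟨w, hw⟩
  refine ⟨(w, fun i => jacobianMatrix (cubicPerturbation G q) 0 i, q.2), trivial, ?_⟩
  refine Prod.ext ?_ rfl
  funext i l
  simp only [Φ, hw]
  rw [jacobianMatrix_cubicPerturbation hG]
  simp

/-- Almost all cubic perturbations of an odd map `ℝⁿ⁺¹ → ℝⁿ` have the origin as a regular
value. -/
theorem exists_regular_cubicPerturbation {n : ℕ} {G : (Fin (n + 1) → ℝ) → (Fin n → ℝ)}
    (hG : ContDiff ℝ 2 G) (hodd : ∀ x, G (-x) = -G x) {δ : ℝ} (hδ : 0 < δ) :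
    ∃ q : (Fin n → Fin (n + 1) → ℝ) × (Fin n → Fin (n + 1) → ℝ), ‖q‖ < δ ∧
      ∀ x, cubicPerturbation G q x = 0 →
        LinearIndependent ℝ (jacobianMatrix (cubicPerturbation G q) x).row := by
  rcases Nat.eq_zero_or_pos n with rfl | hn
  · exact ⟨0, by simpa using hδ, fun x _ => linearIndependent_empty_type⟩
  let bad : Set ((Fin n → Fin (n + 1) → ℝ) × (Fin n → Fin (n + 1) → ℝ)) :=
    {q | ∃ x, cubicPerturbation G q x = 0 ∧
      ¬ LinearIndependent ℝ (jacobianMatrix (cubicPerturbation G q) x).row}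
  suffices hdense : Dense badᶜ by
    obtain ⟨q, hq, hqb⟩ := hdense.exists_mem_open Metric.isOpen_ball
      ⟨0, Metric.mem_ball_self hδ⟩
    refine ⟨q, by simpa using hqb, fun x hx => ?_⟩
    by_contra hli
    exact hq ⟨x, hx, hli⟩
  refine dense_compl_of_dimH_lt_finrank ?_
  have hsub : bad ⊆
      (⋃ j : Fin n, {q | ∃ w : {i // i ≠ j} → ℝ,
        fillRow j w (fun i => jacobianMatrix (cubicPerturbation G q) 0 i) =
          jacobianMatrix (cubicPerturbation G q) 0}) ∪
      ⋃ (j : Fin n) (k : Fin (n + 1)), {q | ∃ x, 0 < x k ∧ cubicPerturbation G q x = 0 ∧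
        ∃ w : {i // i ≠ j} → ℝ,
          fillRow j w (fun i => jacobianMatrix (cubicPerturbation G q) x i) =
            jacobianMatrix (cubicPerturbation G q) x} := by
    rintro q ⟨x, hx, hli⟩
    obtain ⟨j, w, hw⟩ := exists_fillRow_of_not_linearIndependent hli
    by_cases hx0 : x = 0
    · subst hx0
      exact Or.inl (Set.mem_iUnion.mpr ⟨j, w, hw⟩)
    right
    obtain ⟨k, hk⟩ := Function.ne_iff.mp hx0
    simp only [Set.mem_iUnion]
    refine ⟨j, k, ?_⟩
    rcases lt_or_gt_of_ne hk with hlt | hgt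
    · have hJ : jacobianMatrix (cubicPerturbation G q) (-x) =
          jacobianMatrix (cubicPerturbation G q) x := by
        unfold jacobianMatrix
        rw [fderiv_neg_of_odd (cubicPerturbation_neg hodd q)]
      refine ⟨-x, by simpa using hlt, by rw [cubicPerturbation_neg hodd, hx, neg_zero], w, ?_⟩
      rw [hJ]
      exact hw
    · exact ⟨x, hgt, hx, w, hw⟩
  have hle : dimH bad ≤ ((2 * n * (n + 1) - 1 : ℕ) : ENNReal) := by
    refine (dimH_mono hsub).trans ?_
    rw [dimH_union]
    refine max_le ?_ ?_
    · rw [dimH_iUnion]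
      exact iSup_le fun j => dimH_critical_zero_le hG j
    · simp only [dimH_iUnion]
      exact iSup_le fun j => iSup_le fun k => dimH_critical_pos_le hG j k
  refine hle.trans_lt (Nat.cast_lt.mpr ?_)
  simp only [Module.finrank_prod, Module.finrank_pi_fintype, Module.finrank_self,
    Finset.sum_const, Finset.card_univ, Fintype.card_fin, smul_eq_mul, mul_one]
  have : 0 < n * (n + 1) := by positivity
  rw [mul_assoc]
  omega

theorem exists_norm_cubicPerturbation_sub_le {n : ℕ} (R : ℝ) {ε : ℝ} (hε : 0 < ε) :
    ∃ δ > 0, ∀ (G : (Fin (n + 1) → ℝ) → (Fin n → ℝ))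
      (q : (Fin n → Fin (n + 1) → ℝ) × (Fin n → Fin (n + 1) → ℝ)), ‖q‖ < δ →
        ∀ x, ‖x‖ ≤ R → ‖cubicPerturbation G q x - G x‖ ≤ ε := by
  have hC : 0 < (n + 1) * (|R| + |R| ^ 3) + 1 := by positivity
  refine ⟨ε / ((n + 1) * (|R| + |R| ^ 3) + 1), by positivity, fun G q hq x hx => ?_⟩
  rw [lt_div_iff₀ hC] at hq
  refine (pi_norm_le_iff_of_nonneg hε.le).mpr fun i => ?_
  have hterm : ∀ l ∈ Finset.univ, ‖q.1 i l * x l + q.2 i l * x l ^ 3‖ ≤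
      ‖q‖ * (|R| + |R| ^ 3) := by
    intro l _
    have h1 : ‖q.1 i l‖ ≤ ‖q‖ :=
      ((norm_le_pi_norm _ l).trans (norm_le_pi_norm q.1 i)).trans (norm_fst_le q)
    have h2 : ‖q.2 i l‖ ≤ ‖q‖ :=
      ((norm_le_pi_norm _ l).trans (norm_le_pi_norm q.2 i)).trans (norm_snd_le q)
    have h3 : ‖x l‖ ≤ |R| := ((norm_le_pi_norm x l).trans hx).trans (le_abs_self R)
    refine (norm_add_le _ _).trans ?_
    rw [norm_mul, norm_mul, norm_pow, mul_add]
    gcongr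
  have hsum := norm_sum_le_of_le _ hterm
  simp only [Finset.sum_const, Finset.card_univ, Fintype.card_fin, nsmul_eq_mul,
    Nat.cast_add, Nat.cast_one] at hsum
  have : (cubicPerturbation G q x - G x) i = ∑ l, (q.1 i l * x l + q.2 i l * x l ^ 3) := by
    simp [cubicPerturbation]
  rw [this]
  nlinarith [norm_nonneg q]

/-- A Borsuk-type theorem: an odd continuous map `ℝⁿ⁺¹ → ℝⁿ` vanishes somewhere on the zero set of
any continuous function that is positive at the origin and negative outside of a ball. -/
theorem exists_common_zero_of_odd {n : ℕ} {F : (Fin (n + 1) → ℝ) → (Fin n → ℝ)}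
    (hF : Continuous F) (hodd : ∀ x, F (-x) = -F x)
    {h : (Fin (n + 1) → ℝ) → ℝ} (hc : Continuous h) (h0 : 0 < h 0) {R : ℝ}
    (hR : ∀ x, 0 ≤ h x → ‖x‖ ≤ R) : ∃ x, F x = 0 ∧ h x = 0 := by
  by_contra! hno
  have hcpt : IsCompact {x | h x = 0} :=
    (isCompact_closedBall 0 R).of_isClosed_subset (isClosed_eq hc continuous_const)
      fun x hx => by simpa using hR x (le_of_eq (Eq.symm hx))
  obtain ⟨ε, hε, hεF⟩ : ∃ ε > 0, ∀ x, h x = 0 → ε ≤ ‖F x‖ := by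
    rcases Set.eq_empty_or_nonempty {x | h x = 0} with he | hne
    · exact ⟨1, one_pos, fun x hx => absurd (show x ∈ {x | h x = 0} from hx) (by simp [he])⟩
    · obtain ⟨x, hx, hmin⟩ := hcpt.exists_isMinOn hne hF.norm.continuousOn
      exact ⟨‖F x‖, norm_pos_iff.mpr fun h1 => hno x h1 hx, fun y hy => hmin hy⟩
  obtain ⟨G, hG, hGF, -⟩ := hF.exists_contDiff_approx 2
    (ε := fun _ => ε / 2) continuous_const fun _ => half_pos hε
  let G' : (Fin (n + 1) → ℝ) → (Fin n → ℝ) := fun x => (1 / 2 : ℝ) • (G x - G (-x))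
  have hG' : ContDiff ℝ 2 G' := (hG.sub (hG.comp contDiff_neg)).const_smul (1 / 2 : ℝ)
  have hG'odd : ∀ x, G' (-x) = -G' x := fun x => by
    simp only [G', neg_neg, ← smul_neg, neg_sub]
  have hG'F : ∀ x, ‖G' x - F x‖ < ε / 2 := fun x => by
    have h1 : G' x - F x = (1 / 2 : ℝ) • ((G x - F x) - (G (-x) - F (-x))) := by
      simp only [G', hodd]
      module
    rw [h1, norm_smul]
    have h2 := hGF x
    have h3 := hGF (-x)
    rw [dist_eq_norm] at h2 h3
    have h4 := norm_sub_le (G x - F x) (G (-x) - F (-x))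
    norm_num
    linarith
  obtain ⟨δ, hδ, hδP⟩ := exists_norm_cubicPerturbation_sub_le (n := n) R (half_pos hε)
  obtain ⟨q, hq, hreg⟩ := exists_regular_cubicPerturbation hG' hG'odd hδ
  obtain ⟨x, hx, hhx⟩ := exists_common_zero_of_regular (contDiff_cubicPerturbation hG' q)
    (cubicPerturbation_neg hG'odd q) hreg hc h0 hR
  have h1 := hδP G' q hq x (hR x hhx.ge)
  rw [hx, zero_sub, norm_neg] at h1
  have h2 := hεF x hhx
  have h3 := norm_sub_norm_le (F x) (G' x)
  rw [norm_sub_rev] at h3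
  linarith [hG'F x]

theorem exists_continuous_truncated_depth {E : Type*} [NormedAddCommGroup E] {U : Set E}
    (hU : IsOpen U) (h0 : 0 ∈ U) (hb : Bornology.IsBounded U) (hne : Uᶜ.Nonempty) :
    ∃ (u : E → ℝ) (ρ R : ℝ), Continuous u ∧ 0 < ρ ∧ (∀ x, ‖x‖ ≤ ρ → u x = ρ) ∧
      (∀ x, u x ≤ ρ) ∧ (∀ x, u x = 0 → x ∈ frontier U) ∧ ∀ x, 0 ≤ u x → ‖x‖ ≤ R := by
  obtain ⟨r, hr, hrU⟩ := Metric.isOpen_iff.mp hU 0 h0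
  obtain ⟨R, hR⟩ := isBounded_iff_forall_norm_le.mp hb.closure
  have hUne : U.Nonempty := ⟨0, h0⟩
  refine ⟨fun x => min (r / 2) (Metric.infDist x Uᶜ) - Metric.infDist x U, r / 2, R,
    ?_, half_pos hr, fun x hx => ?_, fun x => ?_, fun x hx => ?_, fun x hx => ?_⟩
  · exact (continuous_const.min (Metric.continuous_infDist_pt _)).sub
      (Metric.continuous_infDist_pt _)
  · have hxU : x ∈ U := hrU (by rw [mem_ball_zero_iff]; linarith)
    dsimp only
    rw [Metric.infDist_zero_of_mem hxU, sub_zero, min_eq_left]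
    refine (Metric.le_infDist hne).mpr fun y hy => ?_
    have h1 : r ≤ ‖y‖ := by
      by_contra! h2
      exact hy (hrU (by simpa using h2))
    rw [dist_eq_norm, norm_sub_rev]
    linarith [norm_sub_norm_le y x]
  · linarith [min_le_left (r / 2) (Metric.infDist x Uᶜ), Metric.infDist_nonneg (x := x) (s := U)]
  · dsimp only at hx
    by_cases hxU : x ∈ U
    · rw [Metric.infDist_zero_of_mem hxU, sub_zero] at hx
      have h1 : Metric.infDist x Uᶜ = 0 := by
        rcases min_choice (r / 2) (Metric.infDist x Uᶜ) with h | h <;> linarith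
      exact absurd hxU ((hU.isClosed_compl.mem_iff_infDist_zero hne).mpr h1)
    · rw [Metric.infDist_zero_of_mem (Set.mem_compl hxU), min_eq_right (half_pos hr).le] at hx
      rw [hU.frontier_eq]
      exact ⟨(Metric.mem_closure_iff_infDist_zero hUne).mpr (by linarith), hxU⟩
  · refine hR x ?_
    by_cases hxU : x ∈ U
    · exact subset_closure hxU
    · dsimp only at hx
      rw [Metric.infDist_zero_of_mem (Set.mem_compl hxU), min_eq_right (half_pos hr).le] at hx
      exact (Metric.mem_closure_iff_infDist_zero hUne).mpr
        (by linarith [Metric.infDist_nonneg (x := x) (s := U)])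

/-- A continuous map to `ℝᵐ` takes the same value at the endpoints of
some segment through the origin with endpoints on the frontier of a bounded open neighbourhood of
the origin in `ℝᵐ⁺¹`. -/
theorem exists_frontier_pair_of_isOpen {m : ℕ} {E : Type*} [NormedAddCommGroup E]
    [NormedSpace ℝ E] (L : (Fin (m + 1) → ℝ) ≃L[ℝ] E) {U : Set E} (hU : IsOpen U) (h0 : 0 ∈ U)
    (hb : Bornology.IsBounded U) {f : E → Fin m → ℝ} (hf : Continuous f) :
    ∃ y ∈ frontier U, ∃ z ∈ frontier U, (0 : E) ∈ segment ℝ y z ∧ f y = f z := by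
  have : Nontrivial E := L.symm.toEquiv.nontrivial
  have hne : Uᶜ.Nonempty := by
    rw [Set.nonempty_compl]
    rintro rfl
    exact NormedSpace.unbounded_univ ℝ E hb
  obtain ⟨u, ρ, R, hu, hρ, huball, hule, hufr, huR⟩ :=
    exists_continuous_truncated_depth hU h0 hb hne
  obtain ⟨Q, hQ, hQR⟩ : ∃ Q : ℝ, 0 < Q ∧ Real.exp (-2 * Q) * R ≤ ρ := by
    have h1 : Filter.Tendsto (fun Q : ℝ => Real.exp (-2 * Q) * R) Filter.atTop (nhds (0 * R)) := by
      refine Filter.Tendsto.mul_const R (Real.tendsto_exp_atBot.comp ?_)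
      exact Filter.tendsto_id.const_mul_atTop_of_neg (by norm_num)
    rw [zero_mul] at h1
    obtain ⟨Q, h2, h3⟩ := ((h1.eventually (ge_mem_nhds hρ)).and
      (Filter.eventually_gt_atTop 0)).exists
    exact ⟨Q, h3, h2⟩
  let φ : ℝ → ℝ := fun q => max (q - Q) 0 - max (-q - Q) 0
  let y : (Fin (m + 1 + 1) → ℝ) → E := fun p => Real.exp (p 0) • L (Fin.tail p)
  let z : (Fin (m + 1 + 1) → ℝ) → E := fun p => -(Real.exp (-p 0) • L (Fin.tail p))
  have htail : Continuous (Fin.tail : (Fin (m + 1 + 1) → ℝ) → Fin (m + 1) → ℝ) :=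
    continuous_pi fun i => continuous_apply i.succ
  have hy : Continuous y :=
    (Real.continuous_exp.comp (continuous_apply 0)).smul (L.continuous.comp htail)
  have hz : Continuous z :=
    ((Real.continuous_exp.comp (continuous_apply 0).neg).smul (L.continuous.comp htail)).neg
  have htailneg : ∀ p : Fin (m + 1 + 1) → ℝ, Fin.tail (-p) = -Fin.tail p := fun p => rfl
  have hyneg : ∀ p, y (-p) = z p := fun p => by
    simp only [y, z, htailneg, map_neg, smul_neg, Pi.neg_apply]
  have hzneg : ∀ p, z (-p) = y p := fun p => by
    rw [← hyneg, neg_neg]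
  let F : (Fin (m + 1 + 1) → ℝ) → (Fin (m + 1) → ℝ) := fun p =>
    Fin.cons (u (y p) - u (z p) - φ (p 0)) (f (y p) - f (z p))
  let h : (Fin (m + 1 + 1) → ℝ) → ℝ := fun p => min (min (u (y p)) (u (z p))) (Q + 1 - |p 0|)
  have hF : Continuous F := by
    refine continuous_pi fun i => ?_
    refine Fin.cases ?_ (fun i => ?_) i
    · simp only [F, Fin.cons_zero, φ]
      fun_prop
    · simp only [F, Fin.cons_succ]
      fun_prop
  have hFodd : ∀ p, F (-p) = -F p := fun p => by
    ext i
    refine Fin.cases ?_ (fun i => ?_) i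
    · simp only [F, Fin.cons_zero, φ, hyneg, hzneg, Pi.neg_apply, neg_neg]
      ring
    · simp only [F, Fin.cons_succ, hyneg, hzneg, Pi.neg_apply, Pi.sub_apply]
      ring
  have hcont : Continuous h := by fun_prop
  have hu0 : u 0 = ρ := huball 0 (by simpa using hρ.le)
  have hh0 : 0 < h 0 := by
    have h1 : Fin.tail (0 : Fin (m + 1 + 1) → ℝ) = 0 := rfl
    simp only [h, y, z, h1, map_zero, smul_zero, neg_zero, hu0, Pi.zero_apply, abs_zero, sub_zero,
      min_self]
    exact lt_min hρ (by linarith)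
  have hbound : ∀ p, 0 ≤ h p →
      ‖p‖ ≤ max (Q + 1) (‖(L.symm : E →L[ℝ] (Fin (m + 1) → ℝ))‖ * (Real.exp (Q + 1) * R)) := by
    intro p hp
    have h1 : |p 0| ≤ Q + 1 := by linarith [hp.trans (min_le_right _ _)]
    have h2 := huR _ ((hp.trans (min_le_left _ _)).trans (min_le_left _ _))
    have h3 : Fin.tail p = L.symm (Real.exp (-p 0) • y p) := by
      simp only [y, smul_smul, ← Real.exp_add, neg_add_cancel, Real.exp_zero, one_smul,
        ContinuousLinearEquiv.symm_apply_apply]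
    refine (pi_norm_le_iff_of_nonneg (le_max_of_le_left (by linarith))).mpr fun i => ?_
    refine Fin.cases ?_ (fun i => ?_) i
    · exact le_max_of_le_left h1
    · refine le_max_of_le_right ((norm_le_pi_norm (Fin.tail p) i).trans ?_)
      rw [h3]
      refine ((L.symm : E →L[ℝ] (Fin (m + 1) → ℝ)).le_opNorm _).trans ?_
      rw [norm_smul, Real.norm_eq_abs, Real.abs_exp]
      gcongr
      linarith [neg_abs_le (p 0)]
  obtain ⟨p, hFp, hhp⟩ := exists_common_zero_of_odd hF hFodd hcont hh0 hbound
  have hFu : u (y p) - u (z p) - φ (p 0) = 0 := congrFun hFp 0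
  have hFf : f (y p) = f (z p) := by
    funext i
    have h1 : f (y p) i - f (z p) i = 0 := congrFun hFp i.succ
    linarith
  have huy : 0 ≤ u (y p) := (hhp.ge.trans (min_le_left _ _)).trans (min_le_left _ _)
  have huz : 0 ≤ u (z p) := (hhp.ge.trans (min_le_left _ _)).trans (min_le_right _ _)
  have hshrink : ∀ (a : E) (q : ℝ), Q < q → ‖Real.exp q • a‖ ≤ R → ‖Real.exp (-q) • a‖ ≤ ρ := by
    intro a q hq ha
    have h1 : Real.exp (-q) • a = Real.exp (-2 * q) • Real.exp q • a := by
      rw [smul_smul, ← Real.exp_add]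
      ring_nf
    rw [h1, norm_smul, Real.norm_eq_abs, Real.abs_exp]
    refine le_trans ?_ hQR
    exact mul_le_mul (Real.exp_le_exp.mpr (by linarith)) ha (norm_nonneg _) (Real.exp_pos _).le
  have hle : p 0 ≤ Q := by
    by_contra! hlt
    have h1 : u (z p) = ρ := huball _ (by
      simp only [z, norm_neg]
      exact hshrink _ _ hlt (huR _ huy))
    have h2 : φ (p 0) = p 0 - Q := by
      simp only [φ]
      rw [max_eq_left (by linarith), max_eq_right (by linarith), sub_zero]
    linarith [hule (y p)]
  have hge : -Q ≤ p 0 := by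
    by_contra! hlt
    have h1 : u (y p) = ρ := huball _ (by
      have h3 := hshrink (L (Fin.tail p)) (-p 0) (by linarith)
        (by simpa only [z, norm_neg] using huR _ huz)
      rwa [neg_neg] at h3)
    have h2 : φ (p 0) = -(-p 0 - Q) := by
      simp only [φ]
      rw [max_eq_right (by linarith), max_eq_left (by linarith), zero_sub]
    linarith [hule (z p)]
  have hφ : φ (p 0) = 0 := by
    simp only [φ]
    rw [max_eq_right (by linarith), max_eq_right (by linarith), sub_zero]
  have heq : u (y p) = u (z p) := by linarith
  have habs : |p 0| ≤ Q := abs_le.mpr ⟨hge, hle⟩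
  have hy0 : u (y p) = 0 := by
    have h1 : min (min (u (y p)) (u (z p))) (Q + 1 - |p 0|) = 0 := hhp
    rw [← heq, min_self] at h1
    rcases min_choice (u (y p)) (Q + 1 - |p 0|) with h2 | h2 <;> linarith
  refine ⟨y p, hufr _ hy0, z p, hufr _ (heq ▸ hy0), ?_, hFf⟩
  have hS : 0 < Real.exp (p 0) + Real.exp (-p 0) := by positivity
  refine ⟨Real.exp (-p 0) / (Real.exp (p 0) + Real.exp (-p 0)),
    Real.exp (p 0) / (Real.exp (p 0) + Real.exp (-p 0)), by positivity, by positivity, ?_, ?_⟩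
  · field_simp
    ring
  · simp only [y, z, smul_neg, smul_smul]
    rw [div_mul_eq_mul_div, div_mul_eq_mul_div, mul_comm (Real.exp (-p 0)), add_neg_cancel]

/-- A continuous map to `ℝᵐ` on the frontier of a compact subset `W` of an `m + 1`-dimensional
space takes the same value at the endpoints of some chord through any given point of `W`. -/
theorem exists_frontier_pair_of_isCompact {m : ℕ} {E : Type*} [NormedAddCommGroup E]
    [NormedSpace ℝ E] (L : (Fin (m + 1) → ℝ) ≃L[ℝ] E) {W : Set E} (hW : IsCompact W)
    {f : E → Fin m → ℝ} (hf : Continuous f) {x : E} (hx : x ∈ W) :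
    ∃ y ∈ frontier W, ∃ z ∈ frontier W, x ∈ segment ℝ y z ∧ f y = f z := by
  by_cases hxi : x ∈ interior W
  · have hfr : ∀ v, v ∈ frontier ((fun v => x + v) ⁻¹' interior W) → x + v ∈ frontier W := by
      intro v hv
      have h1 := (Homeomorph.addLeft x).preimage_frontier (interior W)
      rw [Homeomorph.coe_addLeft] at h1
      rw [← h1] at hv
      exact frontier_interior_subset hv
    obtain ⟨y, hy, z, hz, hseg, hyz⟩ := exists_frontier_pair_of_isOpen L
      (U := (fun v => x + v) ⁻¹' interior W)
      (isOpen_interior.preimage (continuous_const_add x)) (by simpa using hxi)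
      ((IsometryEquiv.addLeft x).isometry.antilipschitz.isBounded_preimage
        (hW.isBounded.subset interior_subset))
      (f := fun v => f (x + v)) (hf.comp (continuous_const_add x))
    refine ⟨x + y, hfr y hy, x + z, hfr z hz, ?_, hyz⟩
    have h2 := (mem_segment_translate ℝ x).mpr hseg
    rwa [add_zero] at h2
  · have h1 : x ∈ frontier W := ⟨subset_closure hx, hxi⟩
    exact ⟨x, h1, x, h1, by simp, rfl⟩

theorem isCompact_chord_values {E V : Type*} [NormedAddCommGroup E] [NormedSpace ℝ E]
    [TopologicalSpace V] [T2Space V] {W : Set E} (hW : IsCompact W) {f : E → V}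
    (hf : Continuous f) :
    IsCompact {p : E × V | p.1 ∈ W ∧ ∃ x₁ ∈ frontier W, ∃ x₂ ∈ frontier W,
      p.1 ∈ segment ℝ x₁ x₂ ∧ f x₁ = p.2 ∧ f x₂ = p.2} := by
  have hfr : IsCompact (frontier W) :=
    hW.of_isClosed_subset isClosed_frontier hW.isClosed.frontier_subset
  have hK : IsCompact ((frontier W ×ˢ frontier W ×ˢ Set.Icc (0 : ℝ) 1) ∩
      ({a : E × E × ℝ | f a.1 = f a.2.1} ∩ {a | (1 - a.2.2) • a.1 + a.2.2 • a.2.1 ∈ W})) := by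
    refine (hfr.prod (hfr.prod isCompact_Icc)).inter_right (IsClosed.inter ?_ ?_)
    · exact isClosed_eq (by fun_prop) (by fun_prop)
    · exact hW.isClosed.preimage (by fun_prop :
        Continuous fun a : E × E × ℝ => (1 - a.2.2) • a.1 + a.2.2 • a.2.1)
  refine (congrArg IsCompact ?_).mp (hK.image (f := fun a : E × E × ℝ =>
    ((1 - a.2.2) • a.1 + a.2.2 • a.2.1, f a.1)) (by fun_prop))
  ext ⟨x, v⟩
  constructor
  · rintro ⟨⟨x₁, x₂, t⟩, ⟨⟨h1, h2, ht⟩, heq, hmem⟩, he⟩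
    obtain ⟨rfl, rfl⟩ := Prod.mk.inj he
    exact ⟨hmem, x₁, h1, x₂, h2, ⟨1 - t, t, by linarith [ht.2], ht.1, by ring, rfl⟩, rfl,
      Eq.symm heq⟩
  · rintro ⟨hx, x₁, h1, x₂, h2, ⟨a, b, ha, hb, hab, he⟩, hv1, hv2⟩
    obtain rfl : a = 1 - b := by linarith
    refine ⟨(x₁, x₂, b), ⟨⟨h1, h2, hb, by linarith⟩, hv1.trans hv2.symm, ?_⟩, Prod.ext he hv1⟩
    change (1 - b) • x₁ + b • x₂ ∈ W
    rw [he]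
    exact hx

/-- For a compact `n`-manifold with boundary `W ⊆ ℝ^n` (charted on the euclidean
half-space, with the manifold boundary equal to the topological frontier of `W`
in `ℝ^n`) and a continuous `f : ∂W → ℝ^{n-1}`, the set
`Z = {(x,v) : ∃ x₁ x₂ ∈ ∂W, x ∈ [x₁,x₂], f(x₁) = v = f(x₂)}` is compact and
projects onto `W`. -/
theorem stmt11 (n : ℕ) (hn : 2 ≤ n) [NeZero n]
    (W : Set (EuclideanSpace ℝ (Fin n)))
    (hWcpt : IsCompact W)
    [ChartedSpace (EuclideanHalfSpace n) ↥W]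
    (hbd : Subtype.val '' ((𝓡∂ n).boundary ↥W) = frontier W)
    (f : EuclideanSpace ℝ (Fin n) → EuclideanSpace ℝ (Fin (n - 1)))
    (hf : ContinuousOn f (frontier W))
    (Z : Set (EuclideanSpace ℝ (Fin n) × EuclideanSpace ℝ (Fin (n - 1))))
    (hZ : Z = {p | p.1 ∈ W ∧ ∃ x₁ ∈ frontier W, ∃ x₂ ∈ frontier W,
      p.1 ∈ segment ℝ x₁ x₂ ∧ f x₁ = p.2 ∧ f x₂ = p.2}) :
    IsCompact Z ∧ ∀ x ∈ W, ∃ v, (x, v) ∈ Z := by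
  let e := EuclideanSpace.equiv (Fin (n - 1)) ℝ
  obtain ⟨g, hg⟩ := ContinuousMap.exists_restrict_eq (isClosed_frontier (s := W))
    ⟨fun x => e (f x), e.continuous.comp hf.domRestrict⟩
  have hgf : ∀ x ∈ frontier W, e.symm (g x) = f x := fun x hx => by
    rw [show g x = e (f x) from DFunLike.congr_fun hg ⟨x, hx⟩, e.symm_apply_apply]
  have hZg : Z = {p | p.1 ∈ W ∧ ∃ x₁ ∈ frontier W, ∃ x₂ ∈ frontier W,
      p.1 ∈ segment ℝ x₁ x₂ ∧ e.symm (g x₁) = p.2 ∧ e.symm (g x₂) = p.2} := by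
    rw [hZ]
    ext p
    refine and_congr_right fun _ => exists_congr fun x₁ => and_congr_right fun h1 =>
      exists_congr fun x₂ => and_congr_right fun h2 => ?_
    rw [hgf x₁ h1, hgf x₂ h2]
  refine ⟨?_, fun x hx => ?_⟩
  · rw [hZg]
    exact isCompact_chord_values hWcpt (e.symm.continuous.comp g.continuous)
  · have L : (Fin (n - 1 + 1) → ℝ) ≃L[ℝ] EuclideanSpace ℝ (Fin n) :=
      ContinuousLinearEquiv.ofFinrankEq (by simp; omega)
    obtain ⟨y, hy, z, hz, hseg, hyz⟩ := exists_frontier_pair_of_isCompact L hWcpt g.continuous hx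
    refine ⟨e.symm (g y), ?_⟩
    rw [hZg]
    exact ⟨hx, y, hy, z, hz, hseg, rfl, congrArg e.symm hyz.symm⟩
end
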